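/- Fix α > 1, p ≥ 0, H ∈ ℕ and a strictly increasing σ : {1,…,H} → ℤ with σ(1) > −H, and let (z, h₁,…,h_H, ω) be a solution of the standard IBA equation. Then: (i) for every n ∈ ℕ, the function x ↦ Dⁿz(x) − ((α+1)/(2α))ⁿ·x^{(1+α)/(2α)} is bounded on [ω,∞); (ii) setting λ(ξ) = z(ωξ) − l̄(ξ; ω, p) for ξ ≥ 1, where l̄ is the rescaled solution of the linearised IBA equation, one has sup_{ξ≥1}|λ(ξ)| ≤ (H + 1/4)(α − 1), and for every n ≥ 1 there is a constant C_n (depending only on α, H, n) with sup_{ξ≥1}|Dⁿλ(ξ)| ≤ C_n. -/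

import Mathlib

open Real MeasureTheory Set Filter Topology Asymptotics

noncomputable section

/-- The function `F_α`. -/
def Fa (α x : ℝ) : ℝ :=
  (Real.sin (2 * π / (1 + α)) / π) *
    ∫ y in (0:ℝ)..x, 1 / (1 + y ^ 2 - 2 * y * Real.cos (2 * π / (1 + α)))

/-- The kernel `K_α`. -/
def Ka (α x : ℝ) : ℝ :=
  (Real.sin (2 * π / (1 + α)) / π) *
    (x / (1 + x ^ 2 - 2 * x * Real.cos (2 * π / (1 + α))))

/-- The convolution operator 𝕂_J. -/
def Kconv (α : ℝ) (J : Set ℝ) (f : ℝ → ℝ) (x : ℝ) : ℝ :=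
  ∫ y in J, Ka α (x / y) * f y / y

/-- The Euler operator D = x d/dx, with the derivative taken within a set. -/
def eulerDW (s : Set ℝ) (f : ℝ → ℝ) : ℝ → ℝ := fun x => x * derivWithin f s x

/-- A solution of the standard IBA equation, for the data H and σ. -/
structure StdIBASolution (α p : ℝ) (H : ℕ) : Type where
  σ : Fin H → ℤ
  σmono : StrictMono σ
  σlb : ∀ i, -(H : ℤ) < σ i
  ω : ℝ
  ωpos : 0 < ω
  h : Fin H → ℝ
  hgt : ∀ i, ω < h i
  hmono : StrictMono h
  z : ℝ → ℝ
  zcont : ContinuousOn z (Set.Ici ω)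
  znorm : Tendsto (fun x : ℝ => x ^ (-((1 + α) / (2 * α))) * z x) atTop (𝓝 1)
  iba : ∀ x, ω ≤ x → z x = -2 * p
      + Kconv α (Set.Ici ω) (fun y => (⌈z y - 1/2⌉ : ℝ)) x
      + (H : ℝ) * Fa α (x / ω) - ∑ i, Fa α (x / h i)
  holes : ∀ i, z (h i) = (σ i : ℝ) + 1/2
  ceilω : ⌈z ω - 1/2⌉ = -(H : ℤ)

/-- V(u;x) = x u² − u^{2α+2} − 1. -/
def Vfun (α x u : ℝ) : ℝ := x * u ^ 2 - u ^ (2 * α + 2) - 1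

/-- ρ = ((α+1)/α)·α^{1/(α+1)}. -/
def rhoC (α : ℝ) : ℝ := ((α + 1) / α) * α ^ (1 / (α + 1))

/-- The smaller positive root u₁(x) of V(·;x). -/
def u1F (α x : ℝ) : ℝ := sInf {u : ℝ | 0 < u ∧ Vfun α x u = 0}

/-- The larger positive root u₂(x) of V(·;x). -/
def u2F (α x : ℝ) : ℝ := sSup {u : ℝ | 0 < u ∧ Vfun α x u = 0}

/-- The WKB integral S(x). -/
def Sfun (α x : ℝ) : ℝ :=
  if rhoC α < x then (1/π) * ∫ u in u1F α x..u2F α x, Real.sqrt (Vfun α x u) / u else 0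

/-- τ(ξ) = 2(1+α)·S(ρξ). -/
def tauF (α ξ : ℝ) : ℝ := 2 * (1 + α) * Sfun α (rhoC α * ξ)

/-- The constant A. -/
def Aconst (α : ℝ) : ℝ :=
  (1 + α) * (Real.Gamma (1 / (2 * α)) /
    (Real.sqrt (π * α) * Real.Gamma ((1 + α) / (2 * α)))) ^ (2 * α / (α + 1))

/-- The rescaled solution l̄(ξ; ω, p) of the linearised IBA equation. -/
def lbar (α ω p ξ : ℝ) : ℝ :=
  p * tauF α ξ - (2 * α / (1 + α)) * (p - (ω / Aconst α) ^ ((1 + α) / (2 * α))) *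
    eulerDW (Set.Ici 1) (tauF α) ξ

/-! ### The kernel -/

/-- The angle `2π/(1+α)` of the kernel. -/
def kerAngle (α : ℝ) : ℝ := 2 * π / (1 + α)

/-- The growth exponent `(1+α)/(2α)`. -/
def growthExp (α : ℝ) : ℝ := (1 + α) / (2 * α)

/-- The total mass `(α-1)/(α+1)` of the kernel with respect to `dy/y`. -/
def kerMass (α : ℝ) : ℝ := (α - 1) / (α + 1)

/-- The denominator of the kernel. -/
def kerDen (α x : ℝ) : ℝ := 1 + x ^ 2 - 2 * x * Real.cos (kerAngle α)

lemma kerAngle_pos {α : ℝ} (hα : 1 < α) : 0 < kerAngle α := by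
  unfold kerAngle; have := Real.pi_pos; positivity

lemma kerAngle_lt_pi {α : ℝ} (hα : 1 < α) : kerAngle α < π := by
  unfold kerAngle
  rw [div_lt_iff₀ (by linarith)]
  nlinarith [Real.pi_pos]

lemma sin_kerAngle_pos {α : ℝ} (hα : 1 < α) : 0 < Real.sin (kerAngle α) :=
  Real.sin_pos_of_pos_of_lt_pi (kerAngle_pos hα) (kerAngle_lt_pi hα)

lemma growthExp_pos {α : ℝ} (hα : 1 < α) : 0 < growthExp α := by
  unfold growthExp; positivity

lemma growthExp_lt_one {α : ℝ} (hα : 1 < α) : growthExp α < 1 := by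
  unfold growthExp; rw [div_lt_one (by linarith)]; linarith

lemma kerMass_pos {α : ℝ} (hα : 1 < α) : 0 < kerMass α := by
  unfold kerMass; exact div_pos (by linarith) (by linarith)

lemma one_sub_kerMass {α : ℝ} (hα : 1 < α) : 1 - kerMass α = 2 / (α + 1) := by
  unfold kerMass; have : α + 1 ≠ 0 := by linarith
  field_simp; ring

lemma kerMass_lt_one {α : ℝ} (hα : 1 < α) : kerMass α < 1 := by
  have h := one_sub_kerMass hα
  have : 0 < 2 / (α + 1) := by apply div_pos <;> linarith
  linarith

lemma pi_sub_kerAngle {α : ℝ} (hα : 1 < α) : (π - kerAngle α) / π = kerMass α := by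
  unfold kerAngle kerMass
  have : α + 1 ≠ 0 := by linarith
  have := Real.pi_ne_zero
  rw [add_comm 1 α]
  field_simp; ring

/-- The comparison constant `1 - |cos(kerAngle α)|`. -/
def kerGap (α : ℝ) : ℝ := 1 - |Real.cos (kerAngle α)|

lemma kerGap_pos {α : ℝ} (hα : 1 < α) : 0 < kerGap α := by
  unfold kerGap
  have h := Real.sin_sq_add_cos_sq (kerAngle α)
  have hs := sin_kerAngle_pos hα
  have : |Real.cos (kerAngle α)| < 1 := by
    rw [← sq_lt_one_iff_abs_lt_one]
    nlinarith
  linarith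

lemma kerGap_mul_le_kerDen (α x : ℝ) : kerGap α * (1 + x ^ 2) ≤ kerDen α x := by
  unfold kerGap kerDen
  have h1 : 2 * x * Real.cos (kerAngle α) ≤ (1 + x ^ 2) * |Real.cos (kerAngle α)| := by
    calc 2 * x * Real.cos (kerAngle α) ≤ |2 * x * Real.cos (kerAngle α)| := le_abs_self _
      _ = |2 * x| * |Real.cos (kerAngle α)| := abs_mul _ _
      _ ≤ _ := by
        gcongr
        rw [abs_le]; constructor <;> nlinarith [sq_nonneg (x - 1), sq_nonneg (x + 1)]
  linarith

lemma kerDen_pos {α : ℝ} (hα : 1 < α) (x : ℝ) : 0 < kerDen α x :=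
  lt_of_lt_of_le (mul_pos (kerGap_pos hα) (by positivity)) (kerGap_mul_le_kerDen α x)

lemma kerDen_eq (α x : ℝ) :
    kerDen α x = (x - Real.cos (kerAngle α)) ^ 2 + Real.sin (kerAngle α) ^ 2 := by
  unfold kerDen
  have h := Real.sin_sq_add_cos_sq (kerAngle α)
  nlinarith

lemma Ka_eq (α x : ℝ) : Ka α x = (Real.sin (kerAngle α) / π) * (x / kerDen α x) := rfl

lemma Fa_eq (α x : ℝ) :
    Fa α x = (Real.sin (kerAngle α) / π) * ∫ y in (0:ℝ)..x, 1 / kerDen α y := rfl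

lemma Ka_pos {α : ℝ} (hα : 1 < α) {x : ℝ} (hx : 0 < x) : 0 < Ka α x := by
  rw [Ka_eq]
  have := sin_kerAngle_pos hα
  have := kerDen_pos hα x
  have := Real.pi_pos
  positivity

lemma continuous_kerDen (α : ℝ) : Continuous (kerDen α) := by
  unfold kerDen; fun_prop

lemma continuous_Ka {α : ℝ} (hα : 1 < α) : Continuous (Ka α) := by
  have : Ka α = fun x => (Real.sin (kerAngle α) / π) * (x / kerDen α x) := rfl
  rw [this]
  exact continuous_const.mul (continuous_id.div (continuous_kerDen α)
    fun x => (kerDen_pos hα x).ne')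

lemma hasDerivAt_Fa {α : ℝ} (hα : 1 < α) {x : ℝ} (hx : x ≠ 0) :
    HasDerivAt (Fa α) (Ka α x / x) x := by
  have hc : Continuous fun y => 1 / kerDen α y :=
    continuous_const.div (continuous_kerDen α) fun x => (kerDen_pos hα x).ne'
  have h := (intervalIntegral.integral_hasDerivAt_right (hc.intervalIntegrable 0 x)
    (hc.stronglyMeasurableAtFilter _ _) hc.continuousAt).const_mul (Real.sin (kerAngle α) / π)
  have h2 : Ka α x / x = (Real.sin (kerAngle α) / π) * (1 / kerDen α x) := by
    rw [Ka_eq]; field_simp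
  rw [h2]; exact h

lemma Fa_zero (α : ℝ) : Fa α 0 = 0 := by simp [Fa]

lemma continuous_Fa {α : ℝ} (hα : 1 < α) : Continuous (Fa α) := by
  have hc : Continuous fun y => 1 / kerDen α y :=
    continuous_const.div (continuous_kerDen α) fun x => (kerDen_pos hα x).ne'
  have : Fa α = fun x => (Real.sin (kerAngle α) / π) * ∫ y in (0:ℝ)..x, 1 / kerDen α y := rfl
  rw [this]
  exact continuous_const.mul (intervalIntegral.continuous_primitive
    (fun a b => hc.intervalIntegrable a b) 0)

lemma Fa_eq_arctan {α : ℝ} (hα : 1 < α) (x : ℝ) :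
    Fa α x = (1 / π) * (Real.arctan ((x - Real.cos (kerAngle α)) / Real.sin (kerAngle α)) -
      (kerAngle α - π / 2)) := by
  have hs := sin_kerAngle_pos hα
  have hpi := Real.pi_pos
  have hd : ∀ y : ℝ, HasDerivAt (fun y => (1 / Real.sin (kerAngle α)) *
      Real.arctan ((y - Real.cos (kerAngle α)) / Real.sin (kerAngle α))) (1 / kerDen α y) y := by
    intro y
    have h1 : HasDerivAt (fun y => (y - Real.cos (kerAngle α)) / Real.sin (kerAngle α))
        (1 / Real.sin (kerAngle α)) y := ((hasDerivAt_id y).sub_const _).div_const _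
    have h2 := (h1.arctan).const_mul (1 / Real.sin (kerAngle α))
    refine h2.congr_deriv ?_
    rw [kerDen_eq]
    field_simp
    ring
  have hc : Continuous fun y => 1 / kerDen α y :=
    continuous_const.div (continuous_kerDen α) fun x => (kerDen_pos hα x).ne'
  rw [Fa_eq, intervalIntegral.integral_eq_sub_of_hasDerivAt (fun y _ => hd y)
    (hc.intervalIntegrable 0 x)]
  have h0 : Real.arctan ((0 - Real.cos (kerAngle α)) / Real.sin (kerAngle α)) =
      kerAngle α - π / 2 := by
    have : (0 - Real.cos (kerAngle α)) / Real.sin (kerAngle α) =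
        Real.tan (kerAngle α - π / 2) := by
      rw [Real.tan_eq_sin_div_cos, Real.sin_sub_pi_div_two, Real.cos_sub_pi_div_two]; ring
    rw [this, Real.arctan_tan]
    · linarith [kerAngle_pos hα]
    · linarith [kerAngle_lt_pi hα]
  rw [h0]
  field_simp

lemma Fa_le_kerMass {α : ℝ} (hα : 1 < α) (x : ℝ) : Fa α x ≤ kerMass α := by
  rw [Fa_eq_arctan hα, ← pi_sub_kerAngle hα, one_div, div_eq_inv_mul (π - kerAngle α) π]
  have := Real.pi_pos
  refine mul_le_mul_of_nonneg_left ?_ (by positivity)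
  linarith [Real.arctan_lt_pi_div_two ((x - Real.cos (kerAngle α)) / Real.sin (kerAngle α))]

lemma Fa_mono {α : ℝ} (hα : 1 < α) : Monotone (Fa α) := by
  intro x y hxy
  rw [Fa_eq_arctan hα, Fa_eq_arctan hα]
  have := Real.pi_pos
  have := sin_kerAngle_pos hα
  have h : Real.arctan ((x - Real.cos (kerAngle α)) / Real.sin (kerAngle α)) ≤
    Real.arctan ((y - Real.cos (kerAngle α)) / Real.sin (kerAngle α)) := by
    apply Real.arctan_mono
    gcongr
  gcongr

lemma Fa_nonneg {α : ℝ} (hα : 1 < α) {x : ℝ} (hx : 0 ≤ x) : 0 ≤ Fa α x := by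
  rw [← Fa_zero α]; exact Fa_mono hα hx

lemma hasDerivAt_neg_Fa_div {α : ℝ} (hα : 1 < α) {x y : ℝ} (hx : 0 < x) (hy : 0 < y) :
    HasDerivAt (fun y => -Fa α (x / y)) (Ka α (x / y) / y) y := by
  have h1 : HasDerivAt (fun y => x / y) (-x / y ^ 2) y := by
    have := (hasDerivAt_inv hy.ne').const_mul x
    refine this.congr_deriv ?_
    ring
  have h2 := ((hasDerivAt_Fa hα (div_pos hx hy).ne').comp y h1).neg
  refine h2.congr_deriv ?_
  field_simp

lemma tendsto_neg_Fa_div {α : ℝ} (hα : 1 < α) (x : ℝ) :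
    Tendsto (fun y => -Fa α (x / y)) atTop (𝓝 0) := by
  have h1 : Tendsto (fun y : ℝ => x / y) atTop (𝓝 0) := tendsto_const_nhds.div_atTop tendsto_id
  have h2 := ((continuous_Fa hα).tendsto 0).comp h1
  rw [Fa_zero] at h2
  simpa using h2.neg

lemma integrableOn_Ka_div {α : ℝ} (hα : 1 < α) {x : ℝ} (hx : 0 < x) :
    IntegrableOn (fun y => Ka α (x / y) / y) (Ioi 1) :=
  integrableOn_Ioi_deriv_of_nonneg
    (hasDerivAt_neg_Fa_div hα hx one_pos).continuousAt.continuousWithinAt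
    (fun _ hy => hasDerivAt_neg_Fa_div hα hx (lt_trans one_pos hy))
    (fun _ hy => (div_pos (Ka_pos hα (div_pos hx (lt_trans one_pos hy)))
      (lt_trans one_pos hy)).le) (tendsto_neg_Fa_div hα x)

lemma integral_Ka_div {α : ℝ} (hα : 1 < α) {x : ℝ} (hx : 0 < x) :
    ∫ y in Ioi 1, Ka α (x / y) / y = Fa α x := by
  rw [integral_Ioi_of_hasDerivAt_of_nonneg
    (hasDerivAt_neg_Fa_div hα hx one_pos).continuousAt.continuousWithinAt
    (fun _ hy => hasDerivAt_neg_Fa_div hα hx (lt_trans one_pos hy))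
    (fun _ hy => (div_pos (Ka_pos hα (div_pos hx (lt_trans one_pos hy)))
      (lt_trans one_pos hy)).le) (tendsto_neg_Fa_div hα x)]
  simp

/-! ### Euler derivatives of the kernel -/

/-- The algebra of functions generated by `x / kerDen` and `(1 - x²) / kerDen`. -/
inductive KerAlg (α : ℝ) : (ℝ → ℝ) → Prop
  | base : KerAlg α fun x => x / kerDen α x
  | logDeriv : KerAlg α fun x => (1 - x ^ 2) / kerDen α x
  | const (c : ℝ) : KerAlg α fun _ => c
  | add {f g : ℝ → ℝ} : KerAlg α f → KerAlg α g → KerAlg α fun x => f x + g x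
  | mul {f g : ℝ → ℝ} : KerAlg α f → KerAlg α g → KerAlg α fun x => f x * g x

lemma hasDerivAt_kerDen (α x : ℝ) :
    HasDerivAt (kerDen α) (2 * x - 2 * Real.cos (kerAngle α)) x := by
  have h1 := ((hasDerivAt_pow 2 x).const_add 1).sub
    (((hasDerivAt_id x).const_mul 2).mul_const (Real.cos (kerAngle α)))
  refine h1.congr_deriv ?_
  norm_num

lemma hasDerivAt_kerBase {α : ℝ} (hα : 1 < α) {x : ℝ} (hx : 0 < x) :
    HasDerivAt (fun x => x / kerDen α x)
      ((x / kerDen α x) * ((1 - x ^ 2) / kerDen α x) / x) x := by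
  have hd := (kerDen_pos hα x).ne'
  refine ((hasDerivAt_id x).div (hasDerivAt_kerDen α x) hd).congr_deriv ?_
  have hx' := hx.ne'
  simp only [id]
  field_simp
  unfold kerDen
  ring

lemma hasDerivAt_kerLogDeriv {α : ℝ} (hα : 1 < α) {x : ℝ} (hx : 0 < x) :
    HasDerivAt (fun x => (1 - x ^ 2) / kerDen α x)
      ((2 * Real.cos (kerAngle α) * (x / kerDen α x) +
        -4 * (1 - Real.cos (kerAngle α) ^ 2) * ((x / kerDen α x) * (x / kerDen α x))) / x) x := by
  have hd := (kerDen_pos hα x).ne'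
  refine (((hasDerivAt_pow 2 x).const_sub 1).div (hasDerivAt_kerDen α x) hd).congr_deriv ?_
  have hx' := hx.ne'
  field_simp
  unfold kerDen
  ring

lemma KerAlg.exists_hasDerivAt {α : ℝ} (hα : 1 < α) {f : ℝ → ℝ} (hf : KerAlg α f) :
    ∃ g, KerAlg α g ∧ ∀ x, 0 < x → HasDerivAt f (g x / x) x := by
  induction hf with
  | base => exact ⟨_, .mul .base .logDeriv, fun x hx => hasDerivAt_kerBase hα hx⟩
  | logDeriv =>
    exact ⟨_, .add (.mul (.const _) .base) (.mul (.const _) (.mul .base .base)),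
      fun x hx => hasDerivAt_kerLogDeriv hα hx⟩
  | const c =>
    exact ⟨_, .const 0, fun x _ => (hasDerivAt_const x c).congr_deriv (by simp)⟩
  | add _ _ h1 h2 =>
    obtain ⟨g1, hg1, h1⟩ := h1
    obtain ⟨g2, hg2, h2⟩ := h2
    exact ⟨_, .add hg1 hg2, fun x hx => ((h1 x hx).add (h2 x hx)).congr_deriv (by ring)⟩
  | @mul f1 f2 hf1 hf2 h1 h2 =>
    obtain ⟨g1, hg1, h1⟩ := h1
    obtain ⟨g2, hg2, h2⟩ := h2
    exact ⟨_, .add (.mul hg1 hf2) (.mul hf1 hg2),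
      fun x hx => ((h1 x hx).mul (h2 x hx)).congr_deriv (by ring)⟩

lemma KerAlg.exists_bound {α : ℝ} (hα : 1 < α) {f : ℝ → ℝ} (hf : KerAlg α f) :
    ∃ C, 0 ≤ C ∧ ∀ x, |f x| ≤ C := by
  have hk := kerGap_pos hα
  have key : ∀ x u : ℝ, |u| ≤ 1 + x ^ 2 → |u / kerDen α x| ≤ 1 / kerGap α := by
    intro x u hu
    rw [abs_div, abs_of_pos (kerDen_pos hα x), div_le_div_iff₀ (kerDen_pos hα x) hk]
    have := kerGap_mul_le_kerDen α x
    nlinarith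
  induction hf with
  | base =>
    refine ⟨1 / kerGap α, by positivity, fun x => key x x ?_⟩
    rw [abs_le]; constructor <;> nlinarith [sq_nonneg (x - 1), sq_nonneg (x + 1)]
  | logDeriv =>
    refine ⟨1 / kerGap α, by positivity, fun x => key x _ ?_⟩
    rw [abs_le]; constructor <;> nlinarith [sq_nonneg x]
  | const c => exact ⟨|c|, abs_nonneg c, fun _ => le_rfl⟩
  | add _ _ h1 h2 =>
    obtain ⟨C1, hC1, h1⟩ := h1
    obtain ⟨C2, hC2, h2⟩ := h2
    exact ⟨C1 + C2, by positivity, fun x => (abs_add_le _ _).trans (add_le_add (h1 x) (h2 x))⟩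
  | mul _ _ h1 h2 =>
    obtain ⟨C1, hC1, h1⟩ := h1
    obtain ⟨C2, hC2, h2⟩ := h2
    refine ⟨C1 * C2, by positivity, fun x => ?_⟩
    rw [abs_mul]
    exact mul_le_mul (h1 x) (h2 x) (abs_nonneg _) hC1

/-- The `n`-th Euler derivative of the kernel. -/
def kerD (α : ℝ) (n : ℕ) : ℝ → ℝ := (fun f x => x * deriv f x)^[n] (Ka α)

@[simp] lemma kerD_zero (α : ℝ) : kerD α 0 = Ka α := rfl

lemma kerD_succ (α : ℝ) (n : ℕ) (x : ℝ) : kerD α (n + 1) x = x * deriv (kerD α n) x := by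
  unfold kerD; rw [Function.iterate_succ_apply']

lemma exists_kerD_eq {α : ℝ} (hα : 1 < α) (n : ℕ) :
    ∃ g, KerAlg α g ∧ ∀ x, 0 < x → kerD α n x = Ka α x * g x := by
  induction n with
  | zero => exact ⟨_, .const 1, fun x _ => by simp⟩
  | succ n ih =>
    obtain ⟨g, hg, h⟩ := ih
    obtain ⟨g', hg', h'⟩ := hg.exists_hasDerivAt hα
    refine ⟨_, .add (.mul .logDeriv hg) hg', fun x hx => ?_⟩
    have hK : HasDerivAt (Ka α) (Ka α x * ((1 - x ^ 2) / kerDen α x) / x) x :=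
      ((hasDerivAt_kerBase hα hx).const_mul (Real.sin (kerAngle α) / π)).congr_deriv
        (by rw [Ka_eq]; ring)
    have h2 : kerD α n =ᶠ[𝓝 x] fun x => Ka α x * g x := by
      filter_upwards [Ioi_mem_nhds hx] with y hy using h y hy
    rw [kerD_succ, h2.deriv_eq, (hK.fun_mul (h' x hx)).deriv]
    field_simp

lemma hasDerivAt_kerD {α : ℝ} (hα : 1 < α) (n : ℕ) {x : ℝ} (hx : 0 < x) :
    HasDerivAt (kerD α n) (kerD α (n + 1) x / x) x := by
  obtain ⟨g, hg, h⟩ := exists_kerD_eq hα n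
  obtain ⟨g', hg', h'⟩ := hg.exists_hasDerivAt hα
  have hK : DifferentiableAt ℝ (Ka α) x :=
    ((hasDerivAt_kerBase hα hx).const_mul (Real.sin (kerAngle α) / π)).differentiableAt
  have h2 : kerD α n =ᶠ[𝓝 x] fun x => Ka α x * g x := by
    filter_upwards [Ioi_mem_nhds hx] with y hy using h y hy
  have h3 : DifferentiableAt ℝ (kerD α n) x :=
    (hK.mul (h' x hx).differentiableAt).congr_of_eventuallyEq h2
  rw [kerD_succ, mul_div_cancel_left₀ _ hx.ne']
  exact h3.hasDerivAt

lemma exists_kerD_bound {α : ℝ} (hα : 1 < α) (n : ℕ) :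
    ∃ C, 0 ≤ C ∧ ∀ x, 0 < x → |kerD α n x| ≤ C * Ka α x := by
  obtain ⟨g, hg, h⟩ := exists_kerD_eq hα n
  obtain ⟨C, hC, hb⟩ := hg.exists_bound hα
  refine ⟨C, hC, fun x hx => ?_⟩
  rw [h x hx, abs_mul, abs_of_pos (Ka_pos hα hx), mul_comm]
  exact mul_le_mul_of_nonneg_right (hb x) (Ka_pos hα hx).le

/-- The supremum-type constant bounding the `n`-th Euler derivative by the kernel. -/
def kerDBound {α : ℝ} (hα : 1 < α) (n : ℕ) : ℝ := (exists_kerD_bound hα n).choose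

lemma kerDBound_nonneg {α : ℝ} (hα : 1 < α) (n : ℕ) : 0 ≤ kerDBound hα n :=
  (exists_kerD_bound hα n).choose_spec.1

lemma abs_kerD_le {α : ℝ} (hα : 1 < α) (n : ℕ) {x : ℝ} (hx : 0 < x) :
    |kerD α n x| ≤ kerDBound hα n * Ka α x :=
  (exists_kerD_bound hα n).choose_spec.2 x hx

lemma continuousOn_kerD {α : ℝ} (hα : 1 < α) (n : ℕ) : ContinuousOn (kerD α n) (Ioi 0) :=
  fun _ hx => (hasDerivAt_kerD hα n hx).continuousAt.continuousWithinAt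

/-- The constant in the elementary bound for the kernel. -/
def kerSup (α : ℝ) : ℝ := Real.sin (kerAngle α) / π / kerGap α

lemma kerSup_pos {α : ℝ} (hα : 1 < α) : 0 < kerSup α := by
  have := sin_kerAngle_pos hα
  have := kerGap_pos hα
  have := Real.pi_pos
  unfold kerSup; positivity

lemma Ka_le {α : ℝ} (hα : 1 < α) {x : ℝ} (hx : 0 < x) :
    Ka α x ≤ kerSup α * (x / (1 + x ^ 2)) := by
  have := sin_kerAngle_pos hα
  have hk := kerGap_pos hα
  have := Real.pi_pos
  rw [Ka_eq, kerSup, div_mul_eq_mul_div _ (kerGap α), mul_div_assoc, div_div]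
  gcongr
  rw [mul_comm]; exact kerGap_mul_le_kerDen α x

lemma Ka_le_kerSup {α : ℝ} (hα : 1 < α) {x : ℝ} (hx : 0 < x) : Ka α x ≤ kerSup α := by
  refine (Ka_le hα hx).trans ?_
  have : x / (1 + x ^ 2) ≤ 1 := by
    rw [div_le_one (by positivity)]; nlinarith [sq_nonneg (x - 1)]
  nlinarith [kerSup_pos hα]

lemma Ka_div_div_le {α : ℝ} (hα : 1 < α) {x y : ℝ} (hx : 0 < x) (hy : 0 < y) :
    Ka α (x / y) / y ≤ kerSup α * (x / (x ^ 2 + y ^ 2)) := by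
  have h := Ka_le hα (div_pos hx hy)
  rw [div_le_iff₀ hy]
  refine h.trans (le_of_eq ?_)
  field_simp
  ring

/-! ### Convolution with the Euler derivatives of the kernel -/

/-- Convolution on `J` with the `n`-th Euler derivative of the kernel. -/
def convD (α : ℝ) (n : ℕ) (J : Set ℝ) (f : ℝ → ℝ) (x : ℝ) : ℝ :=
  ∫ y in J, kerD α n (x / y) * f y / y

lemma convD_zero (α : ℝ) (J : Set ℝ) (f : ℝ → ℝ) : convD α 0 J f = Kconv α J f := rfl

lemma abs_kerD_div_le {α : ℝ} (hα : 1 < α) (n : ℕ) {a b x y : ℝ} (ha : 0 < a) (hax : a ≤ x)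
    (hxb : x ≤ b) (hy : 0 < y) :
    |kerD α n (x / y)| / y ≤
      kerDBound hα n * (kerSup α * (b / min (a ^ 2) 1)) * (1 / (1 + y ^ 2)) := by
  have hx : 0 < x := ha.trans_le hax
  have hm : 0 < min (a ^ 2) 1 := lt_min (by positivity) one_pos
  have h1 : |kerD α n (x / y)| / y ≤ kerDBound hα n * (Ka α (x / y) / y) := by
    rw [← mul_div_assoc]
    gcongr
    exact abs_kerD_le hα n (div_pos hx hy)
  refine h1.trans ?_
  rw [mul_assoc]
  refine mul_le_mul_of_nonneg_left ?_ (kerDBound_nonneg hα n)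
  refine (Ka_div_div_le hα hx hy).trans ?_
  rw [mul_assoc]
  refine mul_le_mul_of_nonneg_left ?_ (kerSup_pos hα).le
  rw [div_mul_div_comm, mul_one]
  have h2 : min (a ^ 2) 1 * (1 + y ^ 2) ≤ x ^ 2 + y ^ 2 := by
    have := min_le_left (a ^ 2) 1
    have := min_le_right (a ^ 2) 1
    have : a ^ 2 ≤ x ^ 2 := by gcongr
    nlinarith [sq_nonneg y]
  gcongr
  exact hx.le.trans hxb

lemma aestronglyMeasurable_of_weight {J : Set ℝ} {f : ℝ → ℝ}
    (hf : IntegrableOn (fun y => f y / (1 + y ^ 2)) J) :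
    AEStronglyMeasurable f (volume.restrict J) := by
  have h : f = fun y => (f y / (1 + y ^ 2)) * (1 + y ^ 2) := by
    ext y
    have : (1 + y ^ 2) ≠ 0 := by positivity
    field_simp
  rw [h]
  exact hf.aestronglyMeasurable.mul
    (by fun_prop : Continuous fun y : ℝ => 1 + y ^ 2).aestronglyMeasurable

lemma aestronglyMeasurable_convD {α : ℝ} (hα : 1 < α) (n : ℕ) {J : Set ℝ} (hJ : MeasurableSet J)
    (hJ0 : J ⊆ Ioi 0) {f : ℝ → ℝ} (hf : AEStronglyMeasurable f (volume.restrict J)) {x : ℝ}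
    (hx : 0 < x) :
    AEStronglyMeasurable (fun y => kerD α n (x / y) * f y / y) (volume.restrict J) := by
  have h1 : ContinuousOn (fun y => kerD α n (x / y)) J := by
    refine (continuousOn_kerD hα n).comp
      (continuousOn_const.div continuousOn_id fun y hy => (hJ0 hy).ne') ?_
    exact fun y hy => div_pos hx (hJ0 hy)
  have h2 : ContinuousOn (fun y : ℝ => y⁻¹) J :=
    continuousOn_id.inv₀ fun y hy => (hJ0 hy).ne'
  exact ((h1.aestronglyMeasurable hJ).mul hf).mul (h2.aestronglyMeasurable hJ)

lemma abs_convD_integrand_le {α : ℝ} (hα : 1 < α) (n : ℕ) {a b x y : ℝ} (ha : 0 < a) (hax : a ≤ x)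
    (hxb : x ≤ b) (hy : 0 < y) (v : ℝ) :
    |kerD α n (x / y) * v / y| ≤
      kerDBound hα n * (kerSup α * (b / min (a ^ 2) 1)) * |v / (1 + y ^ 2)| := by
  have h := abs_kerD_div_le hα n ha hax hxb hy
  have h0 : |kerD α n (x / y) * v / y| = |kerD α n (x / y)| / y * |v| := by
    rw [abs_div, abs_mul, abs_of_pos hy]; ring
  have h1 : |v / (1 + y ^ 2)| = 1 / (1 + y ^ 2) * |v| := by
    rw [abs_div, abs_of_pos (by positivity : 0 < 1 + y ^ 2)]; ring
  rw [h0, h1, ← mul_assoc]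
  exact mul_le_mul_of_nonneg_right h (abs_nonneg v)

lemma integrableOn_convD {α : ℝ} (hα : 1 < α) (n : ℕ) {J : Set ℝ} (hJ : MeasurableSet J)
    (hJ0 : J ⊆ Ioi 0) {f : ℝ → ℝ} (hf : IntegrableOn (fun y => f y / (1 + y ^ 2)) J) {x : ℝ}
    (hx : 0 < x) : IntegrableOn (fun y => kerD α n (x / y) * f y / y) J := by
  refine Integrable.mono' (hf.abs.const_mul
      (kerDBound hα n * (kerSup α * (x / min (x ^ 2) 1))))
    (aestronglyMeasurable_convD hα n hJ hJ0 (aestronglyMeasurable_of_weight hf) hx)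
    ((ae_restrict_iff' hJ).2 <| ae_of_all _ fun y hy => ?_)
  exact abs_convD_integrand_le hα n hx le_rfl le_rfl (hJ0 hy) (f y)

lemma hasDerivAt_convD {α : ℝ} (hα : 1 < α) (n : ℕ) {J : Set ℝ} (hJ : MeasurableSet J)
    (hJ0 : J ⊆ Ioi 0) {f : ℝ → ℝ} (hf : IntegrableOn (fun y => f y / (1 + y ^ 2)) J) {x : ℝ}
    (hx : 0 < x) : HasDerivAt (convD α n J f) (convD α (n + 1) J f x / x) x := by
  have hfm := aestronglyMeasurable_of_weight hf
  have hs : Ioo (x / 2) (2 * x) ∈ 𝓝 x := Ioo_mem_nhds (by linarith) (by linarith)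
  have hx2 : 0 < x / 2 := by positivity
  have key := hasDerivAt_integral_of_dominated_loc_of_deriv_le (μ := volume.restrict J)
    (F := fun x y => kerD α n (x / y) * f y / y)
    (F' := fun x y => kerD α (n + 1) (x / y) * f y / y / x) hs
    (bound := fun y => kerDBound hα (n + 1) * (kerSup α * (2 * x / min ((x / 2) ^ 2) 1)) *
      |f y / (1 + y ^ 2)| * (1 / (x / 2)))
    (by
      filter_upwards [Ioi_mem_nhds hx] with t ht
      exact aestronglyMeasurable_convD hα n hJ hJ0 hfm ht)
    (integrableOn_convD hα n hJ hJ0 hf hx)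
    ((aestronglyMeasurable_convD hα (n + 1) hJ hJ0 hfm hx).mul_const x⁻¹)
    ((ae_restrict_iff' hJ).2 <| ae_of_all _ fun y hy t ht => by
      have ht0 : 0 < t := hx2.trans ht.1
      rw [Real.norm_eq_abs, abs_div, abs_of_pos ht0, div_eq_mul_one_div]
      refine mul_le_mul (abs_convD_integrand_le hα (n + 1) hx2 ht.1.le ht.2.le (hJ0 hy) (f y))
        (one_div_le_one_div_of_le hx2 ht.1.le) (by positivity) ?_
      have h1 := kerDBound_nonneg hα (n + 1)
      have h2 := (kerSup_pos hα).le
      have h3 : 0 ≤ min ((x / 2) ^ 2) 1 := by positivity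
      positivity)
    ((hf.abs.const_mul _).mul_const _)
    ((ae_restrict_iff' hJ).2 <| ae_of_all _ fun y hy t ht => by
      have ht0 : 0 < t := hx2.trans ht.1
      have hy0 : 0 < y := hJ0 hy
      have h1 := ((hasDerivAt_kerD hα n (div_pos ht0 hy0)).comp t
        ((hasDerivAt_id t).div_const y)).mul_const (f y) |>.div_const y
      refine h1.congr_deriv ?_
      field_simp)
  refine key.2.congr_deriv ?_
  rw [integral_div]; rfl

lemma continuousOn_convD {α : ℝ} (hα : 1 < α) (n : ℕ) {J : Set ℝ} (hJ : MeasurableSet J)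
    (hJ0 : J ⊆ Ioi 0) {f : ℝ → ℝ} (hf : IntegrableOn (fun y => f y / (1 + y ^ 2)) J) :
    ContinuousOn (convD α n J f) (Ioi 0) :=
  fun _ hx => (hasDerivAt_convD hα n hJ hJ0 hf hx).continuousAt.continuousWithinAt

lemma Ici_one_subset_Ioi_zero : Ici (1:ℝ) ⊆ Ioi 0 := fun y hy => show (0:ℝ) < y from
  lt_of_lt_of_le one_pos hy

lemma abs_convD_le_Fa {α : ℝ} (hα : 1 < α) (n : ℕ) {f : ℝ → ℝ} {B : ℝ}
    (hf : ∀ y, 1 ≤ y → |f y| ≤ B) {x : ℝ} (hx : 0 < x) :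
    |convD α n (Ici 1) f x| ≤ kerDBound hα n * B * Fa α x := by
  unfold convD
  rw [← integral_Ka_div hα hx, ← integral_const_mul, integral_Ici_eq_integral_Ioi,
    ← Real.norm_eq_abs]
  refine norm_integral_le_of_norm_le ((integrableOn_Ka_div hα hx).const_mul _)
    ((ae_restrict_iff' measurableSet_Ioi).2 <| ae_of_all _ fun y hy => ?_)
  have hy0 : 0 < y := lt_trans one_pos hy
  rw [Real.norm_eq_abs, abs_div, abs_mul, abs_of_pos hy0, ← mul_div_assoc]
  refine div_le_div_of_nonneg_right ?_ hy0.le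
  calc |kerD α n (x / y)| * |f y| ≤ (kerDBound hα n * Ka α (x / y)) * B := by
        apply mul_le_mul (abs_kerD_le hα n (div_pos hx hy0)) (hf y (le_of_lt hy)) (abs_nonneg _)
        exact mul_nonneg (kerDBound_nonneg hα n) (Ka_pos hα (div_pos hx hy0)).le
    _ = _ := by ring

lemma abs_convD_le {α : ℝ} (hα : 1 < α) (n : ℕ) {f : ℝ → ℝ} {B : ℝ}
    (hf : ∀ y, 1 ≤ y → |f y| ≤ B) {x : ℝ} (hx : 0 < x) :
    |convD α n (Ici 1) f x| ≤ kerDBound hα n * B * kerMass α := by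
  have hB : 0 ≤ B := (abs_nonneg _).trans (hf 1 le_rfl)
  exact (abs_convD_le_Fa hα n hf hx).trans (mul_le_mul_of_nonneg_left (Fa_le_kerMass hα x)
    (mul_nonneg (kerDBound_nonneg hα n) hB))

lemma integrableOn_weight_of_growth {α : ℝ} (hα : 1 < α) {f : ℝ → ℝ} {C : ℝ}
    (hfm : AEStronglyMeasurable f (volume.restrict (Ici 1)))
    (hf : ∀ y, 1 ≤ y → |f y| ≤ C * y ^ growthExp α) :
    IntegrableOn (fun y => f y / (1 + y ^ 2)) (Ici 1) := by
  have hi : IntegrableOn (fun y : ℝ => C * y ^ (growthExp α - 2)) (Ici 1) := by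
    rw [integrableOn_Ici_iff_integrableOn_Ioi]
    exact (integrableOn_Ioi_rpow_of_lt (by linarith [growthExp_lt_one hα]) one_pos).const_mul C
  refine Integrable.mono' hi ?_ ((ae_restrict_iff' measurableSet_Ici).2 <|
    ae_of_all _ fun y hy => ?_)
  · exact hfm.mul ((by fun_prop : Measurable fun y : ℝ => (1 + y ^ 2)⁻¹).aestronglyMeasurable)
  · have hy0 : 0 < y := lt_of_lt_of_le one_pos hy
    have hp : 0 < 1 + y ^ 2 := by positivity
    rw [Real.norm_eq_abs, abs_div, abs_of_pos hp, div_le_iff₀ hp]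
    refine (hf y hy).trans ?_
    have h1 : y ^ growthExp α = y ^ (growthExp α - 2) * y ^ 2 := by
      rw [← Real.rpow_natCast, ← Real.rpow_add hy0]; norm_num
    have h2 : 0 < y ^ (growthExp α - 2) := Real.rpow_pos_of_pos hy0 _
    have hC : 0 ≤ C := by
      have := (abs_nonneg _).trans (hf 1 le_rfl); simpa using this
    rw [h1, ← mul_assoc]
    have : 0 ≤ C * y ^ (growthExp α - 2) := by positivity
    nlinarith

lemma integrableOn_weight_rpow_Ioo {α : ℝ} (hα : 1 < α) :
    IntegrableOn (fun y : ℝ => y ^ growthExp α / (1 + y ^ 2)) (Ioo 0 1) := by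
  refine Measure.integrableOn_of_bounded (M := 1) (by simp)
    (by fun_prop : Measurable fun y : ℝ => y ^ growthExp α / (1 + y ^ 2)).aestronglyMeasurable
    ((ae_restrict_iff' measurableSet_Ioo).2 <| ae_of_all _ fun y hy => ?_)
  have h1 : y ^ growthExp α ≤ 1 := Real.rpow_le_one hy.1.le hy.2.le (growthExp_pos hα).le
  have h2 : 0 ≤ y ^ growthExp α := Real.rpow_nonneg hy.1.le _
  rw [Real.norm_eq_abs, abs_of_nonneg (by positivity), div_le_one (by positivity)]
  nlinarith [sq_nonneg y]

lemma abs_convD_Ioo_le {α : ℝ} (hα : 1 < α) (n : ℕ) {x : ℝ} (hx : 0 < x) :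
    |convD α n (Ioo 0 1) (fun y => y ^ growthExp α) x| ≤
      kerDBound hα n * kerSup α * ∫ y in Ioo (0:ℝ) 1, y ^ (growthExp α - 1) := by
  unfold convD
  rw [← integral_const_mul, ← Real.norm_eq_abs]
  have hi : IntegrableOn (fun y : ℝ => y ^ (growthExp α - 1)) (Ioo 0 1) :=
    (intervalIntegral.integrableOn_Ioo_rpow_iff one_pos).2 (by linarith [growthExp_pos hα])
  refine norm_integral_le_of_norm_le (hi.const_mul _)
    ((ae_restrict_iff' measurableSet_Ioo).2 <| ae_of_all _ fun y hy => ?_)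
  have hy0 : 0 < y := hy.1
  have h2 : 0 < y ^ growthExp α := Real.rpow_pos_of_pos hy0 _
  rw [Real.norm_eq_abs, abs_div, abs_mul, abs_of_pos hy0, abs_of_pos h2, mul_div_assoc,
    Real.rpow_sub_one hy0.ne']
  gcongr
  exact (abs_kerD_le hα n (div_pos hx hy0)).trans
    (mul_le_mul_of_nonneg_left (Ka_le_kerSup hα (div_pos hx hy0)) (kerDBound_nonneg hα n))

/-- The potential `u ↦ u ^ (2 * α) + u ^ (-2)`, so that `V(u; x) = u² (x - phiF α u)`. -/
def phiF (α u : ℝ) : ℝ := u ^ (2 * α) + (u ^ 2)⁻¹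

lemma Vfun_eq {α x u : ℝ} (hu : 0 < u) : Vfun α x u = u ^ 2 * (x - phiF α u) := by
  have h : u ^ (2 * α + 2) = u ^ (2 * α) * u ^ 2 := by
    rw [Real.rpow_add hu]; norm_num
  unfold Vfun phiF
  rw [h]
  field_simp
  ring

lemma rhoC_pos {α : ℝ} (hα : 1 < α) : 0 < rhoC α := by
  have : 0 < α := by linarith
  unfold rhoC
  positivity

lemma log_rhoC {α : ℝ} (hα : 1 < α) :
    Real.log (rhoC α) = Real.log (1 + α) - α / (1 + α) * Real.log α := by
  have h0 : 0 < α := by linarith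
  unfold rhoC
  rw [Real.log_mul (by positivity) (by positivity), Real.log_div (by positivity) (by positivity),
    Real.log_rpow h0, add_comm α 1]
  field_simp
  ring

lemma rhoC_le_phiF {α u : ℝ} (hα : 1 < α) (hu : 0 < u) : rhoC α ≤ phiF α u := by
  have h0 : 0 < α := by linarith
  have key := Real.geom_mean_le_arith_mean2_weighted (w₁ := 1 / (1 + α)) (w₂ := α / (1 + α))
    (p₁ := (1 + α) * u ^ (2 * α)) (p₂ := (1 + α) / α * (u ^ 2)⁻¹)
    (by positivity) (by positivity) (by positivity) (by positivity) (by field_simp)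
  have h1 : 1 / (1 + α) * ((1 + α) * u ^ (2 * α)) + α / (1 + α) * ((1 + α) / α * (u ^ 2)⁻¹)
      = phiF α u := by
    unfold phiF; field_simp
  rw [h1] at key
  refine le_of_eq_of_le ?_ key
  have hu2 : 0 < u ^ (2 * α) := by positivity
  apply Real.log_injOn_pos (mem_Ioi.2 (rhoC_pos hα)) (mem_Ioi.2 (by positivity))
  rw [log_rhoC hα, Real.log_mul (by positivity) (by positivity), Real.log_rpow (by positivity),
    Real.log_rpow (by positivity), Real.log_mul (by positivity) (by positivity),
    Real.log_mul (by positivity) (by positivity), Real.log_rpow hu, Real.log_inv, Real.log_pow,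
    Real.log_div (by positivity) (by positivity)]
  push_cast
  field_simp
  ring

lemma phiF_pos {α u : ℝ} (hu : 0 < u) : 0 < phiF α u := by unfold phiF; positivity

lemma rpow_lt_of_phiF_lt {α x u : ℝ} (hα : 1 < α) (hu : 0 < u) (h : phiF α u < x) :
    u < x ^ (1 / (2 * α)) := by
  have h0 : 0 < α := by linarith
  have h1 : u ^ (2 * α) < x := by
    have : 0 < (u ^ 2)⁻¹ := by positivity
    unfold phiF at h; linarith
  calc u = (u ^ (2 * α)) ^ (1 / (2 * α)) := by
        rw [← Real.rpow_mul hu.le, mul_one_div_cancel (by positivity), Real.rpow_one]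
    _ < _ := Real.rpow_lt_rpow (by positivity) h1 (by positivity)

lemma continuousOn_phiF (α : ℝ) : ContinuousOn (phiF α) (Ioi 0) := by
  intro u hu
  have hu' : u ≠ 0 := ne_of_gt hu
  apply ContinuousAt.continuousWithinAt
  unfold phiF
  exact (Real.continuousAt_rpow_const _ _ (Or.inl hu')).add
    ((continuousAt_id.pow 2).inv₀ (by simpa using hu'))

lemma measurable_phiF (α : ℝ) : Measurable (phiF α) := by
  unfold phiF; fun_prop

lemma Sfun_eq {α : ℝ} (hα : 1 < α) (x : ℝ) :
    Sfun α x = (1 / π) * ∫ u in Ioi 0, √(x - phiF α u) := by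
  have h0 : 0 < α := by linarith
  unfold Sfun
  split_ifs with hx
  swap
  · rw [setIntegral_eq_zero_of_forall_eq_zero, mul_zero]
    intro u hu
    exact Real.sqrt_eq_zero_of_nonpos (by linarith [rhoC_le_phiF hα hu])
  congr 1
  have hx0 : 0 < x := (rhoC_pos hα).trans hx
  set Z : Set ℝ := {u : ℝ | 0 < u ∧ Vfun α x u = 0} with hZ
  have hmem : ∀ u, 0 < u → phiF α u = x → u ∈ Z := fun u hu h => by
    refine ⟨hu, ?_⟩
    rw [Vfun_eq hu, h, sub_self, mul_zero]
  have hmem' : ∀ u ∈ Z, phiF α u = x := fun u hu => by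
    have h1 := hu.2
    rw [Vfun_eq hu.1] at h1
    have : u ^ 2 ≠ 0 := pow_ne_zero _ hu.1.ne'
    rcases mul_eq_zero.1 h1 with h | h
    · exact absurd h this
    · linarith
  have hbb : BddBelow Z := ⟨0, fun u hu => hu.1.le⟩
  have hba : BddAbove Z := ⟨(x + 1) ^ (1 / (2 * α)), fun u hu =>
    (rpow_lt_of_phiF_lt hα hu.1 (by rw [hmem' u hu]; linarith)).le⟩
  have ha0 : 0 ≤ u1F α x := Real.sInf_nonneg fun u hu => hu.1.le
  have hab : u1F α x ≤ u2F α x := Real.sInf_le_sSup Z hbb hba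
  rw [intervalIntegral.integral_of_le hab]
  have hsub : Ioc (u1F α x) (u2F α x) ⊆ Ioi 0 := fun u hu => lt_of_le_of_lt ha0 hu.1
  rw [← setIntegral_eq_of_subset_of_forall_sdiff_eq_zero measurableSet_Ioi hsub]
  · refine setIntegral_congr_fun measurableSet_Ioi fun u hu => ?_
    have hu0 : 0 < u := hu
    rw [Vfun_eq hu0, Real.sqrt_mul (by positivity), Real.sqrt_sq hu0.le, mul_div_cancel_left₀ _ hu0.ne']
  · rintro u ⟨hu0, hu⟩
    have hu0 : 0 < u := hu0
    by_contra hne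
    have hlt : phiF α u < x := by
      by_contra hge
      apply hne
      rw [Vfun_eq hu0, Real.sqrt_eq_zero_of_nonpos, zero_div]
      exact mul_nonpos_of_nonneg_of_nonpos (by positivity) (by linarith)
    apply hu
    constructor
    · have hr0 : 0 < √(1 / x) := Real.sqrt_pos.2 (by positivity)
      have hru : √(1 / x) < u := by
        rw [Real.sqrt_lt' hu0, one_div]
        apply inv_lt_of_inv_lt₀ (by positivity)
        have : 0 < u ^ (2 * α) := by positivity
        unfold phiF at hlt; linarith
      obtain ⟨c, hc, hcx⟩ := intermediate_value_Icc' hru.le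
        ((continuousOn_phiF α).mono fun v hv => lt_of_lt_of_le hr0 hv.1)
        (show x ∈ Icc (phiF α u) (phiF α √(1 / x)) by
          refine ⟨hlt.le, ?_⟩
          unfold phiF
          rw [Real.sq_sqrt (by positivity), one_div, inv_inv]
          have : 0 < √(x⁻¹) ^ (2 * α) := by rw [← one_div]; positivity
          linarith)
      have hcu : c ≠ u := by rintro rfl; linarith
      exact lt_of_le_of_lt (csInf_le hbb (hmem c (lt_of_lt_of_le hr0 hc.1) hcx))
        (lt_of_le_of_ne hc.2 hcu)
    · have huR := rpow_lt_of_phiF_lt hα hu0 hlt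
      obtain ⟨c, hc, hcx⟩ := intermediate_value_Icc huR.le
        ((continuousOn_phiF α).mono fun v hv => lt_of_lt_of_le hu0 hv.1)
        (show x ∈ Icc (phiF α u) (phiF α (x ^ (1 / (2 * α)))) by
          refine ⟨hlt.le, ?_⟩
          unfold phiF
          rw [← Real.rpow_mul hx0.le, one_div_mul_cancel (by positivity), Real.rpow_one]
          have : 0 < ((x ^ (1 / (2 * α))) ^ 2)⁻¹ := by positivity
          linarith)
      exact hc.1.trans (le_csSup hba (hmem c (lt_of_lt_of_le hu0 hc.1) hcx))

lemma measurable_sqrt_sub_phiF (α x : ℝ) : Measurable fun u => √(x - phiF α u) :=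
  (measurable_const.sub (measurable_phiF α)).sqrt

lemma sqrt_sub_phiF_le {α x u : ℝ} (hα : 1 < α) (hu : 0 < u) :
    √(x - phiF α u) ≤ (Ioo 0 (x ^ (1 / (2 * α)))).indicator (fun _ => √x) u := by
  by_cases h : phiF α u < x
  · rw [indicator_of_mem (show u ∈ Ioo 0 _ from ⟨hu, rpow_lt_of_phiF_lt hα hu h⟩)]
    exact Real.sqrt_le_sqrt (by linarith [phiF_pos (α := α) hu])
  · rw [Real.sqrt_eq_zero_of_nonpos (by linarith)]
    exact indicator_nonneg (fun _ _ => Real.sqrt_nonneg _) _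

lemma integrable_indicator_Ioo_const (a b c : ℝ) :
    IntegrableOn ((Ioo a b).indicator fun _ => c) (Ioi 0) :=
  ((integrable_indicator_iff measurableSet_Ioo).2
    (integrableOn_const (by simp))).integrableOn

lemma integrableOn_sqrt_sub_phiF {α : ℝ} (hα : 1 < α) (x : ℝ) :
    IntegrableOn (fun u => √(x - phiF α u)) (Ioi 0) := by
  refine Integrable.mono' (integrable_indicator_Ioo_const 0 (x ^ (1 / (2 * α))) √x)
    (measurable_sqrt_sub_phiF α x).aestronglyMeasurable ?_
  filter_upwards [ae_restrict_mem measurableSet_Ioi] with u hu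
  rw [Real.norm_of_nonneg (Real.sqrt_nonneg _)]
  exact sqrt_sub_phiF_le hα hu

lemma Sfun_nonneg {α : ℝ} (hα : 1 < α) (x : ℝ) : 0 ≤ Sfun α x := by
  rw [Sfun_eq hα]
  exact mul_nonneg (by positivity) (integral_nonneg fun _ => Real.sqrt_nonneg _)

lemma Sfun_le {α x : ℝ} (hα : 1 < α) (hx : 0 < x) : Sfun α x ≤ (1 / π) * x ^ growthExp α := by
  have h0 : 0 < α := by linarith
  rw [Sfun_eq hα]
  refine mul_le_mul_of_nonneg_left ?_ (by positivity)
  calc ∫ u in Ioi 0, √(x - phiF α u)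
      ≤ ∫ u in Ioi 0, (Ioo 0 (x ^ (1 / (2 * α)))).indicator (fun _ => √x) u :=
        setIntegral_mono_on (integrableOn_sqrt_sub_phiF hα x) (integrable_indicator_Ioo_const _ _ _)
          measurableSet_Ioi fun u hu => sqrt_sub_phiF_le hα hu
    _ = x ^ (1 / (2 * α)) * √x := by
        rw [setIntegral_indicator measurableSet_Ioo,
          inter_eq_right.2 Ioo_subset_Ioi_self]
        simp [Real.rpow_nonneg hx.le]
    _ = x ^ growthExp α := by
        rw [Real.sqrt_eq_rpow, ← Real.rpow_add hx]
        congr 1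
        unfold growthExp; field_simp

lemma monotone_Sfun {α : ℝ} (hα : 1 < α) : Monotone (Sfun α) := fun x y hxy => by
  rw [Sfun_eq hα, Sfun_eq hα]
  exact mul_le_mul_of_nonneg_left (setIntegral_mono (integrableOn_sqrt_sub_phiF hα x)
    (integrableOn_sqrt_sub_phiF hα y) fun u => Real.sqrt_le_sqrt (by linarith)) (by positivity)

lemma Sfun_eq_zero {α x : ℝ} (hx : x ≤ rhoC α) : Sfun α x = 0 := by
  unfold Sfun; rw [if_neg (by linarith)]

/-- The leading coefficient of `Sfun α x` as `x → ∞`. -/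
def coefS (α : ℝ) : ℝ := (1 / π) * ∫ v in Ioi 0, √(1 - v ^ (2 * α))

lemma rpow_neg_mul_Sfun {α x : ℝ} (hα : 1 < α) (hx : 0 < x) :
    x ^ (-growthExp α) * Sfun α x =
      (1 / π) * ∫ v in Ioi 0, √(1 - v ^ (2 * α) - x ^ (-(1 + 1 / α)) * (v ^ 2)⁻¹) := by
  have h0 : 0 < α := by linarith
  set R := x ^ (1 / (2 * α)) with hR
  have hR0 : 0 < R := Real.rpow_pos_of_pos hx _
  have h1 := integral_comp_mul_left_Ioi (fun u => √(x - phiF α u)) 0 hR0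
  rw [mul_zero, smul_eq_mul] at h1
  have h2 : ∫ u in Ioi 0, √(x - phiF α u) = R * ∫ v in Ioi 0, √(x - phiF α (R * v)) := by
    rw [h1]; field_simp
  have h3 : ∫ v in Ioi 0, √(x - phiF α (R * v)) =
      √x * ∫ v in Ioi 0, √(1 - v ^ (2 * α) - x ^ (-(1 + 1 / α)) * (v ^ 2)⁻¹) := by
    rw [← integral_const_mul]
    refine setIntegral_congr_fun measurableSet_Ioi fun v hv => ?_
    have hv : 0 < v := hv
    have hR1 : R ^ (2 * α) = x := by
      rw [hR, ← Real.rpow_mul hx.le, one_div_mul_cancel (by positivity), Real.rpow_one]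
    have hR2 : (R ^ 2)⁻¹ = x * x ^ (-(1 + 1 / α)) := by
      rw [hR, ← Real.rpow_natCast, ← Real.rpow_mul hx.le, ← Real.rpow_neg hx.le]
      nth_rewrite 2 [← Real.rpow_one x]
      rw [← Real.rpow_add hx]
      congr 1
      push_cast; field_simp; ring
    have : x - phiF α (R * v) = x * (1 - v ^ (2 * α) - x ^ (-(1 + 1 / α)) * (v ^ 2)⁻¹) := by
      unfold phiF
      rw [Real.mul_rpow hR0.le hv.le, hR1, mul_pow, mul_inv, hR2]
      ring
    rw [this, Real.sqrt_mul hx.le]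
  have h4 : x ^ (-growthExp α) * (R * √x) = 1 := by
    rw [hR, Real.sqrt_eq_rpow, ← Real.rpow_add hx, ← Real.rpow_add hx]
    have : -growthExp α + (1 / (2 * α) + 1 / 2) = 0 := by unfold growthExp; field_simp; ring
    rw [this, Real.rpow_zero]
  rw [Sfun_eq hα, h2, h3]
  linear_combination (1 / π * ∫ v in Ioi 0, √(1 - v ^ (2 * α) - x ^ (-(1 + 1 / α)) * (v ^ 2)⁻¹)) * h4

lemma sqrt_one_sub_rpow_le {α v b : ℝ} (hα : 1 < α) (hv : 0 < v) (hb : 0 ≤ b) :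
    √(1 - v ^ (2 * α) - b) ≤ (Ioo 0 1).indicator (fun _ => (1:ℝ)) v := by
  by_cases h : v < 1
  · rw [indicator_of_mem (show v ∈ Ioo 0 1 from ⟨hv, h⟩)]
    rw [Real.sqrt_le_one]
    have : 0 < v ^ (2 * α) := by positivity
    linarith
  · rw [Real.sqrt_eq_zero_of_nonpos]
    · exact indicator_nonneg (fun _ _ => zero_le_one) _
    · have := Real.one_le_rpow (not_lt.1 h) (show 0 ≤ 2 * α by linarith)
      linarith

lemma tendsto_rpow_neg_mul_Sfun {α : ℝ} (hα : 1 < α) :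
    Tendsto (fun x => x ^ (-growthExp α) * Sfun α x) atTop (𝓝 (coefS α)) := by
  have h0 : 0 < α := by linarith
  have h : Tendsto (fun x : ℝ => (1 / π) * ∫ v in Ioi 0,
      √(1 - v ^ (2 * α) - x ^ (-(1 + 1 / α)) * (v ^ 2)⁻¹)) atTop (𝓝 (coefS α)) := by
    refine Tendsto.const_mul _ ?_
    refine tendsto_integral_filter_of_dominated_convergence
      ((Ioo (0:ℝ) 1).indicator fun _ => (1:ℝ)) ?_ ?_ (integrable_indicator_Ioo_const 0 1 1) ?_
    · exact Eventually.of_forall fun x => by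
        apply Measurable.aestronglyMeasurable; fun_prop
    · filter_upwards [eventually_gt_atTop 0] with x hx
      filter_upwards [ae_restrict_mem measurableSet_Ioi] with v hv
      rw [Real.norm_of_nonneg (Real.sqrt_nonneg _)]
      exact sqrt_one_sub_rpow_le hα hv (by positivity)
    · refine Eventually.of_forall fun v => ?_
      have h1 : Tendsto (fun x : ℝ => x ^ (-(1 + 1 / α))) atTop (𝓝 0) :=
        tendsto_rpow_neg_atTop (by positivity)
      have h2 : Tendsto (fun x : ℝ => 1 - v ^ (2 * α) - x ^ (-(1 + 1 / α)) * (v ^ 2)⁻¹) atTop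
          (𝓝 (1 - v ^ (2 * α))) := by
        simpa using (h1.mul_const ((v ^ 2)⁻¹)).const_sub (1 - v ^ (2 * α))
      exact h2.sqrt
  refine h.congr' ?_
  filter_upwards [eventually_gt_atTop 0] with x hx
  exact (rpow_neg_mul_Sfun hα hx).symm

lemma integral_rpow_mul_sqrt_one_sub {a : ℝ} (ha : 0 < a) :
    ∫ t in Ioi (0:ℝ), t ^ (a - 1) * √(1 - t) =
      Real.Gamma a * Real.Gamma (3 / 2) / Real.Gamma (a + 3 / 2) := by
  have h1 : ∫ t in Ioi (0:ℝ), t ^ (a - 1) * √(1 - t) =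
      ∫ t in (0:ℝ)..1, t ^ (a - 1) * (1 - t) ^ ((3 / 2 : ℝ) - 1) := by
    rw [intervalIntegral.integral_of_le zero_le_one,
      setIntegral_eq_of_subset_of_forall_sdiff_eq_zero (s := Ioc 0 1) measurableSet_Ioi
        Ioc_subset_Ioi_self]
    · refine setIntegral_congr_fun measurableSet_Ioc fun t ht => ?_
      rw [Real.sqrt_eq_rpow]; norm_num
    · rintro t ⟨ht0, ht⟩
      have : 1 < t := by
        by_contra h; exact ht ⟨ht0, not_lt.1 h⟩
      rw [Real.sqrt_eq_zero_of_nonpos (by linarith), mul_zero]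
  have h2 := Complex.Gamma_mul_Gamma_eq_betaIntegral (s := (a:ℂ)) (t := ((3 / 2 : ℝ) : ℂ))
    (by simpa using ha) (by norm_num)
  have h3 : Complex.betaIntegral (a:ℂ) ((3 / 2 : ℝ) : ℂ) =
      ((∫ t in (0:ℝ)..1, t ^ (a - 1) * (1 - t) ^ ((3 / 2 : ℝ) - 1) : ℝ) : ℂ) := by
    unfold Complex.betaIntegral
    rw [← intervalIntegral.integral_ofReal]
    refine intervalIntegral.integral_congr fun t ht => ?_
    rw [uIcc_of_le zero_le_one] at ht
    rw [Complex.ofReal_mul, Complex.ofReal_cpow ht.1, Complex.ofReal_cpow (by linarith [ht.2])]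
    push_cast
    rfl
  rw [h3, ← Complex.ofReal_add, Complex.Gamma_ofReal, Complex.Gamma_ofReal, Complex.Gamma_ofReal,
    ← Complex.ofReal_mul, ← Complex.ofReal_mul, Complex.ofReal_inj] at h2
  rw [h1, h2, mul_div_cancel_left₀]
  exact (Real.Gamma_pos_of_pos (by positivity)).ne'

lemma coefS_eq {α : ℝ} (hα : 1 < α) :
    coefS α = Real.Gamma (1 / (2 * α)) / (2 * √π * (1 + α) * Real.Gamma (growthExp α)) := by
  have h0 : 0 < α := by linarith
  have h1 := integral_comp_rpow_Ioi (fun v : ℝ => √(1 - v ^ (2 * α)))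
    (p := 1 / (2 * α)) (by positivity)
  have h2 : ∫ x in Ioi (0:ℝ), (|1 / (2 * α)| * x ^ (1 / (2 * α) - 1)) •
      √(1 - (x ^ (1 / (2 * α))) ^ (2 * α)) =
      (1 / (2 * α)) * ∫ t in Ioi (0:ℝ), t ^ (1 / (2 * α) - 1) * √(1 - t) := by
    rw [← integral_const_mul]
    refine setIntegral_congr_fun measurableSet_Ioi fun t (ht : 0 < t) => ?_
    rw [smul_eq_mul, abs_of_pos (by positivity), ← Real.rpow_mul ht.le,
      one_div_mul_cancel (by positivity), Real.rpow_one]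
    ring
  have hβ := growthExp_pos hα
  have h3 : Real.Gamma (1 / (2 * α) + 3 / 2) = growthExp α * Real.Gamma (growthExp α) := by
    rw [← Real.Gamma_add_one hβ.ne']
    congr 1
    unfold growthExp; field_simp; ring
  have h4 : Real.Gamma (3 / 2) = √π / 2 := by
    have := Real.Gamma_add_one (s := 1 / 2) (by norm_num)
    rw [Real.Gamma_one_half_eq] at this
    rw [show (3 / 2 : ℝ) = 1 / 2 + 1 by norm_num, this]; ring
  have hG := Real.Gamma_pos_of_pos hβ
  unfold coefS
  rw [← h1, h2, integral_rpow_mul_sqrt_one_sub (by positivity), h3, h4]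
  have hp : √π * √π = π := Real.mul_self_sqrt pi_pos.le
  have hsp : 0 < √π := Real.sqrt_pos.2 pi_pos
  have hb : growthExp α = (1 + α) / (2 * α) := rfl
  nth_rewrite 1 [hb]
  have : 1 / π = 1 / (√π * √π) := by rw [hp]
  rw [this]
  field_simp

lemma coefS_pos {α : ℝ} (hα : 1 < α) : 0 < coefS α := by
  have h0 : 0 < α := by linarith
  rw [coefS_eq hα]
  have := Real.Gamma_pos_of_pos (growthExp_pos hα)
  have := Real.Gamma_pos_of_pos (show 0 < 1 / (2 * α) by positivity)
  positivity

lemma Aconst_pos {α : ℝ} (hα : 1 < α) : 0 < Aconst α := by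
  have h0 : 0 < α := by linarith
  have := Real.Gamma_pos_of_pos (growthExp_pos hα)
  have := Real.Gamma_pos_of_pos (show 0 < 1 / (2 * α) by positivity)
  unfold Aconst
  unfold growthExp at *
  positivity

lemma Aconst_rpow {α : ℝ} (hα : 1 < α) :
    Aconst α ^ growthExp α = 2 * (1 + α) * rhoC α ^ growthExp α * coefS α := by
  have h0 : 0 < α := by linarith
  have hG := Real.Gamma_pos_of_pos (growthExp_pos hα)
  have hG' := Real.Gamma_pos_of_pos (show 0 < 1 / (2 * α) by positivity)
  have hsp : 0 < √π := Real.sqrt_pos.2 pi_pos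
  have hsa : 0 < √α := Real.sqrt_pos.2 h0
  have h1 : rhoC α ^ growthExp α * √α = (1 + α) ^ growthExp α := by
    apply Real.log_injOn_pos (mem_Ioi.2 (mul_pos (Real.rpow_pos_of_pos (rhoC_pos hα) _) hsa))
      (mem_Ioi.2 (by positivity))
    rw [Real.log_mul (Real.rpow_pos_of_pos (rhoC_pos hα) _).ne' hsa.ne',
      Real.log_rpow (rhoC_pos hα), log_rhoC hα, Real.log_sqrt h0.le, Real.log_rpow (by positivity)]
    unfold growthExp
    field_simp
    ring
  have hA : Aconst α ^ growthExp α =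
      (1 + α) ^ growthExp α * (Real.Gamma (1 / (2 * α)) / (√(π * α) * Real.Gamma (growthExp α))) := by
    have he : (1 + α) / (2 * α) = growthExp α := rfl
    unfold Aconst
    rw [he, Real.mul_rpow (by positivity) (by positivity), ← Real.rpow_mul (by positivity)]
    have : 2 * α / (α + 1) * growthExp α = 1 := by
      unfold growthExp; field_simp; ring
    rw [this, Real.rpow_one]
  rw [hA, ← h1, coefS_eq hα, Real.sqrt_mul pi_pos.le]
  field_simp

lemma tendsto_rpow_neg_mul_tauF {α : ℝ} (hα : 1 < α) :
    Tendsto (fun ξ => ξ ^ (-growthExp α) * tauF α ξ) atTop (𝓝 (Aconst α ^ growthExp α)) := by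
  have hρ := rhoC_pos hα
  have h := ((tendsto_rpow_neg_mul_Sfun hα).comp
    (tendsto_id.const_mul_atTop hρ)).const_mul (2 * (1 + α) * rhoC α ^ growthExp α)
  rw [Aconst_rpow hα]
  refine h.congr' ?_
  filter_upwards [eventually_gt_atTop 0] with ξ hξ
  simp only [Function.comp, id, tauF]
  rw [Real.mul_rpow hρ.le hξ.le, Real.rpow_neg hρ.le]
  have := (Real.rpow_pos_of_pos hρ (growthExp α)).ne'
  field_simp

/-- The principal square root on `ℂ`. -/
def csqrt (z : ℂ) : ℂ := z ^ (1 / 2 : ℂ)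

lemma csqrt_sq (z : ℂ) : csqrt z ^ 2 = z := by
  have := Complex.cpow_nat_inv_pow z (n := 2) two_ne_zero
  simpa only [csqrt, one_div, Nat.cast_ofNat] using this

lemma csqrt_re_nonneg (z : ℂ) : 0 ≤ (csqrt z).re := by
  by_cases hz : z = 0
  · simp [csqrt, hz]
  unfold csqrt
  rw [Complex.cpow_def_of_ne_zero hz, Complex.exp_re]
  refine mul_nonneg (Real.exp_pos _).le (Real.cos_nonneg_of_mem_Icc ⟨?_, ?_⟩) <;>
  · have h1 := Complex.neg_pi_lt_arg z
    have h2 := Complex.arg_le_pi z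
    have : (Complex.log z * (1 / 2)).im = Complex.arg z / 2 := by
      rw [Complex.mul_im]; simp [Complex.log_im]; ring
    rw [this]
    linarith

lemma norm_csqrt_sq (z : ℂ) : ‖csqrt z‖ ^ 2 = ‖z‖ := by
  rw [← norm_pow, csqrt_sq]

lemma csqrt_re (z : ℂ) : (csqrt z).re = √((‖z‖ + z.re) / 2) := by
  have h1 : (csqrt z ^ 2).re = z.re := by rw [csqrt_sq]
  have h2 := norm_csqrt_sq z
  rw [← Complex.normSq_eq_norm_sq, Complex.normSq_apply] at h2
  rw [sq, Complex.mul_re] at h1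
  rw [← h2, ← h1]
  symm
  rw [Real.sqrt_eq_iff_mul_self_eq (by nlinarith [mul_self_nonneg (csqrt z).re])
    (csqrt_re_nonneg z)]
  ring

lemma two_mul_csqrt (z : ℂ) : 2 * (csqrt z).re * (csqrt z).im = z.im := by
  have h1 : (csqrt z ^ 2).im = z.im := by rw [csqrt_sq]
  rw [sq, Complex.mul_im] at h1
  linarith

lemma continuous_csqrt_re : Continuous fun z => (csqrt z).re := by
  simp only [csqrt_re]
  fun_prop

lemma csqrt_ofReal_re (r : ℝ) : (csqrt (r : ℂ)).re = √r := by
  rw [csqrt_re, Complex.norm_real, Complex.ofReal_re, Real.norm_eq_abs]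
  rcases le_total 0 r with h | h
  · rw [abs_of_nonneg h]; congr 1; ring
  · rw [abs_of_nonpos h, Real.sqrt_eq_zero_of_nonpos h]; simp

lemma csqrt_ofReal_mul {r : ℝ} (hr : 0 < r) (z : ℂ) : csqrt ((r : ℂ) * z) = (√r : ℝ) * csqrt z := by
  by_cases hz : z = 0
  · simp [csqrt, hz]
  have hr' : (r : ℂ) ≠ 0 := Complex.ofReal_ne_zero.2 hr.ne'
  unfold csqrt
  rw [Complex.cpow_def_of_ne_zero (mul_ne_zero hr' hz), Complex.cpow_def_of_ne_zero hz,
    Complex.log_ofReal_mul hr hz, add_mul, Complex.exp_add]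
  congr 1
  rw [← Complex.ofReal_one, ← Complex.ofReal_ofNat, ← Complex.ofReal_div, ← Complex.ofReal_mul,
    ← Complex.ofReal_exp, Complex.ofReal_inj, Real.sqrt_eq_rpow, Real.rpow_def_of_pos hr]

/-- The negated radicand, continued to the strip. -/
def contourN (α x : ℝ) (ζ : ℂ) : ℂ :=
  x * Complex.exp (-((α - 1 : ℝ) * ζ)) - Complex.exp ((α + 1 : ℝ) * ζ)
    - Complex.exp (-((α + 1 : ℝ) * ζ))

lemma contourN_re (α x : ℝ) (ζ : ℂ) : (contourN α x ζ).re =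
    x * Real.exp (-(α - 1) * ζ.re) * Real.cos ((α - 1) * ζ.im)
      - (Real.exp ((α + 1) * ζ.re) + Real.exp (-(α + 1) * ζ.re)) * Real.cos ((α + 1) * ζ.im) := by
  unfold contourN
  simp only [Complex.sub_re, Complex.re_ofReal_mul, Complex.exp_re, Complex.neg_re, Complex.neg_im,
    Complex.im_ofReal_mul, Real.cos_neg, neg_mul]
  ring

lemma contourN_im (α x : ℝ) (ζ : ℂ) : (contourN α x ζ).im =
    -(x * Real.exp (-(α - 1) * ζ.re) * Real.sin ((α - 1) * ζ.im))
      - (Real.exp ((α + 1) * ζ.re) - Real.exp (-(α + 1) * ζ.re)) * Real.sin ((α + 1) * ζ.im) := by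
  unfold contourN
  simp only [Complex.sub_im, Complex.im_ofReal_mul, Complex.exp_im, Complex.neg_re, Complex.neg_im,
    Complex.re_ofReal_mul, Real.sin_neg, neg_mul]
  ring

lemma mul_sin_lt_sin_mul {a c : ℝ} (ha0 : 0 < a) (ha1 : a < 1) (hc0 : 0 < c) (hc : c ≤ π) :
    a * Real.sin c < Real.sin (a * c) := by
  have := strictConcaveOn_sin_Icc.2 (show (0:ℝ) ∈ Icc 0 π from ⟨le_rfl, pi_pos.le⟩)
    (show c ∈ Icc 0 π from ⟨hc0.le, hc⟩) hc0.ne (show 0 < 1 - a by linarith) ha0 (by ring)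
  simpa using this

lemma contourN_mem_slitPlane {α x : ℝ} (hα : 1 < α) (hx : rhoC α ≤ x) {ζ : ℂ}
    (h0 : 0 < ζ.im) (h1 : ζ.im ≤ π / (1 + α)) : contourN α x ζ ∈ Complex.slitPlane := by
  have hx0 : 0 < x := (rhoC_pos hα).trans_le hx
  rw [Complex.mem_slitPlane_iff]
  by_contra hcon
  push Not at hcon
  obtain ⟨hre, him⟩ := hcon
  rw [contourN_re] at hre
  rw [contourN_im] at him
  set t := ζ.re
  set η := ζ.im
  set s := (α - 1) * η with hs
  set c := (α + 1) * η with hc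
  set X := x * Real.exp (-(α - 1) * t) with hX
  set P := Real.exp ((α + 1) * t) with hP
  set Q := Real.exp (-(α + 1) * t) with hQ
  have hX0 : 0 < X := by positivity
  have hP0 : 0 < P := Real.exp_pos _
  have hQ0 : 0 < Q := Real.exp_pos _
  have hcpi : c ≤ π := by
    rw [le_div_iff₀ (by linarith)] at h1
    linarith
  have hs0 : 0 < s := mul_pos (by linarith) h0
  have hsc : s < c := by rw [hs, hc]; nlinarith
  have hsins : 0 < Real.sin s := Real.sin_pos_of_pos_of_lt_pi hs0 (by linarith)
  rcases hcpi.eq_or_lt with hceq | hclt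
  · rw [hceq, Real.sin_pi] at him
    linarith [mul_pos hX0 hsins]
  have hsinc : 0 < Real.sin c := Real.sin_pos_of_pos_of_lt_pi (by linarith) hclt
  rcases lt_or_ge c (π / 2) with hlt | hge
  · have hcosc : 0 < Real.cos c := Real.cos_pos_of_mem_Ioo ⟨by linarith, hlt⟩
    have h2c : 0 < Real.sin (2 * c) := Real.sin_pos_of_pos_of_lt_pi (by linarith) (by linarith)
    have e1 := Real.sin_add c s
    have e2 := Real.sin_sub c s
    have e3 := Real.sin_two_mul c
    have hm := mul_le_mul_of_nonneg_right hre hsinc.le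
    have hq : X * Real.sin (c + s) ≤ Q * Real.sin (2 * c) := by
      rw [e1, e3]; linear_combination hm - Real.cos c * him
    have hp : X * Real.sin (c - s) ≤ P * Real.sin (2 * c) := by
      rw [e2, e3]; linear_combination hm + Real.cos c * him
    have g1 := mul_sin_lt_sin_mul (a := 1 / (1 + α)) (c := 2 * c) (by positivity)
      (by rw [div_lt_one (by linarith)]; linarith) (by linarith) (by linarith)
    have g2 := mul_sin_lt_sin_mul (a := α / (1 + α)) (c := 2 * c) (by positivity)
      (by rw [div_lt_one (by linarith)]; linarith) (by linarith) (by linarith)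
    have a1 : 1 / (1 + α) * (2 * c) = c - s := by rw [hc, hs]; field_simp; ring
    have a2 : α / (1 + α) * (2 * c) = c + s := by rw [hc, hs]; field_simp; ring
    rw [a1] at g1
    rw [a2] at g2
    have hp' : X * (1 / (1 + α)) < P := by
      refine lt_of_mul_lt_mul_right ?_ h2c.le
      linarith [mul_lt_mul_of_pos_left g1 hX0]
    have hq' : X * (α / (1 + α)) < Q := by
      refine lt_of_mul_lt_mul_right ?_ h2c.le
      linarith [mul_lt_mul_of_pos_left g2 hX0]
    have l1 := Real.log_lt_log (by positivity) hp'
    have l2 := Real.log_lt_log (by positivity) hq'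
    rw [hX, Real.log_mul (by positivity) (by positivity), Real.log_mul (by positivity) (by positivity),
      Real.log_div (by positivity) (by positivity), Real.log_exp, hP, Real.log_exp, Real.log_one] at l1
    rw [hX, Real.log_mul (by positivity) (by positivity), Real.log_mul (by positivity) (by positivity),
      Real.log_div (by positivity) (by positivity), Real.log_exp, hQ, Real.log_exp] at l2
    have l3 := Real.log_le_log (rhoC_pos hα) hx
    rw [log_rhoC hα] at l3
    have l4 : (1 + α) * (Real.log (1 + α) - α / (1 + α) * Real.log α) =
      (1 + α) * Real.log (1 + α) - α * Real.log α := by field_simp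
    have l5 := mul_le_mul_of_nonneg_left l3 (show 0 ≤ 1 + α by linarith)
    rw [l4] at l5
    have l6 := mul_lt_mul_of_pos_left l2 (show 0 < α by linarith)
    linarith
  · have hcosc : Real.cos c ≤ 0 := Real.cos_nonpos_of_pi_div_two_le_of_le hge (by linarith)
    rcases lt_or_ge 0 (Real.cos s) with hcs | hcs
    · linarith [mul_pos hX0 hcs, mul_nonneg (add_pos hP0 hQ0).le (neg_nonneg.2 hcosc)]
    · have hs2 : π / 2 ≤ s := by
        by_contra h
        exact absurd (Real.cos_pos_of_mem_Ioo ⟨by linarith, not_le.1 h⟩) (not_lt.2 hcs)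
      have hss : Real.sin c ≤ Real.sin s := by
        rw [← Real.sin_pi_sub c, ← Real.sin_pi_sub s]
        exact Real.sin_le_sin_of_le_of_le_pi_div_two (by linarith) (by linarith) (by linarith)
      have hcc : Real.cos c < Real.cos s :=
        Real.cos_lt_cos_of_nonneg_of_le_pi hs0.le hclt.le hsc
      have hQP : X ≤ Q - P := by
        by_contra h
        push Not at h
        linarith [mul_le_mul_of_nonneg_left hss hX0.le, mul_lt_mul_of_pos_right h hsinc]
      linarith [mul_lt_mul_of_pos_left hcc hX0,
        mul_le_mul_of_nonneg_right (show X ≤ P + Q by linarith) (neg_nonneg.2 hcosc)]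

/-- The exponential prefactor of `contourG`. -/
def contourE (α : ℝ) (ζ : ℂ) : ℂ := Complex.exp (((α + 1) / 2 : ℝ) * ζ)

/-- The analytic continuation of `e^t √(x - phiF α (e^t))` to the strip `0 < Im ζ ≤ π / (1 + α)`. -/
def contourG (α x : ℝ) (ζ : ℂ) : ℂ := csqrt (contourN α x ζ) * contourE α ζ

lemma contourE_sq (α : ℝ) (ζ : ℂ) : contourE α ζ ^ 2 = Complex.exp ((α + 1 : ℝ) * ζ) := by
  unfold contourE
  rw [← Complex.exp_nat_mul]
  congr 1
  push_cast; ring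

lemma contourE_ne_zero (α : ℝ) (ζ : ℂ) : contourE α ζ ≠ 0 := Complex.exp_ne_zero _

lemma contourE_re (α : ℝ) (ζ : ℂ) : (contourE α ζ).re =
    Real.exp ((α + 1) / 2 * ζ.re) * Real.cos ((α + 1) / 2 * ζ.im) := by
  unfold contourE
  rw [Complex.exp_re, Complex.re_ofReal_mul, Complex.im_ofReal_mul]

lemma contourE_im (α : ℝ) (ζ : ℂ) : (contourE α ζ).im =
    Real.exp ((α + 1) / 2 * ζ.re) * Real.sin ((α + 1) / 2 * ζ.im) := by
  unfold contourE
  rw [Complex.exp_im, Complex.re_ofReal_mul, Complex.im_ofReal_mul]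

lemma norm_contourE (α : ℝ) (ζ : ℂ) : ‖contourE α ζ‖ = Real.exp ((α + 1) / 2 * ζ.re) := by
  unfold contourE
  rw [Complex.norm_exp, Complex.re_ofReal_mul]

lemma norm_sub_mul_norm_le {a b : ℂ} (h : 0 ≤ a.re * b.re + a.im * b.im) :
    ‖a - b‖ * ‖b‖ ≤ ‖a ^ 2 - b ^ 2‖ := by
  rw [show a ^ 2 - b ^ 2 = (a - b) * (a + b) by ring, norm_mul]
  refine mul_le_mul_of_nonneg_left ?_ (norm_nonneg _)
  rw [← sq_le_sq₀ (norm_nonneg _) (norm_nonneg _), ← Complex.normSq_eq_norm_sq,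
    ← Complex.normSq_eq_norm_sq, Complex.normSq_apply, Complex.normSq_apply, Complex.add_re,
    Complex.add_im]
  nlinarith [mul_self_nonneg a.re, mul_self_nonneg a.im]

lemma norm_sub_sq_le {a b : ℂ} (h : 0 ≤ a.re * b.re + a.im * b.im) :
    ‖a - b‖ ^ 2 ≤ ‖a ^ 2 - b ^ 2‖ := by
  rw [show a ^ 2 - b ^ 2 = (a - b) * (a + b) by ring, norm_mul, sq]
  refine mul_le_mul_of_nonneg_left ?_ (norm_nonneg _)
  rw [← sq_le_sq₀ (norm_nonneg _) (norm_nonneg _), ← Complex.normSq_eq_norm_sq,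
    ← Complex.normSq_eq_norm_sq, Complex.normSq_apply, Complex.normSq_apply, Complex.add_re,
    Complex.add_im, Complex.sub_re, Complex.sub_im]
  nlinarith

lemma norm_sub_mul_re_le {a b : ℂ} (h : 0 ≤ a.re) : ‖a - b‖ * b.re ≤ ‖a ^ 2 - b ^ 2‖ := by
  rw [show a ^ 2 - b ^ 2 = (a - b) * (a + b) by ring, norm_mul]
  refine mul_le_mul_of_nonneg_left ?_ (norm_nonneg _)
  have := Complex.re_le_norm (a + b)
  rw [Complex.add_re] at this
  linarith

lemma csqrt_re_pos {z : ℂ} (hz : z ∈ Complex.slitPlane) : 0 < (csqrt z).re := by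
  rw [csqrt_re, Real.sqrt_pos]
  rw [Complex.mem_slitPlane_iff] at hz
  rcases hz with h | h
  · have := norm_nonneg z; linarith
  · have := neg_lt_of_abs_lt (Complex.abs_re_lt_norm.2 h); linarith

lemma norm_contourG_sub_right {α x : ℝ} (hα : 1 < α) (hx : 0 < x) {ζ : ℂ} (hre : 0 ≤ ζ.re)
    (h0 : 0 < ζ.im) (h1 : ζ.im ≤ π / (1 + α)) :
    ‖contourG α x ζ - (-Complex.I * Complex.exp ((α + 1 : ℝ) * ζ))‖ ≤
      x * Real.exp (-(α - 1) * ζ.re) + Real.exp (-(α + 1) * ζ.re) := by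
  have h1' : (α + 1) * ζ.im ≤ π := by
    rw [le_div_iff₀ (by linarith)] at h1; linarith
  have hp : 0 < (α + 1) * ζ.im := by positivity
  have hm : 0 < (α - 1) * ζ.im := mul_pos (by linarith) h0
  have hN : (contourN α x ζ).im < 0 := by
    rw [contourN_im]
    have s1 : 0 < Real.sin ((α - 1) * ζ.im) := Real.sin_pos_of_pos_of_lt_pi hm (by nlinarith)
    have s2 : 0 ≤ Real.sin ((α + 1) * ζ.im) := Real.sin_nonneg_of_nonneg_of_le_pi hp.le h1'
    have s3 : Real.exp (-(α + 1) * ζ.re) ≤ Real.exp ((α + 1) * ζ.re) :=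
      Real.exp_le_exp.2 (by nlinarith)
    have s4 : 0 < x * Real.exp (-(α - 1) * ζ.re) * Real.sin ((α - 1) * ζ.im) := by positivity
    have s5 := mul_nonneg (sub_nonneg.2 s3) s2
    linarith
  set a := csqrt (contourN α x ζ) with ha
  set E := contourE α ζ with hE
  have har := csqrt_re_nonneg (contourN α x ζ)
  have hai : a.im ≤ 0 := by
    have := two_mul_csqrt (contourN α x ζ)
    by_contra h
    push Not at h
    have := mul_nonneg (mul_nonneg zero_le_two har) h.le
    linarith
  have hEr : 0 ≤ E.re := by
    rw [hE, contourE_re]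
    exact mul_nonneg (Real.exp_pos _).le (Real.cos_nonneg_of_mem_Icc ⟨by linarith, by linarith⟩)
  have hEi : 0 ≤ E.im := by
    rw [hE, contourE_im]
    exact mul_nonneg (Real.exp_pos _).le (Real.sin_nonneg_of_nonneg_of_le_pi (by linarith) (by linarith))
  have key := norm_sub_mul_norm_le (a := a) (b := -Complex.I * E) (by
    simp only [Complex.mul_re, Complex.mul_im, Complex.neg_re, Complex.neg_im, Complex.I_re,
      Complex.I_im]
    nlinarith [mul_nonneg har hEi, mul_nonneg (neg_nonneg.2 hai) hEr])
  have e1 : contourG α x ζ - (-Complex.I * Complex.exp ((α + 1 : ℝ) * ζ)) = (a - -Complex.I * E) * E := by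
    rw [← contourE_sq]; unfold contourG; rw [← ha, ← hE]; ring
  have e2 : a ^ 2 - (-Complex.I * E) ^ 2 =
      x * Complex.exp (-((α - 1 : ℝ) * ζ)) - Complex.exp (-((α + 1 : ℝ) * ζ)) := by
    rw [ha, csqrt_sq, mul_pow, contourE_sq, neg_sq, Complex.I_sq, contourN]; ring
  rw [e1, norm_mul]
  rw [norm_mul, norm_neg, Complex.norm_I, one_mul, e2] at key
  refine key.trans ((norm_sub_le _ _).trans (le_of_eq ?_))
  rw [norm_mul, Complex.norm_real, Real.norm_of_nonneg hx.le, Complex.norm_exp, Complex.norm_exp]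
  simp only [Complex.neg_re, Complex.re_ofReal_mul, neg_mul]

lemma norm_contourG_sub_left {α x : ℝ} (hα : 1 < α) (hx : rhoC α ≤ x) {ζ : ℂ}
    (hδ : x * Real.exp (2 * ζ.re) + Real.exp (2 * (α + 1) * ζ.re) ≤ 1)
    (h0 : 0 < ζ.im) (h1 : ζ.im ≤ π / (1 + α)) :
    ‖contourG α x ζ - Complex.I‖ ≤
      2 * √(x * Real.exp (2 * ζ.re) + Real.exp (2 * (α + 1) * ζ.re)) := by
  have hx0 : 0 < x := (rhoC_pos hα).trans_le hx
  have h1' : (α + 1) * ζ.im ≤ π := by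
    rw [le_div_iff₀ (by linarith)] at h1; linarith
  have hp : 0 < (α + 1) * ζ.im := by positivity
  have hm : 0 < (α - 1) * ζ.im := mul_pos (by linarith) h0
  set t := ζ.re with ht
  set δ := x * Real.exp (2 * t) + Real.exp (2 * (α + 1) * t) with hδd
  have hδ0 : 0 < δ := by positivity
  set a := csqrt (contourN α x ζ) with ha
  set E := contourE α ζ with hE
  set b : ℂ := Complex.I * E⁻¹ with hb
  have har : 0 < a.re := csqrt_re_pos (contourN_mem_slitPlane hα hx h0 h1)
  have hEinv : E⁻¹ = Complex.exp ((-((α + 1) / 2) : ℝ) * ζ) := by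
    rw [hE, contourE, ← Complex.exp_neg]; congr 1; push_cast; ring
  have hbr : b.re = Real.exp (-((α + 1) / 2) * t) * Real.sin ((α + 1) / 2 * ζ.im) := by
    rw [hb, Complex.I_mul_re, hEinv, Complex.exp_im, Complex.re_ofReal_mul, Complex.im_ofReal_mul,
      neg_mul ((α + 1) / 2) ζ.im, Real.sin_neg]
    ring
  have hbi : b.im = Real.exp (-((α + 1) / 2) * t) * Real.cos ((α + 1) / 2 * ζ.im) := by
    rw [hb, Complex.I_mul_im, hEinv, Complex.exp_re, Complex.re_ofReal_mul, Complex.im_ofReal_mul,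
      neg_mul ((α + 1) / 2) ζ.im, Real.cos_neg]
  have hbr0 : 0 ≤ b.re := by
    rw [hbr]
    exact mul_nonneg (Real.exp_pos _).le (Real.sin_nonneg_of_nonneg_of_le_pi (by linarith) (by linarith))
  have hbi0 : 0 ≤ b.im := by
    rw [hbi]
    exact mul_nonneg (Real.exp_pos _).le (Real.cos_nonneg_of_mem_Icc ⟨by linarith, by linarith⟩)
  have hE0 : E ≠ 0 := contourE_ne_zero α ζ
  have e1 : contourG α x ζ - Complex.I = (a - b) * E := by
    unfold contourG; rw [← ha, ← hE, hb, sub_mul, mul_assoc, inv_mul_cancel₀ hE0, mul_one]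
  have e2 : a ^ 2 - b ^ 2 = x * Complex.exp (-((α - 1 : ℝ) * ζ)) - Complex.exp ((α + 1 : ℝ) * ζ) := by
    rw [ha, csqrt_sq, hb, mul_pow, inv_pow, contourE_sq, Complex.I_sq, contourN, ← Complex.exp_neg]
    ring
  have hEn : ‖E‖ = Real.exp ((α + 1) / 2 * t) := norm_contourE α ζ
  have e3 : ‖a ^ 2 - b ^ 2‖ * ‖E‖ ^ 2 ≤ δ := by
    have : ‖a ^ 2 - b ^ 2‖ ≤ x * Real.exp (-(α - 1) * t) + Real.exp ((α + 1) * t) := by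
      rw [e2]
      refine (norm_sub_le _ _).trans (le_of_eq ?_)
      rw [norm_mul, Complex.norm_real, Real.norm_of_nonneg hx0.le, Complex.norm_exp, Complex.norm_exp]
      simp only [Complex.neg_re, Complex.re_ofReal_mul, neg_mul]
      rfl
    refine (mul_le_mul_of_nonneg_right this (by positivity)).trans (le_of_eq ?_)
    rw [hEn, ← Real.exp_nat_mul, add_mul, mul_assoc, ← Real.exp_add, ← Real.exp_add, hδd]
    congr 3 <;> (push_cast; ring)
  rw [e1, norm_mul]
  rcases le_or_gt 0 (contourN α x ζ).im with hN | hN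
  · have hai : 0 ≤ a.im := by
      have := two_mul_csqrt (contourN α x ζ)
      by_contra h
      push Not at h
      have := mul_neg_of_pos_of_neg (mul_pos two_pos har) h
      linarith
    have key := norm_sub_sq_le (add_nonneg (mul_nonneg har.le hbr0) (mul_nonneg hai hbi0))
    have : ‖a - b‖ * ‖E‖ ≤ √δ := by
      apply Real.le_sqrt_of_sq_le
      rw [mul_pow]
      exact (mul_le_mul_of_nonneg_right key (by positivity)).trans e3
    linarith [Real.sqrt_nonneg δ]
  · have hη : π / 2 ≤ (α + 1) * ζ.im := by
      by_contra h
      push Not at h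
      rw [contourN_im] at hN
      have s2 : 0 < Real.sin ((α + 1) * ζ.im) := Real.sin_pos_of_pos_of_lt_pi hp (by linarith)
      have s1 : Real.sin ((α - 1) * ζ.im) ≤ Real.sin ((α + 1) * ζ.im) :=
        Real.sin_le_sin_of_le_of_le_pi_div_two (by linarith) h.le (by nlinarith)
      have s3 : x * Real.exp (-(α - 1) * t) + Real.exp ((α + 1) * t) =
          δ * Real.exp (-(α + 1) * t) := by
        rw [hδd, add_mul (x * _), mul_assoc x, ← Real.exp_add, ← Real.exp_add]
        congr 3 <;> ring
      have s4 : δ * Real.exp (-(α + 1) * t) ≤ 1 * Real.exp (-(α + 1) * t) :=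
        mul_le_mul_of_nonneg_right hδ (Real.exp_pos _).le
      have s5 := mul_le_mul_of_nonneg_left s1
        (show 0 ≤ x * Real.exp (-(α - 1) * t) by positivity)
      rw [← s3] at s4
      have s6 := mul_le_mul_of_nonneg_right s4 s2.le
      linarith
    have hs : 1 / 2 ≤ Real.sin ((α + 1) / 2 * ζ.im) := by
      rw [← Real.sin_pi_div_six]
      exact Real.sin_le_sin_of_le_of_le_pi_div_two (by linarith [pi_pos]) (by linarith)
        (by linarith [pi_pos])
    have key := norm_sub_mul_re_le (a := a) (b := b) har.le
    have hEb : 1 / 2 ≤ b.re * ‖E‖ := by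
      rw [hbr, hEn, mul_right_comm, ← Real.exp_add]
      simpa using hs
    have k2 : ‖a - b‖ * ‖E‖ * (b.re * ‖E‖) ≤ δ := by
      refine le_trans (le_of_eq ?_) ((mul_le_mul_of_nonneg_right key (sq_nonneg ‖E‖)).trans e3)
      ring
    have k3 := mul_le_mul_of_nonneg_left hEb
      (mul_nonneg (norm_nonneg (a - b)) (norm_nonneg E))
    have k4 : δ ≤ √δ := Real.le_sqrt_of_sq_le (by nlinarith)
    linarith

/-- The point `x * e^{iθ}` at which the kernel `Ka` has its pole. -/
def kerPole (α x : ℝ) : ℂ := x * Complex.exp (kerAngle α * Complex.I)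

lemma contourG_top {α x : ℝ} (hα : 1 < α) (t : ℝ) :
    contourG α x (t + (π / (1 + α) : ℝ) * Complex.I) =
      Complex.I * (Real.exp t : ℝ) * csqrt (phiF α (Real.exp t) - kerPole α x) := by
  have hα1 : (1 + (α : ℂ)) ≠ 0 := by
    rw [← Complex.ofReal_one, ← Complex.ofReal_add, Complex.ofReal_ne_zero]; linarith
  have hN : contourN α x (t + (π / (1 + α) : ℝ) * Complex.I) =
      (Real.exp (-(α - 1) * t) : ℝ) * (phiF α (Real.exp t) - kerPole α x) := by
    have a1 : Complex.exp (-((α - 1 : ℝ) * (t + (π / (1 + α) : ℝ) * Complex.I))) =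
        -(Real.exp (-(α - 1) * t) * Complex.exp (kerAngle α * Complex.I)) := by
      rw [Complex.ofReal_exp, ← Complex.exp_add, neg_eq_neg_one_mul (Complex.exp _),
        ← Complex.exp_neg_pi_mul_I, ← Complex.exp_add]
      congr 1
      unfold kerAngle
      push_cast
      field_simp
      ring
    have a2 : Complex.exp ((α + 1 : ℝ) * (t + (π / (1 + α) : ℝ) * Complex.I)) =
        -(Real.exp (-(α - 1) * t) * (Real.exp t ^ (2 * α) : ℝ)) := by
      rw [← Real.exp_mul, ← Complex.ofReal_mul, ← Real.exp_add, Complex.ofReal_exp,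
        neg_eq_neg_one_mul (Complex.exp _), ← Complex.exp_pi_mul_I, ← Complex.exp_add]
      congr 1
      push_cast
      field_simp
      ring
    have a3 : Complex.exp (-((α + 1 : ℝ) * (t + (π / (1 + α) : ℝ) * Complex.I))) =
        -(Real.exp (-(α - 1) * t) * ((Real.exp t ^ 2)⁻¹ : ℝ)) := by
      rw [← Real.exp_nat_mul, ← Real.exp_neg, ← Complex.ofReal_mul, ← Real.exp_add,
        Complex.ofReal_exp, neg_eq_neg_one_mul (Complex.exp _), ← Complex.exp_neg_pi_mul_I,
        ← Complex.exp_add]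
      congr 1
      push_cast
      field_simp
      ring
    unfold contourN
    rw [a1, a2, a3, phiF, kerPole]
    push_cast
    ring
  have hE : contourE α (t + (π / (1 + α) : ℝ) * Complex.I) =
      (Real.exp ((α + 1) / 2 * t) : ℝ) * Complex.I := by
    conv_rhs => rw [← Complex.exp_pi_div_two_mul_I, Complex.ofReal_exp, ← Complex.exp_add]
    rw [contourE]
    congr 1
    push_cast
    field_simp
    ring
  have hr : √(Real.exp (-(α - 1) * t)) * Real.exp ((α + 1) / 2 * t) = Real.exp t := by
    rw [Real.sqrt_eq_rpow, ← Real.exp_mul, ← Real.exp_add]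
    congr 1; ring
  unfold contourG
  rw [hN, csqrt_ofReal_mul (Real.exp_pos _), hE, ← hr]
  push_cast
  ring

lemma contourG_top_re {α x : ℝ} (hα : 1 < α) (t : ℝ) :
    (contourG α x (t + (π / (1 + α) : ℝ) * Complex.I)).re =
      -(Real.exp t * (csqrt (phiF α (Real.exp t) - kerPole α x)).im) := by
  rw [contourG_top hα, mul_assoc, Complex.I_mul_re, Complex.im_ofReal_mul]

lemma contourN_ofReal (α x t : ℝ) : contourN α x t =
    ((Real.exp (-(α - 1) * t) * (x - phiF α (Real.exp t)) : ℝ) : ℂ) := by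
  have a2 : Real.exp ((α + 1) * t) = Real.exp (-(α - 1) * t) * Real.exp t ^ (2 * α) := by
    rw [← Real.exp_mul, ← Real.exp_add]; congr 1; ring
  have a3 : Real.exp (-((α + 1) * t)) = Real.exp (-(α - 1) * t) * (Real.exp t ^ 2)⁻¹ := by
    rw [← Real.exp_nat_mul, ← Real.exp_neg, ← Real.exp_add]; congr 1; push_cast; ring
  have : contourN α x t = ((x * Real.exp (-(α - 1) * t) - Real.exp ((α + 1) * t) -
      Real.exp (-((α + 1) * t)) : ℝ) : ℂ) := by
    unfold contourN
    push_cast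
    congr 4; ring
  rw [this, a2, a3, phiF]
  congr 1
  ring

lemma contourG_ofReal_re (α x t : ℝ) : (csqrt (contourN α x t)).re * (contourE α t).re =
    Real.exp t * √(x - phiF α (Real.exp t)) := by
  rw [contourN_ofReal, csqrt_ofReal_re, contourE_re, Complex.ofReal_re, Complex.ofReal_im, mul_zero,
    Real.cos_zero, mul_one, Real.sqrt_mul (Real.exp_pos _).le, mul_right_comm, Real.sqrt_eq_rpow,
    ← Real.exp_mul, ← Real.exp_add]
  congr 2; ring

lemma continuous_contourN (α x : ℝ) : Continuous (contourN α x) := by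
  unfold contourN; fun_prop

lemma continuous_contourE (α : ℝ) : Continuous (contourE α) := by
  unfold contourE; fun_prop

lemma differentiableAt_contourG {α x : ℝ} (hα : 1 < α) (hx : rhoC α ≤ x) {ζ : ℂ}
    (h0 : 0 < ζ.im) (h1 : ζ.im ≤ π / (1 + α)) : DifferentiableAt ℂ (contourG α x) ζ := by
  have hN : DifferentiableAt ℂ (contourN α x) ζ := by unfold contourN; fun_prop
  have hE : DifferentiableAt ℂ (contourE α) ζ := by unfold contourE; fun_prop
  exact (hN.cpow (differentiableAt_const _) (contourN_mem_slitPlane hα hx h0 h1)).mul hE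

lemma tendsto_contourG_re (α x t : ℝ) :
    Tendsto (fun ε : ℝ => (contourG α x (t + ε * Complex.I)).re) (𝓝 0)
      (𝓝 (Real.exp t * √(x - phiF α (Real.exp t)))) := by
  have hp : Continuous fun ε : ℝ => (t : ℂ) + ε * Complex.I := by fun_prop
  have hN := (continuous_contourN α x).comp hp
  have hE := (continuous_contourE α).comp hp
  have h1 : Tendsto (fun ε : ℝ => (csqrt (contourN α x (t + ε * Complex.I))).re *
      (contourE α (t + ε * Complex.I)).re) (𝓝 0)
      (𝓝 (Real.exp t * √(x - phiF α (Real.exp t)))) := by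
    have hc : Continuous (fun ε : ℝ => (csqrt (contourN α x (t + ε * Complex.I))).re *
      (contourE α (t + ε * Complex.I)).re) :=
      (continuous_csqrt_re.comp hN).mul (Complex.continuous_re.comp hE)
    rw [← contourG_ofReal_re]
    simpa using hc.tendsto 0
  have h2 : Tendsto (fun ε : ℝ => (csqrt (contourN α x (t + ε * Complex.I))).im *
      (contourE α (t + ε * Complex.I)).im) (𝓝 0) (𝓝 0) := by
    have h3 : Tendsto (fun ε : ℝ => √‖contourN α x (t + ε * Complex.I)‖ *
      |(contourE α (t + ε * Complex.I)).im|) (𝓝 0) (𝓝 0) := by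
      have hc : Continuous (fun ε : ℝ => √‖contourN α x (t + ε * Complex.I)‖ *
        |(contourE α (t + ε * Complex.I)).im|) :=
        (hN.norm.sqrt).mul (Complex.continuous_im.comp hE).abs
      simpa [contourE_im] using hc.tendsto 0
    refine squeeze_zero_norm (fun ε => ?_) h3
    rw [norm_mul]
    refine mul_le_mul_of_nonneg_right ?_ (norm_nonneg _)
    rw [← norm_csqrt_sq, Real.sqrt_sq (norm_nonneg _)]
    exact Complex.abs_im_le_norm _
  have h4 := h1.sub h2
  rw [sub_zero] at h4
  refine h4.congr fun ε => ?_
  unfold contourG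
  rw [Complex.mul_re]

lemma norm_contourG_le (α x : ℝ) (ζ : ℂ) :
    ‖contourG α x ζ‖ ≤ √‖contourN α x ζ‖ * ‖contourE α ζ‖ := by
  unfold contourG
  rw [norm_mul, ← norm_csqrt_sq (contourN α x ζ), Real.sqrt_sq (norm_nonneg _)]

lemma continuous_contour_path {α x : ℝ} (hα : 1 < α) (hx : rhoC α ≤ x) {ε : ℝ} (h0 : 0 < ε)
    (h1 : ε ≤ π / (1 + α)) : Continuous fun t : ℝ => contourG α x (t + ε * Complex.I) := by
  refine continuous_iff_continuousAt.2 fun t => ?_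
  have := (differentiableAt_contourG hα hx (ζ := t + ε * Complex.I) (by simpa using h0)
    (by simpa using h1)).continuousAt
  exact ContinuousAt.comp (f := fun t : ℝ => (t : ℂ) + ε * Complex.I) this (by fun_prop)

lemma tendsto_integral_contourG_re {α x : ℝ} (hα : 1 < α) (hx : rhoC α ≤ x) (L : ℝ) :
    Tendsto (fun ε : ℝ => ∫ t in (-L)..L, (contourG α x (t + ε * Complex.I)).re) (𝓝[>] 0)
      (𝓝 (∫ t in (-L)..L, Real.exp t * √(x - phiF α (Real.exp t)))) := by
  have hα1 : 0 < 1 + α := by linarith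
  have hb : 0 < π / (1 + α) := by positivity
  have hK : Continuous fun p : ℝ × ℝ => √‖contourN α x (p.1 + p.2 * Complex.I)‖ *
      ‖contourE α (p.1 + p.2 * Complex.I)‖ := by
    have hp : Continuous fun p : ℝ × ℝ => (p.1 : ℂ) + p.2 * Complex.I := by fun_prop
    exact (((continuous_contourN α x).comp hp).norm.sqrt).mul ((continuous_contourE α).comp hp).norm
  obtain ⟨C, hC⟩ := ((isCompact_uIcc (a := -L) (b := L)).prod (isCompact_Icc (a := (0:ℝ))
    (b := π / (1 + α)))).bddAbove_image hK.continuousOn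
  have hC' : ∀ t ε : ℝ, t ∈ uIcc (-L) L → 0 ≤ ε → ε ≤ π / (1 + α) →
      √‖contourN α x (t + ε * Complex.I)‖ * ‖contourE α (t + ε * Complex.I)‖ ≤ C :=
    fun t ε ht h0 h1 => hC ⟨(t, ε), ⟨ht, h0, h1⟩, rfl⟩
  have hev : ∀ᶠ ε : ℝ in 𝓝[>] 0, 0 < ε ∧ ε ≤ π / (1 + α) := by
    filter_upwards [Ioc_mem_nhdsGT hb] with ε hε using hε
  refine intervalIntegral.tendsto_integral_filter_of_dominated_convergence (fun _ => C) ?_ ?_ ?_ ?_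
  · filter_upwards [hev] with ε hε
    exact (Complex.continuous_re.comp (continuous_contour_path hα hx hε.1 hε.2)).aestronglyMeasurable
  · filter_upwards [hev] with ε hε
    refine Eventually.of_forall fun t ht => ?_
    refine (Complex.abs_re_le_norm _).trans ((norm_contourG_le _ _ _).trans ?_)
    exact hC' t ε (uIoc_subset_uIcc ht) hε.1.le hε.2
  · exact intervalIntegrable_const
  · refine Eventually.of_forall fun t _ => ?_
    exact (tendsto_contourG_re α x t).mono_left nhdsWithin_le_nhds

lemma abs_contour_integral_le {α x : ℝ} (hα : 1 < α) (hx : rhoC α ≤ x) {L : ℝ} (hL : 0 ≤ L)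
    (hδ : x * Real.exp (2 * -L) + Real.exp (2 * (α + 1) * -L) ≤ 1) :
    |(∫ t in (-L)..L, Real.exp t * √(x - phiF α (Real.exp t))) +
      (∫ t in (-L)..L, Real.exp t * (csqrt (phiF α (Real.exp t) - kerPole α x)).im) +
        π / (1 + α)| ≤
      ((x * Real.exp (-(α - 1) * L) + Real.exp (-(α + 1) * L)) +
        2 * √(x * Real.exp (2 * -L) + Real.exp (2 * (α + 1) * -L))) * (π / (1 + α)) := by
  have hα1 : 0 < 1 + α := by linarith
  have hx0 : 0 < x := (rhoC_pos hα).trans_le hx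
  set b := π / (1 + α) with hbdef
  have hb : 0 < b := by positivity
  set eR := x * Real.exp (-(α - 1) * L) + Real.exp (-(α + 1) * L) with heR
  set eL := 2 * √(x * Real.exp (2 * -L) + Real.exp (2 * (α + 1) * -L)) with heL
  have heR0 : 0 ≤ eR := by positivity
  have heL0 : 0 ≤ eL := by positivity
  set F : ℝ → ℂ := fun η => -(Complex.exp ((α + 1 : ℝ) * (L + η * Complex.I)) / (α + 1 : ℝ)) with hF
  have hFc : Continuous F := by rw [hF]; fun_prop
  have hα1' : ((α + 1 : ℝ) : ℂ) ≠ 0 := Complex.ofReal_ne_zero.2 (by linarith)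
  have hFd : ∀ η : ℝ, HasDerivAt F
      (-Complex.I * Complex.exp ((α + 1 : ℝ) * (L + η * Complex.I))) η := fun η => by
    have h1 : HasDerivAt (fun η : ℝ => ((α + 1 : ℝ) : ℂ) * (L + η * Complex.I))
        ((α + 1 : ℝ) * Complex.I) η := by
      have := (((hasDerivAt_id η).ofReal_comp.mul_const Complex.I).const_add (L : ℂ)).const_mul
        ((α + 1 : ℝ) : ℂ)
      refine this.congr_deriv ?_
      simp
    refine ((h1.cexp.div_const ((α + 1 : ℝ) : ℂ)).neg).congr_deriv ?_
    field_simp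
  have hF0 : (F b).im - (F 0).im = 0 := by
    have e1 : Complex.exp ((α + 1 : ℝ) * (L + b * Complex.I)) = -Complex.exp ((α + 1 : ℝ) * L) := by
      have : ((α + 1 : ℝ) : ℂ) * b = π := by
        rw [← Complex.ofReal_mul, hbdef]; congr 1; field_simp; ring
      rw [mul_add, ← mul_assoc, this, Complex.exp_add, Complex.exp_pi_mul_I]; ring
    have e2 : Complex.exp ((α + 1 : ℝ) * L) = (Real.exp ((α + 1) * L) : ℝ) := by push_cast; rfl
    have e3 : F b = ((Real.exp ((α + 1) * L) / (α + 1) : ℝ) : ℂ) := by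
      rw [hF]; simp only; rw [e1, e2]; push_cast; ring
    have e4 : F 0 = ((-(Real.exp ((α + 1) * L) / (α + 1)) : ℝ) : ℂ) := by
      rw [hF]; simp only; rw [Complex.ofReal_zero, zero_mul, add_zero, e2]; push_cast; ring
    rw [e3, e4, Complex.ofReal_im, Complex.ofReal_im, sub_zero]
  set T := ∫ t in (-L)..L, Real.exp t * (csqrt (phiF α (Real.exp t) - kerPole α x)).im with hT
  have key : ∀ ε : ℝ, 0 < ε ∧ ε ≤ b →
      |(∫ t in (-L)..L, (contourG α x (t + ε * Complex.I)).re) + T + (b - ε)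
        - ((F b).im - (F ε).im)| ≤ (eR + eL) * b := by
    rintro ε ⟨hε0, hεb⟩
    have hmem : ∀ η ∈ uIcc ε b, 0 < η ∧ η ≤ b := fun η hη => by
      rw [uIcc_of_le hεb] at hη
      exact ⟨hε0.trans_le hη.1, hη.2⟩
    have cauchy := Complex.integral_boundary_rect_eq_zero_of_differentiableOn (contourG α x)
      ((-L : ℝ) + ε * Complex.I) ((L : ℝ) + b * Complex.I) (by
        intro ζ hζ
        rw [Complex.mem_reProdIm] at hζ
        have him := hζ.2
        simp only [Complex.add_im, Complex.ofReal_im, Complex.mul_im, Complex.ofReal_re,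
          Complex.I_im, Complex.I_re, mul_one, mul_zero, add_zero, zero_add] at him
        exact (differentiableAt_contourG hα hx (hmem _ him).1 (hmem _ him).2).differentiableWithinAt)
    simp only [Complex.add_im, Complex.ofReal_im, Complex.mul_im, Complex.ofReal_re,
      Complex.I_im, Complex.I_re, mul_one, mul_zero, add_zero, zero_add, Complex.add_re,
      Complex.mul_re, sub_zero, smul_eq_mul] at cauchy
    set Bt := ∫ t in (-L)..L, contourG α x (t + ε * Complex.I) with hBt
    set Tp := ∫ t in (-L)..L, contourG α x (t + b * Complex.I) with hTp
    set Rt := ∫ η in ε..b, contourG α x ((L : ℝ) + η * Complex.I) with hRt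
    set Lf := ∫ η in ε..b, contourG α x ((-L : ℝ) + η * Complex.I) with hLf
    have hcB := continuous_contour_path hα hx hε0 hεb
    have hcT := continuous_contour_path hα hx hb le_rfl
    have hBre : Bt.re = ∫ t in (-L)..L, (contourG α x (t + ε * Complex.I)).re :=
      (Complex.reCLM.intervalIntegral_comp_comm (hcB.intervalIntegrable _ _)).symm
    have hTre : Tp.re = -T := by
      have : Tp.re = ∫ t in (-L)..L, (contourG α x (t + b * Complex.I)).re :=
        (Complex.reCLM.intervalIntegral_comp_comm (hcT.intervalIntegrable _ _)).symm
      rw [this, hT, ← intervalIntegral.integral_neg]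
      exact intervalIntegral.integral_congr fun t _ => contourG_top_re hα t
    have hvert : ∀ s : ℝ, ContinuousOn (fun η : ℝ => contourG α x (s + η * Complex.I)) (uIcc ε b) :=
      fun s η hη => by
        have hd := (differentiableAt_contourG hα hx (ζ := s + η * Complex.I)
          (by simpa using (hmem η hη).1) (by simpa using (hmem η hη).2)).continuousAt
        exact (ContinuousAt.comp (f := fun η : ℝ => (s : ℂ) + η * Complex.I) hd
          (by fun_prop)).continuousWithinAt
    have hRint : ∫ η in ε..b, -Complex.I * Complex.exp ((α + 1 : ℝ) * (L + η * Complex.I)) =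
        F b - F ε :=
      intervalIntegral.integral_eq_sub_of_hasDerivAt (fun η _ => hFd η)
        (Continuous.intervalIntegrable (by fun_prop) _ _)
    have hmemI : ∀ η ∈ uIoc ε b, 0 < η ∧ η ≤ b := fun η hη => hmem η (uIoc_subset_uIcc hη)
    have hbε : |b - ε| ≤ b := by rw [abs_of_nonneg (by linarith)]; linarith
    have hR : ‖Rt - (F b - F ε)‖ ≤ eR * b := by
      rw [← hRint, hRt, ← intervalIntegral.integral_sub (hvert L).intervalIntegrable
        (Continuous.intervalIntegrable (by fun_prop) _ _)]
      refine (intervalIntegral.norm_integral_le_of_norm_le_const (C := eR) fun η hη => ?_).trans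
        (mul_le_mul_of_nonneg_left hbε heR0)
      have := norm_contourG_sub_right hα hx0 (ζ := L + η * Complex.I) (by simpa using hL)
        (by simpa using (hmemI η hη).1) (by simpa using (hmemI η hη).2)
      have hre : ((L : ℂ) + η * Complex.I).re = L := by simp
      rw [hre] at this
      exact this
    have hLe : ‖Lf - (b - ε : ℝ) * Complex.I‖ ≤ eL * b := by
      have hI : ∫ η in ε..b, Complex.I = (b - ε : ℝ) * Complex.I := by
        rw [intervalIntegral.integral_const, Complex.real_smul]
      rw [← hI, hLf, ← intervalIntegral.integral_sub (hvert (-L)).intervalIntegrable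
        intervalIntegrable_const]
      refine (intervalIntegral.norm_integral_le_of_norm_le_const (C := eL) fun η hη => ?_).trans
        (mul_le_mul_of_nonneg_left hbε heL0)
      have := norm_contourG_sub_left hα hx (ζ := (-L : ℝ) + η * Complex.I) (by simpa using hδ)
        (by simpa using (hmemI η hη).1) (by simpa using (hmemI η hη).2)
      have hre : (((-L : ℝ) : ℂ) + η * Complex.I).re = -L := by simp
      rw [hre] at this
      exact this
    have hre := congrArg Complex.re cauchy
    rw [Complex.sub_re, Complex.add_re, Complex.sub_re, Complex.I_mul_re, Complex.I_mul_re,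
      Complex.zero_re, hBre, hTre] at hre
    have i1 := (Complex.abs_im_le_norm _).trans hR
    have i2 := (Complex.abs_im_le_norm _).trans hLe
    rw [Complex.sub_im, Complex.sub_im] at i1
    rw [Complex.sub_im, Complex.im_ofReal_mul, Complex.I_im, mul_one] at i2
    rw [abs_le] at i1 i2 ⊢
    constructor <;> linarith [i1.1, i1.2, i2.1, i2.2]
  have hlim : Tendsto (fun ε : ℝ => |(∫ t in (-L)..L, (contourG α x (t + ε * Complex.I)).re) + T
      + (b - ε) - ((F b).im - (F ε).im)|) (𝓝[>] 0)
      (𝓝 |(∫ t in (-L)..L, Real.exp t * √(x - phiF α (Real.exp t))) + T + b|) := by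
    have h1 := tendsto_integral_contourG_re hα hx L
    have h2 : Continuous fun ε : ℝ => T + (b - ε) - ((F b).im - (F ε).im) := by
      have := Complex.continuous_im.comp hFc
      exact (continuous_const.add (continuous_const.sub continuous_id)).sub
        (continuous_const.sub this)
    have h3 := (h2.tendsto 0).mono_left (nhdsWithin_le_nhds (s := Ioi 0))
    rw [hF0] at h3
    have h4 := (h1.add h3).abs
    simp only [sub_zero] at h4
    rw [add_assoc]
    refine h4.congr fun ε => ?_
    congr 1; ring
  refine le_of_tendsto hlim ?_
  filter_upwards [Ioc_mem_nhdsGT hb] with ε hε using key ε hε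

lemma tendsto_contour_integral {α x : ℝ} (hα : 1 < α) (hx : rhoC α ≤ x) :
    Tendsto (fun L : ℝ => (∫ t in (-L)..L, Real.exp t * √(x - phiF α (Real.exp t))) +
      (∫ t in (-L)..L, Real.exp t * (csqrt (phiF α (Real.exp t) - kerPole α x)).im)) atTop
      (𝓝 (-(π / (1 + α)))) := by
  have hexp : ∀ c : ℝ, c < 0 → Tendsto (fun L : ℝ => Real.exp (c * L)) atTop (𝓝 0) := fun c hc =>
    Real.tendsto_exp_atBot.comp (tendsto_id.const_mul_atTop_of_neg hc)
  have h1 : Tendsto (fun L : ℝ => x * Real.exp (2 * -L) + Real.exp (2 * (α + 1) * -L)) atTop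
      (𝓝 0) := by
    have := ((hexp (-2) (by norm_num)).const_mul x).add (hexp (-(2 * (α + 1))) (by linarith))
    rw [mul_zero, add_zero] at this
    refine this.congr fun L => ?_
    rw [show 2 * -L = -2 * L by ring, show 2 * (α + 1) * -L = -(2 * (α + 1)) * L by ring]
  have h2 : Tendsto (fun L : ℝ => x * Real.exp (-(α - 1) * L) + Real.exp (-(α + 1) * L)) atTop
      (𝓝 0) := by
    have := ((hexp (-(α - 1)) (by linarith)).const_mul x).add (hexp (-(α + 1)) (by linarith))
    rwa [mul_zero, add_zero] at this
  have h3 := (h2.add (h1.sqrt.const_mul 2)).mul_const (π / (1 + α))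
  rw [Real.sqrt_zero, mul_zero, add_zero, zero_mul] at h3
  have h4 : Tendsto (fun L : ℝ => (∫ t in (-L)..L, Real.exp t * √(x - phiF α (Real.exp t))) +
      (∫ t in (-L)..L, Real.exp t * (csqrt (phiF α (Real.exp t) - kerPole α x)).im) + π / (1 + α))
      atTop (𝓝 0) := by
    refine squeeze_zero_norm' ?_ h3
    filter_upwards [eventually_ge_atTop 0, h1.eventually (eventually_le_nhds zero_lt_one)]
      with L hL hδ
    exact abs_contour_integral_le hα hx hL hδ
  have h5 := h4.sub_const (π / (1 + α))
  rw [zero_sub] at h5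
  exact h5.congr fun L => add_sub_cancel_right _ _

lemma tendsto_intervalIntegral_exp {g : ℝ → ℝ} (hg : IntegrableOn g (Ioi 0)) :
    Tendsto (fun L : ℝ => ∫ t in (-L)..L, Real.exp t * g (Real.exp t)) atTop
      (𝓝 (∫ u in Ioi 0, g u)) := by
  have hd : ∀ t ∈ (univ : Set ℝ), HasDerivWithinAt Real.exp (Real.exp t) univ t := fun t _ =>
    (Real.hasDerivAt_exp t).hasDerivWithinAt
  have hi := integrableOn_image_iff_integrableOn_abs_deriv_smul MeasurableSet.univ hd
    Real.exp_injective.injOn g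
  have he := integral_image_eq_integral_abs_deriv_smul MeasurableSet.univ hd
    Real.exp_injective.injOn g
  simp only [image_univ, Real.range_exp, Real.abs_exp, smul_eq_mul, integrableOn_univ,
    setIntegral_univ] at hi he
  rw [he]
  exact intervalIntegral_tendsto_integral (hi.1 hg) tendsto_neg_atTop_atBot tendsto_id

/-- An antiderivative used to evaluate the Stieltjes transform of a square root. -/
def sqrtStieltjesPrim (q : ℂ) (s : ℝ) : ℂ :=
  Complex.I * q * (Complex.log (s - Complex.I * q) - Complex.log (s + Complex.I * q))

section SqrtStieltjes

variable {q : ℂ}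

lemma sub_I_mul_mem_slitPlane (hq : 0 < q.re) (s : ℝ) :
    (s : ℂ) - Complex.I * q ∈ Complex.slitPlane := by
  right
  simp [hq.ne']

lemma add_I_mul_mem_slitPlane (hq : 0 < q.re) (s : ℝ) :
    (s : ℂ) + Complex.I * q ∈ Complex.slitPlane := by
  right
  simp [hq.ne']

lemma hasDerivAt_sqrtStieltjesPrim (hq : 0 < q.re) (s : ℝ) :
    HasDerivAt (sqrtStieltjesPrim q) (-2 * q ^ 2 / (s ^ 2 + q ^ 2)) s := by
  have h1 : HasDerivAt (fun s : ℝ => (s : ℂ) - Complex.I * q) 1 s := by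
    simpa using (hasDerivAt_id s).ofReal_comp.sub_const (Complex.I * q)
  have h2 : HasDerivAt (fun s : ℝ => (s : ℂ) + Complex.I * q) 1 s := by
    simpa using (hasDerivAt_id s).ofReal_comp.add_const (Complex.I * q)
  have n1 := Complex.slitPlane_ne_zero (sub_I_mul_mem_slitPlane hq s)
  have n2 := Complex.slitPlane_ne_zero (add_I_mul_mem_slitPlane hq s)
  have h3 := ((h1.clog_real (sub_I_mul_mem_slitPlane hq s)).sub
    (h2.clog_real (add_I_mul_mem_slitPlane hq s))).const_mul (Complex.I * q)
  refine h3.congr_deriv ?_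
  have n3 : (s : ℂ) ^ 2 + q ^ 2 = (s - Complex.I * q) * (s + Complex.I * q) := by
    linear_combination q ^ 2 * Complex.I_sq
  rw [n3]
  field_simp
  linear_combination (2 * q ^ 2) * Complex.I_sq

lemma sqrtStieltjesPrim_zero (hq : 0 < q.re) : sqrtStieltjesPrim q 0 = π * q := by
  have hq0 : q ≠ 0 := fun h => by simp [h] at hq
  have harg : Complex.arg q ∈ Ioo (-(π / 2)) (π / 2) := by
    rw [mem_Ioo, ← abs_lt]
    exact Complex.abs_arg_lt_pi_div_two_iff.2 (Or.inl hq)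
  have l1 : Complex.log (Complex.I * q) = Complex.log Complex.I + Complex.log q := by
    refine Complex.log_mul Complex.I_ne_zero hq0 ⟨?_, ?_⟩ <;> rw [Complex.arg_I] <;>
      linarith [harg.1, harg.2]
  have l2 : Complex.log (-Complex.I * q) = Complex.log (-Complex.I) + Complex.log q := by
    refine Complex.log_mul (neg_ne_zero.2 Complex.I_ne_zero) hq0 ⟨?_, ?_⟩ <;>
      rw [Complex.arg_neg_I] <;> linarith [harg.1, harg.2]
  unfold sqrtStieltjesPrim
  rw [Complex.ofReal_zero, zero_sub, zero_add, ← neg_mul, l1, l2, Complex.log_I, Complex.log_neg_I]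
  linear_combination (-π * q) * Complex.I_sq

lemma tendsto_sqrtStieltjesPrim (q : ℂ) : Tendsto (sqrtStieltjesPrim q) atTop (𝓝 0) := by
  have hinv : Tendsto (fun s : ℝ => ((s⁻¹ : ℝ) : ℂ)) atTop (𝓝 0) := by
    have := (Complex.continuous_ofReal.tendsto 0).comp tendsto_inv_atTop_zero
    rwa [Complex.ofReal_zero] at this
  have hlog : ∀ c : ℂ, Tendsto (fun s : ℝ => Complex.log (1 + c * (s⁻¹ : ℝ))) atTop (𝓝 0) := by
    intro c
    have h1 : Tendsto (fun s : ℝ => 1 + c * ((s⁻¹ : ℝ) : ℂ)) atTop (𝓝 1) := by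
      simpa using (hinv.const_mul c).const_add 1
    have := ((continuousAt_clog Complex.one_mem_slitPlane).tendsto).comp h1
    rwa [Complex.log_one] at this
  have hne : ∀ c : ℂ, ∀ᶠ s : ℝ in atTop, 1 + c * ((s⁻¹ : ℝ) : ℂ) ≠ 0 := by
    intro c
    have h1 : Tendsto (fun s : ℝ => 1 + c * ((s⁻¹ : ℝ) : ℂ)) atTop (𝓝 1) := by
      simpa using (hinv.const_mul c).const_add 1
    exact h1.eventually_ne one_ne_zero
  have h := ((hlog (-(Complex.I * q))).sub (hlog (Complex.I * q))).const_mul (Complex.I * q)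
  rw [sub_zero, mul_zero] at h
  refine h.congr' ?_
  filter_upwards [eventually_gt_atTop 0, hne (-(Complex.I * q)), hne (Complex.I * q)]
    with s hs n1 n2
  have hs' : (s : ℂ) ≠ 0 := Complex.ofReal_ne_zero.2 hs.ne'
  have e1 : (s : ℂ) - Complex.I * q = s * (1 + -(Complex.I * q) * ((s⁻¹ : ℝ) : ℂ)) := by
    push_cast; field_simp; ring
  have e2 : (s : ℂ) + Complex.I * q = s * (1 + Complex.I * q * ((s⁻¹ : ℝ) : ℂ)) := by
    push_cast; field_simp
  unfold sqrtStieltjesPrim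
  rw [e1, e2, Complex.log_ofReal_mul hs n1, Complex.log_ofReal_mul hs n2]
  ring

end SqrtStieltjes

lemma kerPole_im_pos {α x : ℝ} (hα : 1 < α) (hx : 0 < x) : 0 < (kerPole α x).im := by
  unfold kerPole
  rw [Complex.im_ofReal_mul, Complex.exp_ofReal_mul_I_im]
  exact mul_pos hx (sin_kerAngle_pos hα)

lemma kerPole_im (α x : ℝ) : (kerPole α x).im = x * Real.sin (kerAngle α) := by
  unfold kerPole
  rw [Complex.im_ofReal_mul, Complex.exp_ofReal_mul_I_im]

lemma kerPole_re (α x : ℝ) : (kerPole α x).re = x * Real.cos (kerAngle α) := by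
  unfold kerPole
  rw [Complex.re_ofReal_mul, Complex.exp_ofReal_mul_I_re]

lemma Ka_div_div_eq {α x y : ℝ} (hα : 1 < α) (hy : 0 < y) :
    Ka α (x / y) / y = (1 / π) * (((y : ℂ) - kerPole α x)⁻¹).im := by
  have hn : Complex.normSq ((y : ℂ) - kerPole α x) = y ^ 2 * kerDen α (x / y) := by
    rw [Complex.normSq_apply, Complex.sub_re, Complex.sub_im, Complex.ofReal_re, Complex.ofReal_im,
      kerPole_re, kerPole_im, kerDen]
    field_simp
    linear_combination x ^ 2 * Real.sin_sq_add_cos_sq (kerAngle α)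
  have hd := kerDen_pos hα (x / y)
  rw [Complex.inv_im, hn, Ka_eq, Complex.sub_im, Complex.ofReal_im, kerPole_im]
  field_simp
  ring

lemma stieltjes_sqrt {α x a : ℝ} (hα : 1 < α) (hx : 0 < x) (ha : 0 < a) :
    IntegrableOn (fun y => √(y - a) * (Ka α (x / y) / y)) (Ioi a) ∧
    ∫ y in Ioi a, √(y - a) * (Ka α (x / y) / y) = -(csqrt (a - kerPole α x)).im := by
  set q := csqrt (a - kerPole α x) with hqdef
  have hsl : (a : ℂ) - kerPole α x ∈ Complex.slitPlane := by
    right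
    rw [Complex.sub_im, Complex.ofReal_im, zero_sub]
    exact (neg_neg_of_pos (kerPole_im_pos hα hx)).ne
  have hq : 0 < q.re := csqrt_re_pos hsl
  set g : ℝ → ℝ := fun y => (1 / π) * (sqrtStieltjesPrim q √(y - a)).im with hg
  have hcont : Continuous (sqrtStieltjesPrim q) :=
    continuous_iff_continuousAt.2 fun s => (hasDerivAt_sqrtStieltjesPrim hq s).continuousAt
  have hgc : Continuous g := by
    have h1 : Continuous fun y : ℝ => √(y - a) := (continuous_id.sub continuous_const).sqrt
    exact continuous_const.mul (Complex.continuous_im.comp (hcont.comp h1))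
  have hder : ∀ y ∈ Ioi a, HasDerivAt g (√(y - a) * (Ka α (x / y) / y)) y := fun y hy => by
    have hya : 0 < y - a := sub_pos.2 hy
    have hy0 : 0 < y := ha.trans hy
    have hs := Real.sqrt_pos.2 hya
    have h1 : HasDerivAt (fun y : ℝ => √(y - a)) (1 / (2 * √(y - a))) y :=
      ((hasDerivAt_id y).sub_const a).sqrt hya.ne'
    have h2 := (hasDerivAt_sqrtStieltjesPrim hq √(y - a)).scomp y h1
    have h3 : HasDerivAt g ((1 / π) * ((1 / (2 * √(y - a))) •
        (-2 * q ^ 2 / ((√(y - a) : ℝ) ^ 2 + q ^ 2))).im) y :=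
      (Complex.imCLM.hasFDerivAt.comp_hasDerivAt y h2).const_mul (1 / π)
    refine h3.congr_deriv ?_
    have hw : ((√(y - a) : ℝ) : ℂ) ^ 2 + q ^ 2 = y - kerPole α x := by
      rw [hqdef, csqrt_sq, ← Complex.ofReal_pow, Real.sq_sqrt hya.le]; push_cast; ring
    have hw0 : (y : ℂ) - kerPole α x ≠ 0 := fun h => by
      have := congrArg Complex.im h
      rw [Complex.sub_im, Complex.ofReal_im, Complex.zero_im] at this
      linarith [kerPole_im_pos hα hx]
    have hq2 : -2 * q ^ 2 / (y - kerPole α x) = ((-2 : ℝ) : ℂ) +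
        ((2 * √(y - a) ^ 2 : ℝ) : ℂ) * ((y : ℂ) - kerPole α x)⁻¹ := by
      push_cast
      rw [eq_sub_of_add_eq' hw]
      field_simp
      ring
    rw [hw, hq2, Complex.real_smul, Complex.im_ofReal_mul, Complex.add_im, Complex.ofReal_im,
      Complex.im_ofReal_mul, Ka_div_div_eq hα hy0]
    field_simp
    ring
  have hpos : ∀ y ∈ Ioi a, 0 ≤ √(y - a) * (Ka α (x / y) / y) := fun y hy => by
    have hy0 : 0 < y := ha.trans hy
    have := Ka_pos hα (div_pos hx hy0)
    positivity
  have hlim : Tendsto g atTop (𝓝 0) := by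
    have h1 : Tendsto (fun y : ℝ => √(y - a)) atTop atTop :=
      Real.tendsto_sqrt_atTop.comp (tendsto_atTop_add_const_right _ (-a) tendsto_id)
    have h2 := (Complex.continuous_im.tendsto 0).comp ((tendsto_sqrtStieltjesPrim q).comp h1)
    have h3 := h2.const_mul (1 / π)
    rwa [Complex.zero_im, mul_zero] at h3
  refine ⟨integrableOn_Ioi_deriv_of_nonneg hgc.continuousWithinAt hder hpos hlim, ?_⟩
  rw [integral_Ioi_of_hasDerivAt_of_nonneg hgc.continuousWithinAt hder hpos hlim, hg]
  simp only [sub_self, Real.sqrt_zero]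
  rw [sqrtStieltjesPrim_zero hq, Complex.im_ofReal_mul]
  field_simp
  ring

lemma integral_Ioi_zero_stieltjes_sqrt {α x a : ℝ} (hα : 1 < α) (hx : 0 < x) (ha : 0 < a) :
    ∫ y in Ioi 0, √(y - a) * (Ka α (x / y) / y) = -(csqrt (a - kerPole α x)).im := by
  rw [← (stieltjes_sqrt hα hx ha).2]
  refine setIntegral_eq_of_subset_of_forall_sdiff_eq_zero (s := Ioi a) measurableSet_Ioi
    (Ioi_subset_Ioi ha.le) fun y hy => ?_
  rw [Real.sqrt_eq_zero_of_nonpos (sub_nonpos.2 (not_lt.1 hy.2)), zero_mul]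

lemma integrableOn_weight_Sfun {α : ℝ} (hα : 1 < α) :
    IntegrableOn (fun y => Sfun α y / (1 + y ^ 2)) (Ioi 0) := by
  have hm := (monotone_Sfun hα).measurable
  have h1 : IntegrableOn (fun y => Sfun α y / (1 + y ^ 2)) (Ici 1) := by
    refine integrableOn_weight_of_growth hα (C := 1 / π) hm.aestronglyMeasurable fun y hy => ?_
    rw [abs_of_nonneg (Sfun_nonneg hα y)]
    exact Sfun_le hα (zero_lt_one.trans_le hy)
  have h2 : IntegrableOn (fun y => Sfun α y / (1 + y ^ 2)) (Ioo 0 1) := by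
    refine Measure.integrableOn_of_bounded (M := Sfun α 1) (by simp)
      (by fun_prop : Measurable fun y : ℝ => Sfun α y / (1 + y ^ 2)).aestronglyMeasurable ?_
    refine (ae_restrict_mem measurableSet_Ioo).mono fun y hy => ?_
    rw [Real.norm_of_nonneg (div_nonneg (Sfun_nonneg hα y) (by positivity))]
    refine (div_le_self (Sfun_nonneg hα y) (by nlinarith [sq_nonneg y])).trans ?_
    exact monotone_Sfun hα hy.2.le
  rw [← Ioo_union_Ici_eq_Ioi zero_lt_one]
  exact h2.union h1

lemma integrableOn_convD_Sfun {α x : ℝ} (hα : 1 < α) (hx : 0 < x) :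
    IntegrableOn (fun y => Ka α (x / y) * Sfun α y / y) (Ioi 0) :=
  integrableOn_convD hα 0 measurableSet_Ioi subset_rfl (integrableOn_weight_Sfun hα) hx

lemma integrable_stieltjes_prod {α x : ℝ} (hα : 1 < α) (hx : 0 < x) :
    Integrable (Function.uncurry fun u y => √(y - phiF α u) * (Ka α (x / y) / y))
      ((volume.restrict (Ioi 0)).prod (volume.restrict (Ioi 0))) := by
  have hKm : Measurable (Ka α) := (continuous_Ka hα).measurable
  have hφm := measurable_phiF α
  refine (integrable_prod_iff' ?_).2 ⟨?_, ?_⟩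
  · refine Measurable.aestronglyMeasurable ?_
    unfold Function.uncurry
    refine Measurable.mul ?_ ?_
    · exact (measurable_snd.sub (hφm.comp measurable_fst)).sqrt
    · exact (hKm.comp (measurable_const.div measurable_snd)).div measurable_snd
  · exact Eventually.of_forall fun y => (integrableOn_sqrt_sub_phiF hα y).mul_const (Ka α (x / y) / y)
  · have h := (integrableOn_convD_Sfun hα hx).const_mul π
    refine h.congr ?_
    refine (ae_restrict_mem measurableSet_Ioi).mono fun y hy => ?_
    have hK := Ka_pos hα (div_pos hx hy)
    have hy' : (0 : ℝ) < y := hy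
    have : ∀ u, ‖√(y - phiF α u) * (Ka α (x / y) / y)‖ = √(y - phiF α u) * (Ka α (x / y) / y) :=
      fun u => Real.norm_of_nonneg (by positivity)
    simp only [Function.uncurry_apply_pair, this]
    rw [integral_mul_const, Sfun_eq hα]
    field_simp

lemma integral_im_csqrt {α x : ℝ} (hα : 1 < α) (hx : 0 < x) :
    IntegrableOn (fun u => (csqrt (phiF α u - kerPole α x)).im) (Ioi 0) ∧
    ∫ u in Ioi 0, (csqrt (phiF α u - kerPole α x)).im = -(π * convD α 0 (Ioi 0) (Sfun α) x) := by
  have hI := integrable_stieltjes_prod hα hx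
  have hl := hI.integral_prod_left
  have hsw := integral_integral_swap hI
  have e : ∀ u ∈ Ioi (0:ℝ), ∫ y in Ioi 0, √(y - phiF α u) * (Ka α (x / y) / y) =
      -(csqrt (phiF α u - kerPole α x)).im := fun u hu =>
    integral_Ioi_zero_stieltjes_sqrt hα hx (phiF_pos hu)
  constructor
  · refine hl.neg.congr ((ae_restrict_mem measurableSet_Ioi).mono fun u hu => ?_)
    simp only [Function.uncurry_apply_pair, Pi.neg_apply]
    rw [e u hu, neg_neg]
  · rw [setIntegral_congr_fun measurableSet_Ioi e, integral_neg] at hsw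
    rw [neg_eq_iff_eq_neg] at hsw
    rw [hsw, convD, ← integral_const_mul]
    congr 1
    refine setIntegral_congr_fun measurableSet_Ioi fun y hy => ?_
    have hy' : (0 : ℝ) < y := hy
    simp only [kerD_zero]
    rw [integral_mul_const, Sfun_eq hα]
    field_simp

lemma convD_Sfun {α x : ℝ} (hα : 1 < α) (hx : rhoC α ≤ x) :
    convD α 0 (Ioi 0) (Sfun α) x = Sfun α x + 1 / (1 + α) := by
  have hx0 := (rhoC_pos hα).trans_le hx
  obtain ⟨hi, he⟩ := integral_im_csqrt hα hx0
  have h1 := (tendsto_intervalIntegral_exp (integrableOn_sqrt_sub_phiF hα x)).add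
    (tendsto_intervalIntegral_exp hi)
  have h2 := tendsto_nhds_unique h1 (tendsto_contour_integral hα hx)
  have hα1 : 1 + α ≠ 0 := by linarith
  rw [he] at h2
  have h3 : convD α 0 (Ioi 0) (Sfun α) x =
      (1 / π) * ((∫ u in Ioi 0, √(x - phiF α u)) + π / (1 + α)) := by
    field_simp at h2 ⊢
    linarith
  rw [h3, Sfun_eq hα]
  field_simp

lemma convD_zero_Ioi_scale {α x : ℝ} (hx : 0 < x) (f : ℝ → ℝ) :
    convD α 0 (Ioi 0) f x = ∫ s in Ioi 0, Ka α (1 / s) * f (x * s) / s := by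
  have h := integral_comp_mul_left_Ioi (fun y => Ka α (x / y) * f y / y) 0 hx
  rw [mul_zero, smul_eq_mul] at h
  rw [convD]
  simp only [kerD_zero]
  rw [eq_inv_mul_iff_mul_eq₀ hx.ne'] at h
  rw [← h, ← integral_const_mul]
  refine setIntegral_congr_fun measurableSet_Ioi fun s hs => ?_
  have hs' : (0 : ℝ) < s := hs
  have e : x / (x * s) = 1 / s := by field_simp
  simp only [e]
  field_simp

lemma integrableOn_weight_rpow_Ioi {α : ℝ} (hα : 1 < α) :
    IntegrableOn (fun y : ℝ => y ^ growthExp α / (1 + y ^ 2)) (Ioi 0) := by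
  rw [← Ioo_union_Ici_eq_Ioi zero_lt_one]
  refine (integrableOn_weight_rpow_Ioo hα).union (integrableOn_weight_of_growth hα (C := 1)
    (by fun_prop : Measurable fun y : ℝ => y ^ growthExp α).aestronglyMeasurable fun y hy => ?_)
  rw [abs_of_nonneg (Real.rpow_nonneg (zero_le_one.trans hy) _), one_mul]

lemma convD_Ioi_rpow_one {α : ℝ} (hα : 1 < α) :
    ∫ s in Ioi 0, Ka α (1 / s) * s ^ growthExp α / s = 1 := by
  set β := growthExp α with hβ
  have hker : IntegrableOn (fun s => Ka α (1 / s) * s ^ β / s) (Ioi 0) :=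
    integrableOn_convD hα 0 measurableSet_Ioi subset_rfl (integrableOn_weight_rpow_Ioi hα) one_pos
  have hS := tendsto_rpow_neg_mul_Sfun hα
  have hSm : Measurable (Sfun α) := (monotone_Sfun hα).measurable
  have hKm : Measurable (Ka α) := (continuous_Ka hα).measurable
  have h1 : Tendsto (fun x : ℝ => ∫ s in Ioi 0, Ka α (1 / s) * (x ^ (-β) * Sfun α (x * s)) / s)
      atTop (𝓝 (∫ s in Ioi 0, Ka α (1 / s) * (s ^ β * coefS α) / s)) := by
    refine tendsto_integral_filter_of_dominated_convergence
      (fun s => (1 / π) * (Ka α (1 / s) * s ^ β / s)) ?_ ?_ (hker.const_mul _) ?_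
    · refine Eventually.of_forall fun x => Measurable.aestronglyMeasurable ?_
      exact ((hKm.comp (measurable_const.div measurable_id)).mul
        (measurable_const.mul (hSm.comp (measurable_const.mul measurable_id)))).div measurable_id
    · filter_upwards [eventually_gt_atTop 0] with x hx
      refine (ae_restrict_mem measurableSet_Ioi).mono fun s hs => ?_
      have hs' : (0 : ℝ) < s := hs
      have hK := Ka_pos hα (div_pos one_pos hs')
      have h0 := Sfun_nonneg hα (x * s)
      have hb := Sfun_le hα (mul_pos hx hs')
      rw [Real.norm_of_nonneg (by positivity)]
      have : x ^ (-β) * Sfun α (x * s) ≤ (1 / π) * s ^ β := by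
        rw [Real.mul_rpow hx.le hs'.le] at hb
        calc x ^ (-β) * Sfun α (x * s) ≤ x ^ (-β) * ((1 / π) * (x ^ β * s ^ β)) := by gcongr
          _ = (x ^ (-β) * x ^ β) * ((1 / π) * s ^ β) := by ring
          _ = _ := by rw [← Real.rpow_add hx, neg_add_cancel, Real.rpow_zero, one_mul]
      calc Ka α (1 / s) * (x ^ (-β) * Sfun α (x * s)) / s
          ≤ Ka α (1 / s) * ((1 / π) * s ^ β) / s := by gcongr
        _ = _ := by ring
    · refine (ae_restrict_mem measurableSet_Ioi).mono fun s hs => ?_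
      have hs' : (0 : ℝ) < s := hs
      have h2 := (hS.comp (tendsto_id.atTop_mul_const hs')).const_mul (s ^ β)
      refine ((h2.congr' ?_).const_mul (Ka α (1 / s))).div_const s
      filter_upwards [eventually_gt_atTop 0] with x hx
      simp only [Function.comp, id]
      rw [Real.mul_rpow hx.le hs'.le, ← hβ,
        show s ^ β * (x ^ (-β) * s ^ (-β) * Sfun α (x * s)) =
          (s ^ β * s ^ (-β)) * (x ^ (-β) * Sfun α (x * s)) by ring,
        ← Real.rpow_add hs', add_neg_cancel, Real.rpow_zero, one_mul]
  have h2 : Tendsto (fun x : ℝ => ∫ s in Ioi 0, Ka α (1 / s) * (x ^ (-β) * Sfun α (x * s)) / s)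
      atTop (𝓝 (coefS α)) := by
    have h3 : Tendsto (fun x : ℝ => x ^ (-β) * (1 / (1 + α))) atTop (𝓝 0) := by
      have := (tendsto_rpow_neg_atTop (growthExp_pos hα)).mul_const (1 / (1 + α))
      rwa [zero_mul] at this
    have h4 := hS.add h3
    rw [add_zero] at h4
    refine h4.congr' ?_
    filter_upwards [eventually_gt_atTop 0, eventually_ge_atTop (rhoC α)] with x hx hρ
    rw [← mul_add, ← convD_Sfun hα hρ, convD_zero_Ioi_scale hx, ← integral_const_mul]
    refine integral_congr_ae (Eventually.of_forall fun s => ?_)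
    beta_reduce
    ring
  have h5 := tendsto_nhds_unique h1 h2
  have h6 : ∫ s in Ioi 0, Ka α (1 / s) * (s ^ β * coefS α) / s =
      coefS α * ∫ s in Ioi 0, Ka α (1 / s) * s ^ β / s := by
    rw [← integral_const_mul]
    refine integral_congr_ae (Eventually.of_forall fun s => ?_)
    beta_reduce
    ring
  rw [h6] at h5
  exact mul_left_cancel₀ (coefS_pos hα).ne' (h5.trans (mul_one _).symm)

lemma convD_Ioi_rpow_growthExp {α x : ℝ} (hα : 1 < α) (hx : 0 < x) :
    convD α 0 (Ioi 0) (fun y => y ^ growthExp α) x = x ^ growthExp α := by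
  rw [convD_zero_Ioi_scale hx]
  conv_rhs => rw [← mul_one (x ^ growthExp α), ← convD_Ioi_rpow_one hα, ← integral_const_mul]
  refine setIntegral_congr_fun measurableSet_Ioi fun s hs => ?_
  have hs' : (0 : ℝ) < s := hs
  rw [Real.mul_rpow hx.le hs'.le]
  ring

lemma convD_rpow_growthExp {α x : ℝ} (hα : 1 < α) (hx : 0 < x) :
    convD α 0 (Ici 1) (fun y => y ^ growthExp α) x =
      x ^ growthExp α - convD α 0 (Ioo 0 1) (fun y => y ^ growthExp α) x := by
  have hi := integrableOn_convD hα 0 measurableSet_Ioi subset_rfl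
    (integrableOn_weight_rpow_Ioi hα) hx
  rw [eq_sub_iff_add_eq', ← convD_Ioi_rpow_growthExp hα hx, convD, convD, convD,
    ← Ioo_union_Ici_eq_Ioi (zero_lt_one (α := ℝ))]
  rw [← Ioo_union_Ici_eq_Ioi (zero_lt_one (α := ℝ))] at hi
  exact (setIntegral_union (disjoint_left.2 fun y h1 h2 => not_le.2 h1.2 h2) measurableSet_Ici
    hi.left_of_union hi.right_of_union).symm

/-! ### Boundedness of subdominant solutions -/

lemma convD_add {α : ℝ} (hα : 1 < α) (n : ℕ) {J : Set ℝ} (hJ : MeasurableSet J)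
    (hJ0 : J ⊆ Ioi 0) {f g : ℝ → ℝ} (hf : IntegrableOn (fun y => f y / (1 + y ^ 2)) J)
    (hg : IntegrableOn (fun y => g y / (1 + y ^ 2)) J) {x : ℝ} (hx : 0 < x) :
    convD α n J (fun y => f y + g y) x = convD α n J f x + convD α n J g x := by
  unfold convD
  rw [← integral_add (integrableOn_convD hα n hJ hJ0 hf hx) (integrableOn_convD hα n hJ hJ0 hg hx)]
  congr 1
  ext y
  ring

lemma convD_const_mul (α : ℝ) (n : ℕ) (J : Set ℝ) (c : ℝ) (f : ℝ → ℝ) (x : ℝ) :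
    convD α n J (fun y => c * f y) x = c * convD α n J f x := by
  unfold convD
  rw [← integral_const_mul]
  congr 1
  ext y
  ring

lemma convD_congr (α : ℝ) (n : ℕ) {J : Set ℝ} (hJ : MeasurableSet J) {f g : ℝ → ℝ}
    (h : ∀ y ∈ J, f y = g y) (x : ℝ) : convD α n J f x = convD α n J g x :=
  setIntegral_congr_fun hJ fun y hy => by simp only [h y hy]

lemma convD_zero_const {α : ℝ} (hα : 1 < α) (c : ℝ) {x : ℝ} (hx : 0 < x) :
    convD α 0 (Ici 1) (fun _ => c) x = c * Fa α x := by
  unfold convD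
  rw [← integral_Ka_div hα hx, ← integral_const_mul, integral_Ici_eq_integral_Ioi]
  congr 1
  ext y
  simp only [kerD_zero]
  ring

lemma convD_zero_mono {α : ℝ} (hα : 1 < α) {J : Set ℝ} (hJ : MeasurableSet J)
    (hJ0 : J ⊆ Ioi 0) {f g : ℝ → ℝ} (hf : IntegrableOn (fun y => f y / (1 + y ^ 2)) J)
    (hg : IntegrableOn (fun y => g y / (1 + y ^ 2)) J) (h : ∀ y ∈ J, f y ≤ g y)
    {x : ℝ} (hx : 0 < x) : convD α 0 J f x ≤ convD α 0 J g x := by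
  refine setIntegral_mono_on (integrableOn_convD hα 0 hJ hJ0 hf hx)
    (integrableOn_convD hα 0 hJ hJ0 hg hx) hJ fun y hy => ?_
  have hy0 : 0 < y := hJ0 hy
  have h1 := h y hy
  have h2 := (Ka_pos hα (div_pos hx hy0)).le
  simp only [kerD_zero]
  gcongr

lemma abs_convD_zero_le (α : ℝ) (hα : 1 < α) {J : Set ℝ} (hJ : MeasurableSet J)
    (hJ0 : J ⊆ Ioi 0) (f : ℝ → ℝ) {x : ℝ} (hx : 0 < x) :
    |convD α 0 J f x| ≤ convD α 0 J (fun y => |f y|) x := by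
  unfold convD
  rw [← Real.norm_eq_abs]
  refine (norm_integral_le_integral_norm _).trans (le_of_eq ?_)
  refine setIntegral_congr_fun hJ fun y hy => ?_
  have hy0 : 0 < y := hJ0 hy
  simp only [kerD_zero, Real.norm_eq_abs, abs_div, abs_mul, abs_of_pos hy0,
    abs_of_pos (Ka_pos hα (div_pos hx hy0))]

lemma convD_Ioo_rpow_pos {α : ℝ} (hα : 1 < α) {x : ℝ} (hx : 0 < x) :
    0 < convD α 0 (Ioo 0 1) (fun y => y ^ growthExp α) x := by
  have hpos : ∀ y ∈ Ioo (0:ℝ) 1, 0 < kerD α 0 (x / y) * y ^ growthExp α / y := fun y hy =>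
    div_pos (mul_pos (Ka_pos hα (div_pos hx hy.1)) (Real.rpow_pos_of_pos hy.1 _)) hy.1
  unfold convD
  rw [setIntegral_pos_iff_support_of_nonneg_ae
    ((ae_restrict_iff' measurableSet_Ioo).2 <| ae_of_all _ fun y hy => (hpos y hy).le)
    (integrableOn_convD hα 0 measurableSet_Ioo (fun y hy => hy.1)
      (integrableOn_weight_rpow_Ioo hα) hx)]
  have : Ioo (0:ℝ) 1 ⊆ (Function.support fun y => kerD α 0 (x / y) * y ^ growthExp α / y) ∩
      Ioo 0 1 := fun y hy => ⟨(hpos y hy).ne', hy⟩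
  exact lt_of_lt_of_le (by simp) (measure_mono this)

lemma convD_rpow_lt {α : ℝ} (hα : 1 < α) {x : ℝ} (hx : 0 < x) :
    convD α 0 (Ici 1) (fun y => y ^ growthExp α) x < x ^ growthExp α := by
  rw [convD_rpow_growthExp hα hx]
  linarith [convD_Ioo_rpow_pos hα hx]

lemma exists_growth_bound {β ℓ : ℝ} {f : ℝ → ℝ} (hc : ContinuousOn f (Ici 1))
    (ho : Tendsto (fun x => x ^ (-β) * f x) atTop (𝓝 ℓ)) :
    ∃ C, ∀ y, 1 ≤ y → |f y| ≤ C * y ^ β := by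
  have hcg : ContinuousOn (fun x : ℝ => x ^ (-β) * f x) (Ici 1) :=
    (continuousOn_id.rpow_const fun x hx => Or.inl
      (ne_of_gt (Ici_one_subset_Ioi_zero hx))).mul hc
  obtain ⟨X, hX⟩ := eventually_atTop.1 (ho.abs.eventually_le_const (lt_add_one |ℓ|))
  obtain ⟨C, hC⟩ := (isCompact_Icc (a := 1) (b := X)).exists_bound_of_continuousOn
    (hcg.mono Icc_subset_Ici_self)
  refine ⟨max C (|ℓ| + 1), fun y hy => ?_⟩
  have hy0 : 0 < y := lt_of_lt_of_le one_pos hy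
  have h1 : |y ^ (-β) * f y| ≤ max C (|ℓ| + 1) := by
    rcases le_total y X with h | h
    · exact (hC y ⟨hy, h⟩).trans (le_max_left _ _)
    · exact (hX y h).trans (le_max_right _ _)
  have hp : 0 < y ^ β := Real.rpow_pos_of_pos hy0 _
  rw [abs_mul, Real.rpow_neg hy0.le, abs_inv, abs_of_pos hp, inv_mul_le_iff₀ hp] at h1
  linarith

lemma integrableOn_weight_const (c : ℝ) :
    IntegrableOn (fun y : ℝ => c / (1 + y ^ 2)) (Ici 1) := by
  have := (integrable_inv_one_add_sq.const_mul c).integrableOn (s := Ici 1)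
  simpa [div_eq_mul_inv] using this

lemma integrableOn_weight_rpow {α : ℝ} (hα : 1 < α) :
    IntegrableOn (fun y : ℝ => y ^ growthExp α / (1 + y ^ 2)) (Ici 1) :=
  integrableOn_weight_of_growth hα (C := 1)
    (by fun_prop : Measurable fun y : ℝ => y ^ growthExp α).aestronglyMeasurable
    fun y hy => by
      rw [one_mul, abs_of_nonneg (Real.rpow_nonneg (zero_le_one.trans hy) _)]

lemma integrableOn_weight_of_bounded {r : ℝ → ℝ} {R : ℝ}
    (hr : AEStronglyMeasurable r (volume.restrict (Ici 1))) (hR : ∀ y, 1 ≤ y → |r y| ≤ R) :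
    IntegrableOn (fun y => r y / (1 + y ^ 2)) (Ici 1) := by
  refine Integrable.mono' (integrableOn_weight_const R)
    (hr.mul ((by fun_prop : Measurable fun y : ℝ => (1 + y ^ 2)⁻¹).aestronglyMeasurable))
    ((ae_restrict_iff' measurableSet_Ici).2 <| ae_of_all _ fun y hy => ?_)
  have hp : 0 < 1 + y ^ 2 := by positivity
  rw [Real.norm_eq_abs, abs_div, abs_of_pos hp]
  gcongr
  exact hR y hy

lemma integrableOn_weight_of_tendsto {α ℓ : ℝ} (hα : 1 < α) {f : ℝ → ℝ}
    (hc : ContinuousOn f (Ici 1))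
    (ho : Tendsto (fun x => x ^ (-growthExp α) * f x) atTop (𝓝 ℓ)) :
    IntegrableOn (fun y => f y / (1 + y ^ 2)) (Ici 1) := by
  obtain ⟨C, hC⟩ := exists_growth_bound hc ho
  exact integrableOn_weight_of_growth hα (hc.aestronglyMeasurable measurableSet_Ici) hC

lemma abs_le_of_subsolution {α : ℝ} (hα : 1 < α) {f : ℝ → ℝ} (hc : ContinuousOn f (Ici 1))
    (ho : Tendsto (fun x => x ^ (-growthExp α) * f x) atTop (𝓝 0)) {G : ℝ} (hG : 0 ≤ G)
    (h : ∀ x, 1 ≤ x → |f x| ≤ convD α 0 (Ici 1) (fun y => |f y|) x + G) {x : ℝ} (hx : 1 ≤ x) :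
    |f x| ≤ G / (1 - kerMass α) := by
  have hm : 0 < 1 - kerMass α := by linarith [kerMass_lt_one hα]
  set c := G / (1 - kerMass α) with hcdef
  have hcG : c * kerMass α + G = c := by
    rw [hcdef]; field_simp; ring
  have hc0 : 0 ≤ c := by positivity
  have hβ := growthExp_pos hα
  set β := growthExp α with hβdef
  by_contra! hlt
  set g : ℝ → ℝ := fun y => y ^ (-β) * (|f y| - c) with hg
  have hgc : ContinuousOn g (Ici 1) :=
    (continuousOn_id.rpow_const fun x hx => Or.inl
      (ne_of_gt (Ici_one_subset_Ioi_zero hx))).mul (hc.abs.sub continuousOn_const)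
  have hgt : Tendsto g atTop (𝓝 0) := by
    have h1 := ho.abs
    have h2 : Tendsto (fun x : ℝ => x ^ (-β) * c) atTop (𝓝 0) := by
      simpa using (tendsto_rpow_neg_atTop hβ).mul_const c
    have h3 := h1.sub h2
    rw [abs_zero, sub_zero] at h3
    refine h3.congr' ?_
    filter_upwards [eventually_gt_atTop 0] with y hy
    rw [abs_mul, abs_of_pos (Real.rpow_pos_of_pos hy _), hg]
    ring
  have hx0 : 0 < x := lt_of_lt_of_le one_pos hx
  have hgx : 0 < g x := mul_pos (Real.rpow_pos_of_pos hx0 _) (by linarith)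
  obtain ⟨X, hX⟩ := eventually_atTop.1 (hgt.eventually_lt_const hgx)
  obtain ⟨x₀, hx₀, hmax⟩ := (isCompact_Icc (a := 1) (b := max X x)).exists_isMaxOn
    ⟨x, hx, le_max_right _ _⟩ (hgc.mono Icc_subset_Ici_self)
  have hx₀1 : 1 ≤ x₀ := hx₀.1
  have hx₀0 : 0 < x₀ := lt_of_lt_of_le one_pos hx₀1
  have hM : 0 < g x₀ := hgx.trans_le (hmax ⟨hx, le_max_right _ _⟩)
  have hle : ∀ y, 1 ≤ y → g y ≤ g x₀ := by
    intro y hy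
    rcases le_total y (max X x) with h | h
    · exact hmax ⟨hy, h⟩
    · exact (hX y ((le_max_left _ _).trans h)).le.trans (hmax ⟨hx, le_max_right _ _⟩)
  have hrec : ∀ y, 1 ≤ y → |f y| = g y * y ^ β + c := by
    intro y hy
    have hy0 : 0 < y := lt_of_lt_of_le one_pos hy
    have hp := (Real.rpow_pos_of_pos hy0 β).ne'
    rw [hg]
    simp only [Real.rpow_neg hy0.le]
    field_simp
    ring
  have hfle : ∀ y, 1 ≤ y → |f y| ≤ g x₀ * y ^ β + c := by
    intro y hy
    rw [hrec y hy]
    have := Real.rpow_nonneg (zero_le_one.trans hy) β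
    have := hle y hy
    gcongr
  have hif : IntegrableOn (fun y => |f y| / (1 + y ^ 2)) (Ici 1) := by
    refine (integrableOn_weight_of_tendsto hα hc ho).abs.congr (ae_of_all _ fun y => ?_)
    simp only [abs_div, abs_of_pos (by positivity : 0 < 1 + y ^ 2)]
  have hi1 : IntegrableOn (fun y : ℝ => g x₀ * y ^ β / (1 + y ^ 2)) (Ici 1) := by
    simp only [mul_div_assoc]
    exact (integrableOn_weight_rpow hα).const_mul (g x₀)
  have hi2 : IntegrableOn (fun y : ℝ => (g x₀ * y ^ β + c) / (1 + y ^ 2)) (Ici 1) := by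
    simp only [add_div]
    exact hi1.add (integrableOn_weight_const c)
  have h1 := convD_zero_mono hα measurableSet_Ici Ici_one_subset_Ioi_zero hif hi2 hfle hx₀0
  rw [convD_add hα 0 measurableSet_Ici Ici_one_subset_Ioi_zero hi1 (integrableOn_weight_const c)
    hx₀0, convD_const_mul, convD_zero_const hα c hx₀0] at h1
  have h2 := mul_lt_mul_of_pos_left (convD_rpow_lt hα hx₀0) hM
  have h3 := mul_le_mul_of_nonneg_left (Fa_le_kerMass hα x₀) hc0
  have h4 := h x₀ hx₀1
  rw [hrec x₀ hx₀1] at h4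
  linarith

lemma abs_le_of_equation {α : ℝ} (hα : 1 < α) {f r e : ℝ → ℝ} (hc : ContinuousOn f (Ici 1))
    (ho : Tendsto (fun x => x ^ (-growthExp α) * f x) atTop (𝓝 0)) {R E : ℝ}
    (hr : AEStronglyMeasurable r (volume.restrict (Ici 1))) (hR : ∀ y, 1 ≤ y → |r y| ≤ R)
    (hE : ∀ x, 1 ≤ x → |e x| ≤ E)
    (h : ∀ x, 1 ≤ x → f x = convD α 0 (Ici 1) (fun y => f y + r y) x + e x) {x : ℝ} (hx : 1 ≤ x) :
    |f x| ≤ (R * kerMass α + E) / (1 - kerMass α) := by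
  have hR0 : 0 ≤ R := (abs_nonneg _).trans (hR 1 le_rfl)
  have hE0 : 0 ≤ E := (abs_nonneg _).trans (hE 1 le_rfl)
  have hm := kerMass_pos hα
  refine abs_le_of_subsolution hα hc ho (by positivity) (fun y hy => ?_) hx
  have hy0 : 0 < y := lt_of_lt_of_le one_pos hy
  have hif := integrableOn_weight_of_tendsto hα hc ho
  have hia : IntegrableOn (fun y => |f y| / (1 + y ^ 2)) (Ici 1) := by
    refine hif.abs.congr (ae_of_all _ fun y => ?_)
    simp only [abs_div, abs_of_pos (by positivity : 0 < 1 + y ^ 2)]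
  have hir := integrableOn_weight_of_bounded hr hR
  have hJ := measurableSet_Ici (a := (1:ℝ))
  have hJ0 := Ici_one_subset_Ioi_zero
  rw [h y hy, convD_add hα 0 hJ hJ0 hif hir hy0]
  have h1 := abs_convD_zero_le α hα hJ hJ0 f hy0
  have h2 := abs_convD_zero_le α hα hJ hJ0 r hy0
  have hiar : IntegrableOn (fun y => |r y| / (1 + y ^ 2)) (Ici 1) := by
    refine hir.abs.congr (ae_of_all _ fun y => ?_)
    simp only [abs_div, abs_of_pos (by positivity : 0 < 1 + y ^ 2)]
  have h3 := convD_zero_mono hα hJ hJ0 hiar (integrableOn_weight_const R) (fun y hy => hR y hy) hy0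
  rw [convD_zero_const hα R hy0] at h3
  have h4 := mul_le_mul_of_nonneg_left (Fa_le_kerMass hα y) hR0
  have h5 := abs_add_three (convD α 0 (Ici 1) f y) (convD α 0 (Ici 1) r y) (e y)
  have h6 := hE y hy
  linarith

lemma iterate_eulerDW_eq {a : ℝ} (ha : 0 < a) {F : ℕ → ℝ → ℝ}
    (hF : ∀ n x, a ≤ x → HasDerivWithinAt (F n) (F (n + 1) x / x) (Ici a) x) {f : ℝ → ℝ}
    (h0 : ∀ x, a ≤ x → f x = F 0 x) (n : ℕ) {x : ℝ} (hx : a ≤ x) :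
    (eulerDW (Ici a))^[n] f x = F n x := by
  induction n generalizing x with
  | zero => exact h0 x hx
  | succ n ih =>
    rw [Function.iterate_succ_apply']
    have hcongr : EqOn ((eulerDW (Ici a))^[n] f) (F n) (Ici a) := fun y hy => ih hy
    rw [eulerDW, derivWithin_congr hcongr (ih hx),
      (hF n x hx).derivWithin (uniqueDiffOn_Ici a x hx), mul_div_cancel₀ _ (ha.trans_le hx).ne']

lemma convD_scale (α : ℝ) (n : ℕ) {c : ℝ} (hc : 0 < c) (f : ℝ → ℝ) (x : ℝ) :
    convD α n (Ici c) f (c * x) = convD α n (Ici 1) (fun t => f (c * t)) x := by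
  have h := integral_comp_mul_left_Ioi (fun y => kerD α n (c * x / y) * f y / y) 1 hc
  rw [mul_one, smul_eq_mul, eq_inv_mul_iff_mul_eq₀ hc.ne'] at h
  rw [convD, convD, integral_Ici_eq_integral_Ioi, integral_Ici_eq_integral_Ioi, ← h,
    ← integral_const_mul]
  refine setIntegral_congr_fun measurableSet_Ioi fun s _ => ?_
  simp only [mul_div_mul_left _ _ hc.ne']
  field_simp

lemma abs_convD_le_convD_zero {α : ℝ} (hα : 1 < α) (n : ℕ) {J : Set ℝ} (hJ : MeasurableSet J)
    (hJ0 : J ⊆ Ioi 0) {f : ℝ → ℝ} (hf : IntegrableOn (fun y => f y / (1 + y ^ 2)) J)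
    (h0 : ∀ y ∈ J, 0 ≤ f y) {x : ℝ} (hx : 0 < x) :
    |convD α n J f x| ≤ kerDBound hα n * convD α 0 J f x := by
  rw [convD, convD, ← integral_const_mul, ← Real.norm_eq_abs]
  refine norm_integral_le_of_norm_le ((integrableOn_convD hα 0 hJ hJ0 hf hx).const_mul _)
    ((ae_restrict_iff' hJ).2 <| ae_of_all _ fun y hy => ?_)
  have hy0 : 0 < y := hJ0 hy
  rw [Real.norm_eq_abs, abs_div, abs_mul, abs_of_pos hy0, abs_of_nonneg (h0 y hy), kerD_zero,
    ← mul_div_assoc, ← mul_assoc]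
  exact div_le_div_of_nonneg_right (mul_le_mul_of_nonneg_right
    (abs_kerD_le hα n (div_pos hx hy0)) (h0 y hy)) hy0.le

lemma convD_rpow_growthExp_all {α : ℝ} (hα : 1 < α) (n : ℕ) {x : ℝ} (hx : 0 < x) :
    convD α n (Ici 1) (fun y => y ^ growthExp α) x =
      growthExp α ^ n * x ^ growthExp α - convD α n (Ioo 0 1) (fun y => y ^ growthExp α) x := by
  induction n generalizing x with
  | zero => rw [pow_zero, one_mul, convD_rpow_growthExp hα hx]
  | succ n ih =>
    have h1 := hasDerivAt_convD hα n measurableSet_Ici Ici_one_subset_Ioi_zero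
      (integrableOn_weight_rpow hα) hx
    have h2 := hasDerivAt_convD hα n measurableSet_Ioo Ioo_subset_Ioi_self
      (integrableOn_weight_rpow_Ioo hα) hx
    have h3 := ((Real.hasDerivAt_rpow_const (p := growthExp α) (Or.inl hx.ne')).const_mul
      (growthExp α ^ n)).sub h2
    have h4 := h3.congr_of_eventuallyEq (f₁ := convD α n (Ici 1) fun y => y ^ growthExp α) (by
      filter_upwards [Ioi_mem_nhds hx] with y hy using ih hy)
    have h5 := h1.unique h4
    rw [Real.rpow_sub_one hx.ne'] at h5
    field_simp at h5
    rw [h5]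
    ring

section Tau

variable {α : ℝ}

lemma tauF_nonneg (hα : 1 < α) (y : ℝ) : 0 ≤ tauF α y := by
  have := Sfun_nonneg hα (rhoC α * y)
  unfold tauF
  have : 0 < 1 + α := by linarith
  positivity

lemma tauF_one (α : ℝ) : tauF α 1 = 0 := by
  rw [tauF, Sfun_eq_zero (by rw [mul_one]), mul_zero]

lemma measurable_tauF (hα : 1 < α) : Measurable (tauF α) :=
  measurable_const.mul ((monotone_Sfun hα).measurable.comp (measurable_const.mul measurable_id))

lemma tauF_le (hα : 1 < α) {y : ℝ} (hy : 0 < y) :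
    tauF α y ≤ 2 * (1 + α) * (1 / π * rhoC α ^ growthExp α) * y ^ growthExp α := by
  have h := Sfun_le hα (mul_pos (rhoC_pos hα) hy)
  rw [Real.mul_rpow (rhoC_pos hα).le hy.le] at h
  unfold tauF
  rw [mul_assoc (2 * (1 + α)), mul_assoc (1 / π)]
  exact mul_le_mul_of_nonneg_left h (by linarith)

lemma integrableOn_weight_tauF (hα : 1 < α) :
    IntegrableOn (fun y => tauF α y / (1 + y ^ 2)) (Ici 1) :=
  integrableOn_weight_of_growth hα (measurable_tauF hα).aestronglyMeasurable fun y hy => by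
    rw [abs_of_nonneg (tauF_nonneg hα y)]
    exact tauF_le hα (zero_lt_one.trans_le hy)

lemma tauF_eq_convD (hα : 1 < α) {x : ℝ} (hx : 1 ≤ x) :
    tauF α x = convD α 0 (Ici 1) (tauF α) x - 2 := by
  have hρ := rhoC_pos hα
  have h1 := convD_Sfun hα (le_mul_of_one_le_right hρ.le hx)
  have h2 : convD α 0 (Ioi 0) (Sfun α) (rhoC α * x) =
      convD α 0 (Ici (rhoC α)) (Sfun α) (rhoC α * x) :=
    setIntegral_eq_of_subset_of_forall_sdiff_eq_zero measurableSet_Ioi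
      (fun y hy => show (0:ℝ) < y from hρ.trans_le hy) fun y hy => by
        rw [Sfun_eq_zero (not_le.1 hy.2).le, mul_zero, zero_div]
  rw [h2, convD_scale α 0 hρ] at h1
  have h3 : convD α 0 (Ici 1) (tauF α) x =
      2 * (1 + α) * convD α 0 (Ici 1) (fun t => Sfun α (rhoC α * t)) x :=
    convD_const_mul α 0 (Ici 1) (2 * (1 + α)) _ x
  rw [h3, h1, tauF]
  have : 1 + α ≠ 0 := by linarith
  field_simp
  ring

/-- The Euler derivative of `tauF` on `[1, ∞)`. -/
def tauD (α : ℝ) : ℝ → ℝ := convD α 1 (Ici 1) (tauF α)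

lemma hasDerivWithinAt_tauF (hα : 1 < α) {x : ℝ} (hx : 1 ≤ x) :
    HasDerivWithinAt (tauF α) (tauD α x / x) (Ici 1) x :=
  ((hasDerivAt_convD hα 0 measurableSet_Ici Ici_one_subset_Ioi_zero (integrableOn_weight_tauF hα)
    (zero_lt_one.trans_le hx)).sub_const 2).hasDerivWithinAt.congr
    (fun _ hy => tauF_eq_convD hα hy) (tauF_eq_convD hα hx)

lemma eulerDW_tauF (hα : 1 < α) {x : ℝ} (hx : 1 ≤ x) : eulerDW (Ici 1) (tauF α) x = tauD α x := by
  rw [eulerDW, (hasDerivWithinAt_tauF hα hx).derivWithin (uniqueDiffOn_Ici 1 x hx),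
    mul_div_cancel₀ _ (zero_lt_one.trans_le hx).ne']

lemma continuousOn_tauF (hα : 1 < α) : ContinuousOn (tauF α) (Ici 1) := fun _ hx =>
  (hasDerivWithinAt_tauF hα hx).continuousWithinAt

lemma continuousOn_tauD (hα : 1 < α) : ContinuousOn (tauD α) (Ici 1) :=
  (continuousOn_convD hα 1 measurableSet_Ici Ici_one_subset_Ioi_zero
    (integrableOn_weight_tauF hα)).mono Ici_one_subset_Ioi_zero

lemma integrableOn_weight_tauD (hα : 1 < α) :
    IntegrableOn (fun y => tauD α y / (1 + y ^ 2)) (Ici 1) := by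
  refine integrableOn_weight_of_growth hα (C := kerDBound hα 1 *
    (2 * (1 + α) * (1 / π * rhoC α ^ growthExp α) + 2))
    ((continuousOn_tauD hα).aestronglyMeasurable measurableSet_Ici) fun y hy => ?_
  have hy0 := zero_lt_one.trans_le hy
  have h1 := abs_convD_le_convD_zero hα 1 measurableSet_Ici Ici_one_subset_Ioi_zero
    (integrableOn_weight_tauF hα) (fun y _ => tauF_nonneg hα y) hy0
  refine h1.trans ?_
  rw [mul_assoc]
  refine mul_le_mul_of_nonneg_left ?_ (kerDBound_nonneg hα 1)
  have h2 := tauF_eq_convD hα hy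
  have h3 := tauF_le hα hy0
  have h4 := Real.one_le_rpow hy (growthExp_pos hα).le
  linarith

lemma tauD_eq_convD (hα : 1 < α) {x : ℝ} (hx : 0 < x) :
    convD α 0 (Ici 1) (tauD α) x = tauD α x := by
  have hd : ∀ y, 1 < y → HasDerivAt (fun y => Ka α (x / y) * tauF α y)
      (Ka α (x / y) * tauD α y / y - kerD α 1 (x / y) * tauF α y / y) y := fun y hy => by
    have hy0 := zero_lt_one.trans hy
    have h1 : HasDerivAt (fun y => Ka α (x / y)) (-kerD α 1 (x / y) / y) y := by
      have h2 : HasDerivAt (fun y => x / y) (-x / y ^ 2) y := by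
        refine ((hasDerivAt_inv hy0.ne').const_mul x).congr_deriv ?_
        field_simp
      refine ((hasDerivAt_kerD hα 0 (div_pos hx hy0)).comp y h2).congr_deriv ?_
      field_simp
    refine (h1.mul ((hasDerivWithinAt_tauF hα hy.le).hasDerivAt (Ici_mem_nhds hy))).congr_deriv ?_
    ring
  have i0 := integrableOn_convD hα 0 measurableSet_Ici Ici_one_subset_Ioi_zero
    (integrableOn_weight_tauD hα) hx
  simp only [kerD_zero] at i0
  have i1 := integrableOn_convD hα 1 measurableSet_Ici Ici_one_subset_Ioi_zero
    (integrableOn_weight_tauF hα) hx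
  have hcont : ContinuousWithinAt (fun y => Ka α (x / y) * tauF α y) (Ici 1) 1 := by
    have h1 : ContinuousAt (fun y => Ka α (x / y)) 1 :=
      (continuous_Ka hα).continuousAt.comp (continuousAt_const.div continuousAt_id one_ne_zero)
    exact h1.continuousWithinAt.mul (continuousOn_tauF hα 1 self_mem_Ici)
  have hlim : Tendsto (fun y => Ka α (x / y) * tauF α y) atTop (𝓝 0) := by
    set C := 2 * (1 + α) * (1 / π * rhoC α ^ growthExp α) with hC
    have h1 : Tendsto (fun y : ℝ => kerSup α * x * C * y ^ (-(1 - growthExp α))) atTop (𝓝 0) := by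
      have := (tendsto_rpow_neg_atTop (sub_pos.2 (growthExp_lt_one hα))).const_mul
        (kerSup α * x * C)
      rwa [mul_zero] at this
    refine squeeze_zero_norm' ?_ h1
    filter_upwards [eventually_gt_atTop 0] with y hy
    have hK0 := Ka_pos hα (div_pos hx hy)
    have hK : Ka α (x / y) ≤ kerSup α * x * y⁻¹ := by
      refine (Ka_le hα (div_pos hx hy)).trans ?_
      rw [mul_assoc, ← div_eq_mul_inv]
      exact mul_le_mul_of_nonneg_left (div_le_self (by positivity)
        (by nlinarith [sq_nonneg (x / y)])) (kerSup_pos hα).le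
    rw [Real.norm_of_nonneg (mul_nonneg hK0.le (tauF_nonneg hα y))]
    refine (mul_le_mul hK (tauF_le hα hy) (tauF_nonneg hα y) (hK0.le.trans hK)).trans_eq ?_
    rw [neg_sub, Real.rpow_sub_one hy.ne']
    ring
  have hI := integral_Ioi_of_hasDerivAt_of_tendsto hcont (fun y hy => hd y hy)
    ((i0.mono_set Ioi_subset_Ici_self).sub (i1.mono_set Ioi_subset_Ici_self)) hlim
  rw [tauF_one α, mul_zero, sub_zero, ← integral_Ici_eq_integral_Ioi, integral_sub i0 i1,
    sub_eq_zero] at hI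
  exact hI

lemma exists_tauF_sub_bound (hα : 1 < α) : ∃ C, ∀ y, 1 ≤ y →
    |tauF α y - Aconst α ^ growthExp α * y ^ growthExp α| ≤ C := by
  set c := Aconst α ^ growthExp α with hc
  set δ : ℝ → ℝ := fun y => tauF α y - c * y ^ growthExp α with hδ
  set e : ℝ → ℝ := fun x => -2 - c * convD α 0 (Ioo 0 1) (fun y => y ^ growthExp α) x with he
  have hcont : ContinuousOn δ (Ici 1) := (continuousOn_tauF hα).sub
    ((continuous_const.mul (Real.continuous_rpow_const (growthExp_pos hα).le)).continuousOn)
  have ho : Tendsto (fun x => x ^ (-growthExp α) * δ x) atTop (𝓝 0) := by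
    have h1 := (tendsto_rpow_neg_mul_tauF hα).sub_const c
    rw [sub_self] at h1
    refine h1.congr' ?_
    filter_upwards [eventually_gt_atTop 0] with x hx
    have : x ^ (-growthExp α) * x ^ growthExp α = 1 := by
      rw [← Real.rpow_add hx, neg_add_cancel, Real.rpow_zero]
    simp only [hδ]
    linear_combination c * this
  have hE : ∀ x, 1 ≤ x → |e x| ≤ 2 + |c| * (kerDBound hα 0 * kerSup α *
      ∫ y in Ioo (0:ℝ) 1, y ^ (growthExp α - 1)) := fun x hx => by
    have h1 := abs_convD_Ioo_le hα 0 (zero_lt_one.trans_le hx)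
    refine (abs_sub _ _).trans ?_
    rw [abs_mul, abs_neg, abs_two]
    gcongr
  refine ⟨_, fun y hy => abs_le_of_equation hα (r := fun _ => 0) (e := e) (R := 0) hcont ho
    aestronglyMeasurable_const
    (fun _ _ => by simp) hE (fun x hx => ?_) hy⟩
  have hx0 := zero_lt_one.trans_le hx
  have h1 := convD_add hα 0 measurableSet_Ici Ici_one_subset_Ioi_zero
    (integrableOn_weight_of_tendsto hα hcont ho)
    (((integrableOn_weight_rpow hα).const_mul c).congr (ae_of_all _ fun y =>
      (mul_div_assoc _ _ _).symm)) hx0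
  rw [convD_const_mul, convD_rpow_growthExp hα hx0] at h1
  simp only [hδ, sub_add_cancel] at h1
  have h2 := tauF_eq_convD hα hx
  simp only [add_zero, hδ, he]
  linear_combination h2 + h1

lemma exists_tauD_sub_bound (hα : 1 < α) : ∃ C, ∀ y, 1 ≤ y →
    |tauD α y - growthExp α * Aconst α ^ growthExp α * y ^ growthExp α| ≤ C := by
  obtain ⟨B, hB⟩ := exists_tauF_sub_bound hα
  set c := Aconst α ^ growthExp α with hc
  refine ⟨kerDBound hα 1 * B * kerMass α + |c| * (kerDBound hα 1 * kerSup α *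
      ∫ y in Ioo (0:ℝ) 1, y ^ (growthExp α - 1)), fun x hx => ?_⟩
  have hx0 := zero_lt_one.trans_le hx
  have i1 : IntegrableOn (fun y => c * y ^ growthExp α / (1 + y ^ 2)) (Ici 1) :=
    ((integrableOn_weight_rpow hα).const_mul c).congr
      (ae_of_all _ fun y => (mul_div_assoc _ _ _).symm)
  have i2 : IntegrableOn (fun y => (tauF α y - c * y ^ growthExp α) / (1 + y ^ 2)) (Ici 1) :=
    ((integrableOn_weight_tauF hα).sub i1).congr (ae_of_all _ fun y => (sub_div _ _ _).symm)
  have h1 := convD_add hα 1 measurableSet_Ici Ici_one_subset_Ioi_zero i2 i1 hx0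
  rw [convD_const_mul, convD_rpow_growthExp_all hα 1 hx0] at h1
  simp only [sub_add_cancel, pow_one] at h1
  have e1 : tauD α x - growthExp α * c * x ^ growthExp α =
      convD α 1 (Ici 1) (fun y => tauF α y - c * y ^ growthExp α) x -
        c * convD α 1 (Ioo 0 1) (fun y => y ^ growthExp α) x := by
    rw [tauD]; linear_combination h1
  rw [e1]
  refine (abs_sub _ _).trans ?_
  rw [abs_mul]
  have h2 := abs_convD_le hα 1 hB hx0
  have h3 := abs_convD_Ioo_le hα 1 hx0
  gcongr

end Tau

section LinearisedSolution

variable {α : ℝ}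

lemma growthExp_mul_inv (hα : 1 < α) : growthExp α * (2 * α / (1 + α)) = 1 := by
  unfold growthExp
  have : 1 + α ≠ 0 := by linarith
  have : α ≠ 0 := by linarith
  field_simp

lemma rpow_neg_mul_rpow {x : ℝ} (hx : 0 < x) (β : ℝ) : x ^ (-β) * x ^ β = 1 := by
  rw [← Real.rpow_add hx, neg_add_cancel, Real.rpow_zero]

lemma tendsto_rpow_neg_mul_of_bound (hα : 1 < α) {f : ℝ → ℝ} {ℓ C : ℝ}
    (h : ∀ y, 1 ≤ y → |f y - ℓ * y ^ growthExp α| ≤ C) :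
    Tendsto (fun x => x ^ (-growthExp α) * f x) atTop (𝓝 ℓ) := by
  have h1 : Tendsto (fun x : ℝ => x ^ (-growthExp α) * C) atTop (𝓝 0) := by
    have := (tendsto_rpow_neg_atTop (growthExp_pos hα)).mul_const C
    rwa [zero_mul] at this
  rw [tendsto_iff_norm_sub_tendsto_zero]
  refine squeeze_zero' (Eventually.of_forall fun _ => norm_nonneg _) ?_ h1
  filter_upwards [eventually_ge_atTop 1] with x hx
  have hx0 := zero_lt_one.trans_le hx
  have e : x ^ (-growthExp α) * f x - ℓ =
      x ^ (-growthExp α) * (f x - ℓ * x ^ growthExp α) := by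
    linear_combination ℓ * rpow_neg_mul_rpow hx0 (growthExp α)
  rw [e, norm_mul, Real.norm_of_nonneg (Real.rpow_nonneg hx0.le _)]
  exact mul_le_mul_of_nonneg_left (h x hx) (Real.rpow_nonneg hx0.le _)

lemma lbar_eq (hα : 1 < α) (ω p : ℝ) {x : ℝ} (hx : 1 ≤ x) :
    lbar α ω p x = p * tauF α x -
      2 * α / (1 + α) * (p - (ω / Aconst α) ^ growthExp α) * tauD α x := by
  rw [lbar, eulerDW_tauF hα hx, growthExp]

lemma continuousOn_lbar (hα : 1 < α) (ω p : ℝ) : ContinuousOn (lbar α ω p) (Ici 1) :=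
  ((continuousOn_const.mul (continuousOn_tauF hα)).sub
    (continuousOn_const.mul (continuousOn_tauD hα))).congr fun _ hx => lbar_eq hα ω p hx

lemma tendsto_rpow_neg_mul_lbar (hα : 1 < α) {ω : ℝ} (hω : 0 < ω) (p : ℝ) :
    Tendsto (fun x => x ^ (-growthExp α) * lbar α ω p x) atTop (𝓝 (ω ^ growthExp α)) := by
  obtain ⟨C, hC⟩ := exists_tauD_sub_bound hα
  have h1 := (tendsto_rpow_neg_mul_tauF hα).const_mul p
  have h2 := (tendsto_rpow_neg_mul_of_bound hα hC).const_mul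
    (2 * α / (1 + α) * (p - (ω / Aconst α) ^ growthExp α))
  have hA := Aconst_pos hα
  have e : p * Aconst α ^ growthExp α - 2 * α / (1 + α) * (p - (ω / Aconst α) ^ growthExp α) *
      (growthExp α * Aconst α ^ growthExp α) = ω ^ growthExp α := by
    have h3 : (ω / Aconst α) ^ growthExp α * Aconst α ^ growthExp α = ω ^ growthExp α := by
      rw [← Real.mul_rpow (by positivity) hA.le, div_mul_cancel₀ _ hA.ne']
    linear_combination h3 - (p - (ω / Aconst α) ^ growthExp α) * Aconst α ^ growthExp α *
      growthExp_mul_inv hα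
  have h3 := h1.sub h2
  rw [e] at h3
  refine h3.congr' ?_
  filter_upwards [eventually_ge_atTop 1] with x hx
  rw [lbar_eq hα ω p hx]
  ring

lemma integrableOn_weight_lbar (hα : 1 < α) {ω : ℝ} (hω : 0 < ω) (p : ℝ) :
    IntegrableOn (fun y => lbar α ω p y / (1 + y ^ 2)) (Ici 1) :=
  integrableOn_weight_of_tendsto hα (continuousOn_lbar hα ω p) (tendsto_rpow_neg_mul_lbar hα hω p)

lemma lbar_eq_convD (hα : 1 < α) (ω p : ℝ) {x : ℝ} (hx : 1 ≤ x) :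
    lbar α ω p x = convD α 0 (Ici 1) (lbar α ω p) x - 2 * p := by
  have hx0 := zero_lt_one.trans_le hx
  set c := 2 * α / (1 + α) * (p - (ω / Aconst α) ^ growthExp α) with hc
  have i1 : IntegrableOn (fun y => p * tauF α y / (1 + y ^ 2)) (Ici 1) :=
    ((integrableOn_weight_tauF hα).const_mul p).congr
      (ae_of_all _ fun y => (mul_div_assoc _ _ _).symm)
  have i2 : IntegrableOn (fun y => -c * tauD α y / (1 + y ^ 2)) (Ici 1) :=
    ((integrableOn_weight_tauD hα).const_mul (-c)).congr
      (ae_of_all _ fun y => (mul_div_assoc _ _ _).symm)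
  have h1 := convD_add hα 0 measurableSet_Ici Ici_one_subset_Ioi_zero i1 i2 hx0
  rw [convD_const_mul, convD_const_mul, tauD_eq_convD hα hx0] at h1
  rw [convD_congr α 0 measurableSet_Ici (g := fun y => p * tauF α y + -c * tauD α y)
    (fun y hy => by rw [lbar_eq hα ω p hy]; ring), h1, lbar_eq hα ω p hx]
  linear_combination p * tauF_eq_convD hα hx

end LinearisedSolution

section IteratedPrimitive

variable {α : ℝ}

/-- The iterated Euler derivatives `Dⁿ F_α`. -/
def faD (α : ℝ) : ℕ → ℝ → ℝ
  | 0 => Fa α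
  | n + 1 => kerD α n

lemma hasDerivAt_faD (hα : 1 < α) (n : ℕ) {x : ℝ} (hx : 0 < x) :
    HasDerivAt (faD α n) (faD α (n + 1) x / x) x := by
  cases n with
  | zero => exact hasDerivAt_Fa hα hx.ne'
  | succ n => exact hasDerivAt_kerD hα n hx

/-- A bound for `|Dⁿ F_α|` on the positive half-line. -/
def faDBound (hα : 1 < α) : ℕ → ℝ
  | 0 => kerMass α
  | n + 1 => kerDBound hα n * kerSup α

lemma faDBound_nonneg (hα : 1 < α) (n : ℕ) : 0 ≤ faDBound hα n := by
  cases n with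
  | zero => exact (kerMass_pos hα).le
  | succ n => exact mul_nonneg (kerDBound_nonneg hα n) (kerSup_pos hα).le

lemma abs_faD_le (hα : 1 < α) (n : ℕ) {x : ℝ} (hx : 0 < x) : |faD α n x| ≤ faDBound hα n := by
  cases n with
  | zero =>
    rw [faD, abs_of_nonneg (Fa_nonneg hα hx.le)]
    exact Fa_le_kerMass hα x
  | succ n =>
    exact (abs_kerD_le hα n hx).trans
      (mul_le_mul_of_nonneg_left (Ka_le_kerSup hα hx) (kerDBound_nonneg hα n))

end IteratedPrimitive

namespace StdIBASolution

variable {α p : ℝ} {H : ℕ} (S : StdIBASolution α p H)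

/-- The rescaled solution `ξ ↦ z(ωξ)`. -/
def zr (ξ : ℝ) : ℝ := S.z (S.ω * ξ)

/-- The error made in replacing the rescaled solution by its rounding. -/
def roundErr (ξ : ℝ) : ℝ := (⌈S.zr ξ - 1 / 2⌉ : ℝ) - S.zr ξ

/-- The iterated Euler derivatives of the contribution of the holes. -/
def holeD (n : ℕ) (ξ : ℝ) : ℝ := H * faD α n ξ - ∑ i, faD α n (S.ω * ξ / S.h i)

lemma h_pos (i : Fin H) : 0 < S.h i := S.ωpos.trans (S.hgt i)

lemma hasDerivAt_holeD (hα : 1 < α) (n : ℕ) {ξ : ℝ} (hξ : 0 < ξ) :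
    HasDerivAt (S.holeD n) (S.holeD (n + 1) ξ / ξ) ξ := by
  have h1 := (hasDerivAt_faD hα n hξ).const_mul (H : ℝ)
  have h2 : ∀ i ∈ Finset.univ, HasDerivAt (fun ξ => faD α n (S.ω * ξ / S.h i))
      (faD α (n + 1) (S.ω * ξ / S.h i) / ξ) ξ := fun i _ => by
    have hω := S.ωpos
    have hh := S.h_pos i
    have h3 : HasDerivAt (fun ξ => S.ω * ξ / S.h i) (S.ω * 1 / S.h i) ξ :=
      ((hasDerivAt_id ξ).const_mul S.ω).div_const (S.h i)
    refine ((hasDerivAt_faD hα n (by positivity)).comp ξ h3).congr_deriv ?_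
    field_simp
  refine (h1.sub (HasDerivAt.fun_sum h2)).congr_deriv ?_
  rw [holeD, sub_div, mul_div_assoc, Finset.sum_div]

lemma abs_holeD_le (hα : 1 < α) (n : ℕ) {ξ : ℝ} (hξ : 0 < ξ) :
    |S.holeD n ξ| ≤ 2 * H * faDBound hα n := by
  have h1 : |∑ i, faD α n (S.ω * ξ / S.h i)| ≤ H * faDBound hα n := by
    refine (Finset.abs_sum_le_sum_abs _ _).trans ?_
    refine (Finset.sum_le_card_nsmul _ _ (faDBound hα n) fun i _ => ?_).trans_eq (by simp)
    exact abs_faD_le hα n (div_pos (mul_pos S.ωpos hξ) (S.h_pos i))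
  have h2 : |(H : ℝ) * faD α n ξ| ≤ H * faDBound hα n := by
    rw [abs_mul, Nat.abs_cast]
    exact mul_le_mul_of_nonneg_left (abs_faD_le hα n hξ) (Nat.cast_nonneg H)
  refine (abs_sub _ _).trans ?_
  linarith

lemma abs_holeD_zero_le (hα : 1 < α) {ξ : ℝ} (hξ : 0 < ξ) : |S.holeD 0 ξ| ≤ H * kerMass α := by
  have h1 : ∑ i, faD α 0 (S.ω * ξ / S.h i) ≤ H * kerMass α := by
    refine (Finset.sum_le_card_nsmul _ _ (kerMass α) fun i _ => ?_).trans_eq (by simp)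
    exact Fa_le_kerMass hα _
  have h2 : 0 ≤ ∑ i, faD α 0 (S.ω * ξ / S.h i) := Finset.sum_nonneg fun i _ =>
    Fa_nonneg hα (div_pos (mul_pos S.ωpos hξ) (S.h_pos i)).le
  have h3 : (H : ℝ) * Fa α ξ ≤ H * kerMass α :=
    mul_le_mul_of_nonneg_left (Fa_le_kerMass hα ξ) (Nat.cast_nonneg H)
  have h4 : 0 ≤ (H : ℝ) * Fa α ξ := mul_nonneg (Nat.cast_nonneg H) (Fa_nonneg hα hξ.le)
  rw [abs_le]
  unfold holeD
  change -_ ≤ (H : ℝ) * Fa α ξ - _ ∧ (H : ℝ) * Fa α ξ - _ ≤ _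
  constructor <;> linarith

lemma abs_roundErr_le (ξ : ℝ) : |S.roundErr ξ| ≤ 1 / 2 := by
  have h1 := Int.le_ceil (S.zr ξ - 1 / 2)
  have h2 := Int.ceil_lt_add_one (S.zr ξ - 1 / 2)
  rw [abs_le]
  unfold roundErr
  constructor <;> linarith

lemma continuousOn_zr : ContinuousOn S.zr (Ici 1) :=
  S.zcont.comp (continuous_const.mul continuous_id).continuousOn fun _ hξ =>
    le_mul_of_one_le_right S.ωpos.le hξ

lemma aestronglyMeasurable_roundErr :
    AEStronglyMeasurable S.roundErr (volume.restrict (Ici 1)) := by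
  have hz := S.continuousOn_zr.aestronglyMeasurable (μ := volume) measurableSet_Ici
  have hm : Measurable fun t : ℝ => (⌈t - 1 / 2⌉ : ℝ) := by fun_prop
  exact (hm.comp_aemeasurable hz.aemeasurable).aestronglyMeasurable.sub hz

lemma tendsto_rpow_neg_mul_zr :
    Tendsto (fun ξ => ξ ^ (-growthExp α) * S.zr ξ) atTop (𝓝 (S.ω ^ growthExp α)) := by
  have h1 := (S.znorm.comp (tendsto_id.const_mul_atTop S.ωpos)).const_mul (S.ω ^ growthExp α)
  rw [mul_one] at h1
  refine h1.congr' ?_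
  filter_upwards [eventually_gt_atTop 0] with ξ hξ
  have h2 := rpow_neg_mul_rpow S.ωpos (growthExp α)
  simp only [Function.comp, id]
  change S.ω ^ growthExp α * ((S.ω * ξ) ^ (-growthExp α) * S.zr ξ) = _
  rw [Real.mul_rpow S.ωpos.le hξ.le]
  linear_combination ξ ^ (-growthExp α) * S.zr ξ * h2

lemma zr_eq {ξ : ℝ} (hξ : 1 ≤ ξ) : S.zr ξ = -2 * p +
    convD α 0 (Ici 1) (fun y => S.zr y + S.roundErr y) ξ + S.holeD 0 ξ := by
  have h1 := S.iba (S.ω * ξ) (le_mul_of_one_le_right S.ωpos.le hξ)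
  rw [← convD_zero, convD_scale α 0 S.ωpos, mul_div_cancel_left₀ _ S.ωpos.ne'] at h1
  have h2 : (fun y => S.zr y + S.roundErr y) = fun y => (⌈S.z (S.ω * y) - 1 / 2⌉ : ℝ) :=
    funext fun y => add_sub_cancel _ _
  rw [h2, zr, h1, holeD]
  simp only [faD]
  ring

lemma integrableOn_weight_zr (hα : 1 < α) :
    IntegrableOn (fun y => S.zr y / (1 + y ^ 2)) (Ici 1) :=
  integrableOn_weight_of_tendsto hα S.continuousOn_zr S.tendsto_rpow_neg_mul_zr

lemma integrableOn_weight_roundErr :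
    IntegrableOn (fun y => S.roundErr y / (1 + y ^ 2)) (Ici 1) :=
  integrableOn_weight_of_bounded S.aestronglyMeasurable_roundErr fun y _ => S.abs_roundErr_le y

/-- The deviation `λ` of the rescaled solution from the linearised one. -/
def linDev (ξ : ℝ) : ℝ := S.zr ξ - lbar α S.ω p ξ

/-- The deviation of the rescaled solution from its leading power. -/
def powDev (ξ : ℝ) : ℝ := S.zr ξ - S.ω ^ growthExp α * ξ ^ growthExp α

lemma integrableOn_weight_add_roundErr {f : ℝ → ℝ}
    (hf : IntegrableOn (fun y => f y / (1 + y ^ 2)) (Ici 1)) :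
    IntegrableOn (fun y => (f y + S.roundErr y) / (1 + y ^ 2)) (Ici 1) :=
  (hf.add S.integrableOn_weight_roundErr).congr (ae_of_all _ fun _ => (add_div _ _ _).symm)

lemma continuousOn_linDev (hα : 1 < α) : ContinuousOn S.linDev (Ici 1) :=
  S.continuousOn_zr.sub (continuousOn_lbar hα S.ω p)

lemma tendsto_rpow_neg_mul_linDev (hα : 1 < α) :
    Tendsto (fun x => x ^ (-growthExp α) * S.linDev x) atTop (𝓝 0) := by
  have h := S.tendsto_rpow_neg_mul_zr.sub (tendsto_rpow_neg_mul_lbar hα S.ωpos p)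
  rw [sub_self] at h
  exact h.congr fun x => (mul_sub _ _ _).symm

lemma integrableOn_weight_linDev (hα : 1 < α) :
    IntegrableOn (fun y => S.linDev y / (1 + y ^ 2)) (Ici 1) :=
  integrableOn_weight_of_tendsto hα (S.continuousOn_linDev hα) (S.tendsto_rpow_neg_mul_linDev hα)

lemma linDev_eq (hα : 1 < α) {ξ : ℝ} (hξ : 1 ≤ ξ) : S.linDev ξ =
    convD α 0 (Ici 1) (fun y => S.linDev y + S.roundErr y) ξ + S.holeD 0 ξ := by
  have h := convD_add hα 0 measurableSet_Ici Ici_one_subset_Ioi_zero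
    (S.integrableOn_weight_add_roundErr (S.integrableOn_weight_linDev hα))
    (integrableOn_weight_lbar hα S.ωpos p) (zero_lt_one.trans_le hξ)
  rw [convD_congr α 0 measurableSet_Ici (g := fun y => S.zr y + S.roundErr y)
    (fun y _ => by rw [linDev]; ring)] at h
  rw [linDev, S.zr_eq hξ, lbar_eq_convD hα S.ω p hξ, h]
  ring

lemma abs_linDev_le (hα : 1 < α) {ξ : ℝ} (hξ : 1 ≤ ξ) :
    |S.linDev ξ| ≤ ((H : ℝ) + 1 / 4) * (α - 1) := by
  refine (abs_le_of_equation hα (S.continuousOn_linDev hα) (S.tendsto_rpow_neg_mul_linDev hα)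
    S.aestronglyMeasurable_roundErr (fun y _ => S.abs_roundErr_le y)
    (fun x hx => S.abs_holeD_zero_le hα (zero_lt_one.trans_le hx))
    (fun x hx => S.linDev_eq hα hx) hξ).trans ?_
  rw [one_sub_kerMass hα, kerMass]
  have h1 : α + 1 ≠ 0 := by linarith
  have h2 : (1 / 2 * ((α - 1) / (α + 1)) + H * ((α - 1) / (α + 1))) / (2 / (α + 1)) =
      ((H : ℝ) / 2 + 1 / 4) * (α - 1) := by
    field_simp
    ring
  rw [h2]
  have h3 : (0 : ℝ) ≤ H := Nat.cast_nonneg H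
  exact mul_le_mul_of_nonneg_right (by linarith) (by linarith)

lemma iterate_eulerDW_linDev (hα : 1 < α) (n : ℕ) {ξ : ℝ} (hξ : 1 ≤ ξ) :
    (eulerDW (Ici 1))^[n] S.linDev ξ =
      convD α n (Ici 1) (fun y => S.linDev y + S.roundErr y) ξ + S.holeD n ξ := by
  refine iterate_eulerDW_eq one_pos
    (F := fun n x => convD α n (Ici 1) (fun y => S.linDev y + S.roundErr y) x + S.holeD n x)
    (fun n x hx => ?_) (fun x hx => S.linDev_eq hα hx) n hξ
  have hx0 := zero_lt_one.trans_le hx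
  refine (((hasDerivAt_convD hα n measurableSet_Ici Ici_one_subset_Ioi_zero
    (S.integrableOn_weight_add_roundErr (S.integrableOn_weight_linDev hα)) hx0).add
    (S.hasDerivAt_holeD hα n hx0)).congr_deriv ?_).hasDerivWithinAt
  rw [add_div]

lemma abs_iterate_eulerDW_linDev_le (hα : 1 < α) (n : ℕ) {ξ : ℝ} (hξ : 1 ≤ ξ) :
    |(eulerDW (Ici 1))^[n] S.linDev ξ| ≤
      kerDBound hα n * (((H : ℝ) + 1 / 4) * (α - 1) + 1 / 2) * kerMass α +
        2 * H * faDBound hα n := by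
  rw [S.iterate_eulerDW_linDev hα n hξ]
  have hξ0 := zero_lt_one.trans_le hξ
  exact (abs_add_le _ _).trans (add_le_add
    (abs_convD_le hα n (fun y hy => (abs_add_le _ _).trans
      (add_le_add (S.abs_linDev_le hα hy) (S.abs_roundErr_le y))) hξ0)
    (S.abs_holeD_le hα n hξ0))

lemma continuousOn_powDev (hα : 1 < α) : ContinuousOn S.powDev (Ici 1) :=
  S.continuousOn_zr.sub (continuous_const.mul
    (Real.continuous_rpow_const (growthExp_pos hα).le)).continuousOn

lemma tendsto_rpow_neg_mul_powDev :
    Tendsto (fun x => x ^ (-growthExp α) * S.powDev x) atTop (𝓝 0) := by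
  have h := S.tendsto_rpow_neg_mul_zr.sub_const (S.ω ^ growthExp α)
  rw [sub_self] at h
  refine h.congr' ?_
  filter_upwards [eventually_gt_atTop 0] with x hx
  rw [powDev]
  linear_combination S.ω ^ growthExp α * rpow_neg_mul_rpow hx (growthExp α)

lemma integrableOn_weight_powDev (hα : 1 < α) :
    IntegrableOn (fun y => S.powDev y / (1 + y ^ 2)) (Ici 1) :=
  integrableOn_weight_of_tendsto hα (S.continuousOn_powDev hα) S.tendsto_rpow_neg_mul_powDev

/-- The remainder left when the kernel acts on the full power rather than on its restriction. -/
def powRem (n : ℕ) (ξ : ℝ) : ℝ :=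
  S.ω ^ growthExp α * convD α n (Ioo 0 1) (fun y => y ^ growthExp α) ξ

lemma convD_zr_add_roundErr (hα : 1 < α) (n : ℕ) {ξ : ℝ} (hξ : 0 < ξ) :
    convD α n (Ici 1) (fun y => S.zr y + S.roundErr y) ξ =
      convD α n (Ici 1) (fun y => S.powDev y + S.roundErr y) ξ - S.powRem n ξ +
        growthExp α ^ n * (S.ω ^ growthExp α * ξ ^ growthExp α) := by
  have i1 : IntegrableOn
      (fun y => S.ω ^ growthExp α * y ^ growthExp α / (1 + y ^ 2)) (Ici 1) :=
    ((integrableOn_weight_rpow hα).const_mul (S.ω ^ growthExp α)).congr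
      (ae_of_all _ fun y => (mul_div_assoc _ _ _).symm)
  have h := convD_add hα n measurableSet_Ici Ici_one_subset_Ioi_zero
    (S.integrableOn_weight_add_roundErr (S.integrableOn_weight_powDev hα)) i1 hξ
  rw [convD_congr α n measurableSet_Ici (g := fun y => S.zr y + S.roundErr y)
    (fun y _ => by rw [powDev]; ring), convD_const_mul, convD_rpow_growthExp_all hα n hξ] at h
  rw [h, powRem]
  ring

/-- The iterated Euler derivatives of the bounded part of the source term. -/
def powSource (n : ℕ) (ξ : ℝ) : ℝ := S.holeD n ξ - (if n = 0 then 2 * p else 0) - S.powRem n ξ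

lemma exists_abs_powSource_le (hα : 1 < α) (n : ℕ) :
    ∃ E, ∀ ξ, 1 ≤ ξ → |S.powSource n ξ| ≤ E := by
  refine ⟨2 * H * faDBound hα n + |if n = 0 then 2 * p else 0| + S.ω ^ growthExp α *
    (kerDBound hα n * kerSup α * ∫ y in Ioo (0 : ℝ) 1, y ^ (growthExp α - 1)), fun ξ hξ => ?_⟩
  have hξ0 := zero_lt_one.trans_le hξ
  refine (abs_sub _ _).trans (add_le_add ((abs_sub _ _).trans
    (add_le_add_left (S.abs_holeD_le hα n hξ0) _)) ?_)
  have hω := Real.rpow_nonneg S.ωpos.le (growthExp α)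
  rw [powRem, abs_mul, abs_of_nonneg hω]
  exact mul_le_mul_of_nonneg_left (abs_convD_Ioo_le hα n hξ0) hω

lemma powDev_eq (hα : 1 < α) {ξ : ℝ} (hξ : 1 ≤ ξ) : S.powDev ξ =
    convD α 0 (Ici 1) (fun y => S.powDev y + S.roundErr y) ξ + S.powSource 0 ξ := by
  rw [powDev, S.zr_eq hξ, S.convD_zr_add_roundErr hα 0 (zero_lt_one.trans_le hξ), powSource,
    if_pos rfl]
  ring

lemma exists_abs_powDev_le (hα : 1 < α) : ∃ B, ∀ ξ, 1 ≤ ξ → |S.powDev ξ| ≤ B := by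
  obtain ⟨E, hE⟩ := S.exists_abs_powSource_le hα 0
  exact ⟨_, fun ξ hξ => abs_le_of_equation hα (S.continuousOn_powDev hα)
    S.tendsto_rpow_neg_mul_powDev S.aestronglyMeasurable_roundErr
    (fun y _ => S.abs_roundErr_le y) hE (fun x hx => S.powDev_eq hα hx) hξ⟩

lemma iterate_eulerDW_z (hα : 1 < α) (n : ℕ) {x : ℝ} (hx : S.ω ≤ x) :
    (eulerDW (Ici S.ω))^[n] S.z x =
      convD α n (Ici 1) (fun y => S.zr y + S.roundErr y) (x / S.ω) + S.holeD n (x / S.ω) -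
        if n = 0 then 2 * p else 0 := by
  have hω := S.ωpos
  refine iterate_eulerDW_eq hω
    (F := fun n x => convD α n (Ici 1) (fun y => S.zr y + S.roundErr y) (x / S.ω) +
      S.holeD n (x / S.ω) - if n = 0 then 2 * p else 0)
    (fun n x hx => ?_) (fun x hx => ?_) n hx
  · have hx0 := hω.trans_le hx
    have h1 := (((hasDerivAt_convD hα n measurableSet_Ici Ici_one_subset_Ioi_zero
      (S.integrableOn_weight_add_roundErr (S.integrableOn_weight_zr hα)) (div_pos hx0 hω)).add
      (S.hasDerivAt_holeD hα n (div_pos hx0 hω))).sub_const (if n = 0 then 2 * p else 0)).comp x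
        ((hasDerivAt_id x).div_const S.ω)
    refine (h1.congr_deriv ?_).hasDerivWithinAt
    rw [if_neg n.succ_ne_zero]
    field_simp
    ring
  · have h1 := S.zr_eq ((one_le_div hω).2 hx)
    rw [zr, mul_div_cancel₀ _ hω.ne'] at h1
    rw [h1, if_pos rfl]
    ring

lemma exists_abs_iterate_eulerDW_z_sub_le (hα : 1 < α) (n : ℕ) : ∃ M, ∀ x, S.ω ≤ x →
    |(eulerDW (Ici S.ω))^[n] S.z x - growthExp α ^ n * x ^ growthExp α| ≤ M := by
  obtain ⟨B, hB⟩ := S.exists_abs_powDev_le hα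
  obtain ⟨E, hE⟩ := S.exists_abs_powSource_le hα n
  refine ⟨kerDBound hα n * (B + 1 / 2) * kerMass α + E, fun x hx => ?_⟩
  have hω := S.ωpos
  have hξ : 1 ≤ x / S.ω := (one_le_div hω).2 hx
  have hξ0 := zero_lt_one.trans_le hξ
  have h1 : S.ω ^ growthExp α * (x / S.ω) ^ growthExp α = x ^ growthExp α := by
    rw [← Real.mul_rpow hω.le hξ0.le, mul_div_cancel₀ _ hω.ne']
  have h2 : (eulerDW (Ici S.ω))^[n] S.z x - growthExp α ^ n * x ^ growthExp α =
      convD α n (Ici 1) (fun y => S.powDev y + S.roundErr y) (x / S.ω) +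
        S.powSource n (x / S.ω) := by
    rw [S.iterate_eulerDW_z hα n hx, S.convD_zr_add_roundErr hα n hξ0, h1, powSource]
    ring
  rw [h2]
  exact (abs_add_le _ _).trans (add_le_add (abs_convD_le hα n (fun y hy => (abs_add_le _ _).trans
    (add_le_add (hB y hy) (S.abs_roundErr_le y))) hξ0) (hE _ hξ))

end StdIBASolution

theorem statement16 (α : ℝ) (hα : 1 < α) (H : ℕ) :
    -- (i) Dⁿz − ((α+1)/(2α))ⁿ x^{(1+α)/(2α)} is bounded on [ω,∞)
    (∀ p : ℝ, 0 ≤ p → ∀ S : StdIBASolution α p H, ∀ n : ℕ,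
      ∃ M : ℝ, ∀ x : ℝ, S.ω ≤ x →
        |(eulerDW (Set.Ici S.ω))^[n] S.z x - ((α + 1) / (2 * α)) ^ n * x ^ ((1 + α) / (2 * α))|
          ≤ M) ∧
    -- (ii) sup |λ| ≤ (H + 1/4)(α − 1), where λ(ξ) = z(ωξ) − l̄(ξ; ω, p)
    (∀ p : ℝ, 0 ≤ p → ∀ S : StdIBASolution α p H, ∀ ξ : ℝ, 1 ≤ ξ →
      |S.z (S.ω * ξ) - lbar α S.ω p ξ| ≤ ((H : ℝ) + 1/4) * (α - 1)) ∧
    -- and for every n ≥ 1, sup |Dⁿλ| ≤ C_n with C_n depending only on α, H, n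
    (∀ n : ℕ, 1 ≤ n → ∃ C : ℝ, 0 < C ∧
      ∀ p : ℝ, 0 ≤ p → ∀ S : StdIBASolution α p H, ∀ ξ : ℝ, 1 ≤ ξ →
        |(eulerDW (Set.Ici 1))^[n] (fun t => S.z (S.ω * t) - lbar α S.ω p t) ξ| ≤ C) := by
  refine ⟨fun p _ S n => ?_, fun p _ S ξ hξ => S.abs_linDev_le hα hξ, fun n _ => ?_⟩
  · rw [add_comm α 1]
    exact S.exists_abs_iterate_eulerDW_z_sub_le hα n
  · have h1 := kerDBound_nonneg hα n
    have h2 := (kerMass_pos hα).le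
    have h3 := faDBound_nonneg hα n
    have h4 : 0 ≤ α - 1 := by linarith
    exact ⟨kerDBound hα n * (((H : ℝ) + 1 / 4) * (α - 1) + 1 / 2) * kerMass α +
      2 * H * faDBound hα n + 1, by positivity, fun p _ S ξ hξ =>
        (S.abs_iterate_eulerDW_linDev_le hα n hξ).trans (le_add_of_nonneg_right zero_le_one)⟩
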